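/- Under hypotheses (H0)-(H4), for every t > ρ(P), every a ∈ Γ₊^t, and every sequence of points z_n ∈ ℤ^{d-1} × ℕ with |z_n| → ∞ and dist(V_t(a), z_n/|z_n|) → 0, one has lim_{n→∞} K_t(z, z_n) = h_{a,t}(z)/h_{a,t}(z₀) for every z ∈ ℤ^{d-1} × ℕ. -/

import Mathlib

open scoped Classical BigOperators
open Filter

noncomputable section

namespace RWHalfspace

/-- `ℤ^d` modeled as `ℤ^{d-1} × ℤ`; the Lean parameter `d` is the paper's `d-1`,
so that the paper's hypothesis `d ≥ 1` is automatic. -/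
abbrev Zd (d : ℕ) := (Fin d → ℤ) × ℤ
/-- The state space `E = ℤ^{d-1} × ℕ`. -/
abbrev Ed (d : ℕ) := (Fin d → ℤ) × ℕ
/-- `ℝ^d` modeled as `ℝ^{d-1} × ℝ`. -/
abbrev Rd (d : ℕ) := (Fin d → ℝ) × ℝ

variable {d : ℕ}

/-- The scalar product `a · z` for `a ∈ ℝ^d`, `z ∈ ℤ^d`. -/
def dotZ (a : Rd d) (z : Zd d) : ℝ := (∑ i, a.1 i * (z.1 i : ℝ)) + a.2 * (z.2 : ℝ)

/-- The scalar product on `ℝ^d`. -/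
def dotR (a b : Rd d) : ℝ := (∑ i, a.1 i * b.1 i) + a.2 * b.2

/-- The scalar product `a · z` for `a ∈ ℝ^d`, `z ∈ E = ℤ^{d-1} × ℕ`. -/
def dotE (a : Rd d) (z : Ed d) : ℝ := (∑ i, a.1 i * (z.1 i : ℝ)) + a.2 * (z.2 : ℝ)

/-- The jump generating function `φ(a) = ∑_{z ∈ ℤ^d} μ(z) e^{a·z}`. -/
def phi (μ : Zd d → ℝ) (a : Rd d) : ℝ := ∑' z, μ z * Real.exp (dotZ a z)

/-- The difference `z' - z ∈ ℤ^d` of two points of `E`. -/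
def jump (z z' : Ed d) : Zd d := (z'.1 - z.1, (z'.2 : ℤ) - (z.2 : ℤ))

/-- The transition kernel of the reflected random walk on `E = ℤ^{d-1} × ℕ`. -/
def ker (μ μ₀ : Zd d → ℝ) (z z' : Ed d) : ℝ :=
  if z.2 = 0 then μ₀ (jump z z') else μ (jump z z')

/-- The `n`-step transition kernel `p^(n)`. -/
def kerN (μ μ₀ : Zd d → ℝ) : ℕ → Ed d → Ed d → ℝ
  | 0 => fun z z' => if z = z' then 1 else 0
  | n + 1 => fun z z' => ∑' w, kerN μ μ₀ n z w * ker μ μ₀ w z'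

/-- The `n`-step kernel of the homogeneous random walk on `ℤ^d` with step distribution `μ`. -/
def homN (μ : Zd d → ℝ) : ℕ → Zd d → Zd d → ℝ
  | 0 => fun z z' => if z = z' then 1 else 0
  | n + 1 => fun z z' => ∑' w, homN μ n z w * μ (z' - w)

/-- The step distribution of the last coordinate of the homogeneous random walk. -/
def lastStep (μ : Zd d → ℝ) (k : ℤ) : ℝ := ∑' x : Fin d → ℤ, μ (x, k)

/-- The `n`-step kernel of the last coordinate random walk on `ℤ`. -/
def lastN (μ : Zd d → ℝ) : ℕ → ℤ → ℤ → ℝ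
  | 0 => fun k k' => if k = k' then 1 else 0
  | n + 1 => fun k k' => ∑' j, lastN μ n k j * lastStep μ (k' - j)

/-- The convergence norm `ρ(P) = limsup_n (p^(n)(z,z'))^{1/n}` (independent of `z, z'`
by irreducibility; we take `z = z' = 0`). -/
def rho (μ μ₀ : Zd d → ℝ) : ℝ :=
  limsup (fun n : ℕ => (kerN μ μ₀ n 0 0) ^ ((n : ℝ)⁻¹)) atTop

/-- `μ` is a nonnegative measure on `ℤ^d` with `0 < μ(ℤ^d) ≤ 1`. -/
def IsMeasure (μ : Zd d → ℝ) : Prop := (∀ z, 0 ≤ μ z) ∧ 0 < ∑' z, μ z ∧ ∑' z, μ z ≤ 1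

/-- (H0): `μ(x,y) = 0` for `y < -1` and `μ₀(x,y) = 0` for `y < 0`. -/
def H0 (μ μ₀ : Zd d → ℝ) : Prop :=
  (∀ z : Zd d, z.2 < -1 → μ z = 0) ∧ (∀ z : Zd d, z.2 < 0 → μ₀ z = 0)

/-- (H1): the kernel `P` is irreducible on `E`. -/
def H1 (μ μ₀ : Zd d → ℝ) : Prop := ∀ z z' : Ed d, ∃ n, 0 < kerN μ μ₀ n z z'

/-- (H2): the homogeneous random walk with step distribution `μ` is irreducible on `ℤ^d`. -/
def H2 (μ : Zd d → ℝ) : Prop := ∀ z z' : Zd d, ∃ n, 0 < homN μ n z z'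

/-- (H3) for a single measure: the jump generating function is finite everywhere
(the defining series converges for every `a ∈ ℝ^d`). -/
def H3 (μ : Zd d → ℝ) : Prop := ∀ a : Rd d, Summable fun z => μ z * Real.exp (dotZ a z)

/-- (H4): the last coordinate of the `μ`-random walk is aperiodic
(the gcd of `{n : p^n(0,0) > 0}` equals `1`). -/
def H4 (μ : Zd d → ℝ) : Prop := ∀ m : ℕ, (∀ n : ℕ, 0 < lastN μ n 0 0 → m ∣ n) → m = 1

/-- The sublevel set `D^t = {a : φ(a) ≤ t}`. -/
def Dset (μ : Zd d → ℝ) (t : ℝ) : Set (Rd d) := {a | phi μ a ≤ t}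

/-- `Θ^t = {α ∈ ℝ^{d-1} : inf_β max(φ(α,β), φ₀(α,β)) ≤ t}`. -/
def Theta (μ μ₀ : Zd d → ℝ) (t : ℝ) : Set (Fin d → ℝ) :=
  {α | sInf (Set.range fun β : ℝ => max (phi μ (α, β)) (phi μ₀ (α, β))) ≤ t}

/-- `Ĥ^t = (Θ^t × ℝ) ∩ D^t`. -/
def Hhat (μ μ₀ : Zd d → ℝ) (t : ℝ) : Set (Rd d) :=
  {a | a.1 ∈ Theta μ μ₀ t ∧ phi μ a ≤ t}

/-- Partial derivative of `f : ℝ^d → ℝ` in the last coordinate. -/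
def dBeta (f : Rd d → ℝ) (a : Rd d) : ℝ := fderiv ℝ f a (0, 1)

/-- The (coordinate) gradient of `f : ℝ^d → ℝ`. -/
def gradV (f : Rd d → ℝ) (a : Rd d) : Rd d :=
  (fun i => fderiv ℝ f a (Pi.single i 1, 0), fderiv ℝ f a (0, 1))

/-- `∂₊D^t`: boundary points of `D^t` where the last coordinate of `∇φ` is `≥ 0`. -/
def dPlus (μ : Zd d → ℝ) (t : ℝ) : Set (Rd d) :=
  {a | a ∈ frontier (Dset μ t) ∧ 0 ≤ dBeta (phi μ) a}

/-- `∂₀D^t`: boundary points of `D^t` where the last coordinate of `∇φ` is `0`. -/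
def dZero (μ : Zd d → ℝ) (t : ℝ) : Set (Rd d) :=
  {a | a ∈ frontier (Dset μ t) ∧ dBeta (phi μ) a = 0}

/-- `Γ₊^t = Ĥ^t ∩ ∂₊D^t`. -/
def GammaPlus (μ μ₀ : Zd d → ℝ) (t : ℝ) : Set (Rd d) := Hhat μ μ₀ t ∩ dPlus μ t

/-- The normal cone `V_t(a)` to `Ĥ^t` at `a`. -/
def Vcone (μ μ₀ : Zd d → ℝ) (t : ℝ) (a : Rd d) : Set (Rd d) :=
  {q | ∀ a' ∈ Hhat μ μ₀ t, dotR q (a' - a) ≤ 0}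

/-- `β̄ = min{b : φ(α,b) ≤ t}`. -/
def betaBar (μ : Zd d → ℝ) (t : ℝ) (α : Fin d → ℝ) : ℝ := sInf {b : ℝ | phi μ (α, b) ≤ t}

/-- `ā^t`: the lowest point of `D^t` with the same first `d-1` coordinates as `a`. -/
def abar (μ : Zd d → ℝ) (t : ℝ) (a : Rd d) : Rd d := (a.1, betaBar μ t a.1)

/-- The Green function `G_t(z,z') = ∑_n t^{-n} p^(n)(z,z')`. -/
def green (μ μ₀ : Zd d → ℝ) (t : ℝ) (z z' : Ed d) : ℝ :=
  ∑' n, (t ^ n)⁻¹ * kerN μ μ₀ n z z'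

/-- The `t`-Martin kernel `K_t(z,z') = G_t(z,z')/G_t(z₀,z')` with reference point `z₀`. -/
def martin (μ μ₀ : Zd d → ℝ) (t : ℝ) (z₀ z z' : Ed d) : ℝ :=
  green μ μ₀ t z z' / green μ μ₀ t z₀ z'

/-- Euclidean norm on `ℝ^d = ℝ^{d-1} × ℝ`. -/
def euclNorm (a : Rd d) : ℝ := Real.sqrt ((∑ i, a.1 i ^ 2) + a.2 ^ 2)

/-- The point of `ℝ^d` corresponding to `z ∈ E`. -/
def vecE (z : Ed d) : Rd d := (fun i => (z.1 i : ℝ), (z.2 : ℝ))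

/-- Euclidean distance from a point `v` to a set `S ⊆ ℝ^d`. -/
def distTo (S : Set (Rd d)) (v : Rd d) : ℝ := sInf ((fun q => euclNorm (v - q)) '' S)

/-- The function `h_{a,t}` of the paper. -/
def hFun (μ μ₀ : Zd d → ℝ) (t : ℝ) (a : Rd d) (z : Ed d) : ℝ :=
  if a ∉ dZero μ t ∧ phi μ₀ (abar μ t a) < t then
    Real.exp (dotE a z)
      - ((t - phi μ₀ a) / (t - phi μ₀ (abar μ t a))) * Real.exp (dotE (abar μ t a) z)
  else if a = abar μ t a ∧ a ∈ dZero μ t ∧ phi μ₀ a < t then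
    ((z.2 : ℝ) + dBeta (phi μ₀) a / (t - phi μ₀ a)) * Real.exp (dotE a z)
  else Real.exp (dotE (abar μ t a) z)


section kernels
variable {S : Type*}

/-- identity kernel -/
def kone : S → S → ENNReal := fun z w => if z = w then 1 else 0
/-- product of kernels -/
def kmul (K L : S → S → ENNReal) : S → S → ENNReal := fun z w => ∑' v, K z v * L v w
/-- powers of a kernel -/
def kpow (K : S → S → ENNReal) : ℕ → S → S → ENNReal
  | 0 => kone
  | n + 1 => kmul (kpow K n) K
/-- action of a kernel on functions -/
def kapp (K : S → S → ENNReal) (f : S → ENNReal) : S → ENNReal := fun z => ∑' w, K z w * f w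
/-- Green kernel -/
def kgreen (K : S → S → ENNReal) : S → S → ENNReal := fun z w => ∑' n, kpow K n z w

lemma kmul_eq (K L : S → S → ENNReal) (z w : S) : kmul K L z w = kapp K (fun v => L v w) z := rfl

lemma kapp_kmul (K L : S → S → ENNReal) (f : S → ENNReal) :
    kapp (kmul K L) f = kapp K (kapp L f) := by
  funext z
  simp only [kapp, kmul]
  simp_rw [← ENNReal.tsum_mul_right, ← ENNReal.tsum_mul_left]
  rw [ENNReal.tsum_comm]
  simp_rw [mul_assoc]

lemma kapp_kone (f : S → ENNReal) : kapp kone f = f := by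
  funext z
  simp only [kapp, kone]
  rw [tsum_eq_single z]
  · simp
  · intro w hw
    simp [Ne.symm hw]

lemma kone_kmul (K : S → S → ENNReal) : kmul kone K = K := by
  funext z w
  rw [kmul_eq, kapp_kone]

lemma kmul_kone (K : S → S → ENNReal) : kmul K kone = K := by
  funext z w
  simp only [kmul, kone]
  rw [tsum_eq_single w]
  · simp
  · intro v hv
    simp [hv]

lemma kmul_assoc (K L M : S → S → ENNReal) : kmul (kmul K L) M = kmul K (kmul L M) := by
  funext z w
  rw [kmul_eq, kapp_kmul]
  rfl

lemma kpow_add (K : S → S → ENNReal) (m n : ℕ) :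
    kpow K (m + n) = kmul (kpow K m) (kpow K n) := by
  induction n with
  | zero => simp [kpow, kmul_kone]
  | succ n ih => rw [← add_assoc, kpow, ih, kpow, kmul_assoc]

lemma kpow_one (K : S → S → ENNReal) : kpow K 1 = K := by
  rw [kpow, kpow, kone_kmul]

lemma kpow_succ' (K : S → S → ENNReal) (n : ℕ) : kpow K (n + 1) = kmul K (kpow K n) := by
  rw [add_comm, kpow_add, kpow_one]

lemma kapp_mono (K : S → S → ENNReal) {f g : S → ENNReal} (h : ∀ z, f z ≤ g z) (z : S) :
    kapp K f z ≤ kapp K g z :=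
  ENNReal.tsum_le_tsum fun w => mul_le_mul_right (h w) _

lemma kapp_add (K : S → S → ENNReal) (f g : S → ENNReal) (z : S) :
    kapp K (fun w => f w + g w) z = kapp K f z + kapp K g z := by
  simp only [kapp, mul_add, ENNReal.tsum_add]

lemma kapp_smul (K : S → S → ENNReal) (x : ENNReal) (f : S → ENNReal) (z : S) :
    kapp K (fun w => x * f w) z = x * kapp K f z := by
  simp only [kapp, ← ENNReal.tsum_mul_left]
  congr 1; funext w; ring

lemma kapp_tsum (K : S → S → ENNReal) {ι : Type*} (f : ι → S → ENNReal) (z : S) :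
    kapp K (fun w => ∑' i, f i w) z = ∑' i, kapp K (f i) z := by
  simp only [kapp, ← ENNReal.tsum_mul_left]
  rw [ENNReal.tsum_comm]

lemma kpow_super (K : S → S → ENNReal) (f : S → ENNReal) (x : ENNReal)
    (h : ∀ z, kapp K f z ≤ x * f z) (n : ℕ) : ∀ z, kapp (kpow K n) f z ≤ x ^ n * f z := by
  induction n with
  | zero => intro z; simp [kpow, kapp_kone]
  | succ n ih =>
    intro z
    rw [kpow, kapp_kmul]
    refine (kapp_mono _ h z).trans ?_
    rw [kapp_smul, pow_succ, mul_comm (x ^ n), mul_assoc]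
    exact mul_le_mul_right (ih z) _

lemma kapp_term (K : S → S → ENNReal) (f : S → ENNReal) (z w : S) : K z w * f w ≤ kapp K f z :=
  ENNReal.le_tsum w

lemma kpow_mul_le (K : S → S → ENNReal) (m n : ℕ) (z v w : S) :
    kpow K m z v * kpow K n v w ≤ kpow K (m + n) z w := by
  rw [kpow_add, kmul_eq]
  exact kapp_term _ _ z v

lemma kpow_le_green (K : S → S → ENNReal) (n : ℕ) (z w : S) : kpow K n z w ≤ kgreen K z w :=
  ENNReal.le_tsum n

lemma kpow_mul_green (K : S → S → ENNReal) (m : ℕ) (z w : S) :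
    kapp (kpow K m) (fun v => kgreen K v w) z = ∑' j, kpow K (m + j) z w := by
  simp only [kgreen]
  rw [kapp_tsum]
  congr 1; funext j
  rw [kpow_add, kmul_eq]

lemma kpow_mul_green_le (K : S → S → ENNReal) (m : ℕ) (z v w : S) :
    kpow K m z v * kgreen K v w ≤ kgreen K z w := by
  refine (kapp_term (kpow K m) (fun v => kgreen K v w) z v).trans ?_
  rw [kpow_mul_green]
  exact ENNReal.tsum_comp_le_tsum_of_injective (fun a b h => by simpa using h) (fun n => kpow K n z w)

lemma green_mul_kpow_le (K : S → S → ENNReal) (m : ℕ) (z v w : S) :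
    kgreen K z v * kpow K m v w ≤ kgreen K z w := by
  simp only [kgreen]
  rw [← ENNReal.tsum_mul_right]
  refine (ENNReal.tsum_le_tsum fun n => kpow_mul_le K n m z v w).trans ?_
  exact ENNReal.tsum_comp_le_tsum_of_injective (fun a b h => by simpa using h) (fun n => kpow K n z w)

lemma green_left (K : S → S → ENNReal) (z w : S) :
    kgreen K z w = kone z w + kapp K (fun v => kgreen K v w) z := by
  have := kpow_mul_green K 1 z w
  rw [kpow_one] at this
  rw [this, kgreen, tsum_eq_zero_add' ENNReal.summable]
  simp only [kpow, add_comm]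

lemma green_right (K : S → S → ENNReal) (z w : S) :
    kgreen K z w = kone z w + ∑' v, kgreen K z v * K v w := by
  simp only [kgreen]
  simp_rw [← ENNReal.tsum_mul_right]
  rw [ENNReal.tsum_comm, tsum_eq_zero_add' ENNReal.summable]
  rfl

/-- the resolvent kernel with parameter one half -/
def kQ (K : S → S → ENNReal) : S → S → ENNReal := fun z w => ∑' n, (2⁻¹ : ENNReal) ^ (n + 1) * kpow K n z w

lemma kapp_kQ (K : S → S → ENNReal) (f : S → ENNReal) (z : S) :
    kapp (kQ K) f z = ∑' n, (2⁻¹ : ENNReal) ^ (n + 1) * kapp (kpow K n) f z := by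
  simp only [kapp, kQ]
  simp_rw [← ENNReal.tsum_mul_right, ← ENNReal.tsum_mul_left]
  rw [ENNReal.tsum_comm]
  simp_rw [mul_assoc]

lemma kQ_rec (K : S → S → ENNReal) (z w : S) :
    kQ K z w = 2⁻¹ * kone z w + 2⁻¹ * kapp K (fun v => kQ K v w) z := by
  simp only [kQ]
  rw [kapp_tsum, tsum_eq_zero_add' ENNReal.summable, ← ENNReal.tsum_mul_left]
  congr 1
  · simp [kpow]
  · congr 1; funext n
    rw [kapp_smul, kpow_succ', kmul_eq, pow_succ' _ (n + 1), mul_assoc]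

lemma tsum_antidiag (F : ℕ → ℕ → ENNReal) :
    ∑' n, ∑' j, F n j = ∑' N, ∑ p ∈ Finset.HasAntidiagonal.antidiagonal N, F p.1 p.2 := by
  rw [← ENNReal.tsum_prod, ← (Finset.HasAntidiagonal.sigmaAntidiagonalEquivProd).tsum_eq
    (fun p : ℕ × ℕ => F p.1 p.2), ENNReal.tsum_sigma']
  congr 1; funext N
  rw [tsum_fintype]
  exact Finset.sum_coe_sort (Finset.HasAntidiagonal.antidiagonal N) (fun p => F p.1 p.2)

lemma geom_half (N : ℕ) : ∑ n ∈ Finset.range (N + 1), (2⁻¹ : ENNReal) ^ (n + 1) + 2⁻¹ ^ (N + 1) = 1 := by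
  induction N with
  | zero => simp [ENNReal.inv_two_add_inv_two]
  | succ N ih =>
    rw [Finset.sum_range_succ, add_assoc]
    conv_rhs => rw [← ih]
    congr 1
    rw [pow_succ _ (N + 1), ← mul_add, ENNReal.inv_two_add_inv_two, mul_one]

lemma kQ_green (K : S → S → ENNReal) (z w : S) :
    kQ K z w + kapp (kQ K) (fun v => kgreen K v w) z = kgreen K z w := by
  rw [kapp_kQ]
  simp_rw [kpow_mul_green, ← ENNReal.tsum_mul_left]
  rw [tsum_antidiag, kQ, ← ENNReal.tsum_add, kgreen]
  congr 1; funext N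
  have : ∑ p ∈ Finset.HasAntidiagonal.antidiagonal N, (2⁻¹ : ENNReal) ^ (p.1 + 1) * kpow K (p.1 + p.2) z w
      = (∑ n ∈ Finset.range (N + 1), (2⁻¹ : ENNReal) ^ (n + 1)) * kpow K N z w := by
    rw [Finset.sum_mul, Finset.Nat.sum_antidiagonal_eq_sum_range_succ_mk]
    refine Finset.sum_congr rfl fun n hn => ?_
    have : n + (N - n) = N := by have := Finset.mem_range.1 hn; omega
    simp only [this]
  rw [this, ← add_mul, add_comm, geom_half, one_mul]

lemma kQ_sum (K : S → S → ENNReal) (hfin : ∀ z w, kgreen K z w ≠ ⊤) (z w : S) :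
    ∑' k, kpow (kQ K) (k + 1) z w = kgreen K z w := by
  set X : S → S → ENNReal := fun z w => ∑' k, kpow (kQ K) (k + 1) z w with hX
  have h1 : ∀ m, ∀ z, ∑ k ∈ Finset.range m, kpow (kQ K) (k + 1) z w ≤ kgreen K z w := by
    intro m
    induction m with
    | zero => intro z; simp
    | succ m ih =>
      intro z
      rw [Finset.sum_range_succ', ← kQ_green K z w, add_comm, zero_add, kpow_one]
      refine add_le_add le_rfl ?_
      refine le_trans (le_of_eq ?_) (kapp_mono (kQ K) ih z)
      have : ∀ k, kpow (kQ K) (k + 1 + 1) z w = kapp (kQ K) (fun v => kpow (kQ K) (k + 1) v w) z := by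
        intro k; rw [kpow_succ' _ (k + 1), kmul_eq]
      simp_rw [this]
      simp only [kapp, Finset.mul_sum]
      rw [Summable.tsum_finsetSum fun i _ => ENNReal.summable]
  have h2 : ∀ z, X z w ≤ kgreen K z w := by
    intro z
    rw [hX]
    exact ENNReal.tsum_le_of_sum_range_le fun n => h1 n z
  have h3 : ∀ z, X z w = kQ K z w + kapp (kQ K) (fun v => X v w) z := by
    intro z
    simp only [hX]
    rw [tsum_eq_zero_add' ENNReal.summable, kapp_tsum, zero_add, kpow_one]
    congr 2; funext k
    rw [kpow_succ' _ (k + 1), kmul_eq]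
  have h4 : ∀ z, X z w = 2⁻¹ * kone z w + 2⁻¹ * X z w + 2⁻¹ * kapp K (fun v => X v w) z := by
    intro z
    have e1 : kapp (kQ K) (fun v => X v w) z =
        2⁻¹ * X z w + 2⁻¹ * kapp K (fun u => kapp (kQ K) (fun v => X v w) u) z := by
      have : kQ K = fun z w => 2⁻¹ * kone z w + 2⁻¹ * kmul K (kQ K) z w := by
        funext z w; rw [kQ_rec]; rfl
      conv_lhs => rw [this]
      have h5 : ∀ f : S → ENNReal, kapp (fun z w => 2⁻¹ * kone z w + 2⁻¹ * kmul K (kQ K) z w) f z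
          = 2⁻¹ * kapp kone f z + 2⁻¹ * kapp (kmul K (kQ K)) f z := by
        intro f
        simp only [kapp, add_mul, ENNReal.tsum_add, mul_assoc, ENNReal.tsum_mul_left]
      rw [h5, kapp_kone, kapp_kmul]
    have e2 : kapp K (fun v => X v w) z = kapp K (fun v => kQ K v w) z +
        kapp K (fun u => kapp (kQ K) (fun v => X v w) u) z := by
      rw [← kapp_add]
      congr 1; funext v; exact h3 v
    rw [e2, h3 z, kQ_rec, e1]
    rw [← kQ_rec K z w]
    have h3z := h3 z
    rw [e1] at h3z
    conv_rhs => rw [← e1]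
    rw [← h3 z]
    rw [kQ_rec] 
    ring
  have h5 : ∀ z, X z w = kone z w + kapp K (fun v => X v w) z := by
    intro z
    have hf : X z w ≠ ⊤ := ne_top_of_le_ne_top (hfin z w) (h2 z)
    have h6 : 2⁻¹ * X z w + 2⁻¹ * X z w = 2⁻¹ * X z w + (2⁻¹ * kone z w +  2⁻¹ * kapp K (fun v => X v w) z) := by
      rw [← add_mul, ENNReal.inv_two_add_inv_two, one_mul]
      conv_lhs => rw [h4 z]
      ring
    have h7 := (ENNReal.add_right_inj (ENNReal.mul_ne_top (by simp) hf)).1 h6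
    rw [← mul_add] at h7
    exact (ENNReal.mul_right_inj (by simp) (by simp)).1 h7
  have h8 : ∀ m, ∀ z, ∑ k ∈ Finset.range m, kpow K k z w ≤ X z w := by
    intro m
    induction m with
    | zero => intro z; simp
    | succ m ih =>
      intro z
      rw [Finset.sum_range_succ', h5 z, add_comm]
      refine add_le_add (le_of_eq rfl) ?_
      refine le_trans (le_of_eq ?_) (kapp_mono K ih z)
      simp_rw [kpow_succ', kmul_eq]
      simp only [kapp, Finset.mul_sum]
      rw [Summable.tsum_finsetSum fun i _ => ENNReal.summable]
  exact le_antisymm (h2 z) (ENNReal.tsum_le_of_sum_range_le fun n => h8 n z)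

end kernels

section ratio
variable {S : Type*}

lemma kpow_shift (K : S → S → ENNReal) (σ : S ≃ S) (h : ∀ z w, K (σ z) (σ w) = K z w) (n : ℕ) :
    ∀ z w, kpow K n (σ z) (σ w) = kpow K n z w := by
  induction n with
  | zero => intro z w; simp [kpow, kone]
  | succ n ih =>
    intro z w
    simp only [kpow, kmul]
    rw [← σ.tsum_eq]
    simp_rw [ih, h]

lemma kgreen_shift (K : S → S → ENNReal) (σ : S ≃ S) (h : ∀ z w, K (σ z) (σ w) = K z w)
    (z w : S) : kgreen K (σ z) (σ w) = kgreen K z w := by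
  simp only [kgreen, kpow_shift K σ h]

/-- exponentially weighted kernels in the Bernoulli part argument -/
def kE (R : S → S → ENNReal) (σ : S ≃ S) (x : ENNReal) : ℕ → S → S → ENNReal
  | 0 => kone
  | k + 1 => fun z w => kapp R (fun v => kE R σ x k v w) z + x * kE R σ x k (σ z) w

lemma ratio_step (Q R : S → S → ENNReal) (σ : S ≃ S) (c : ENNReal)
    (hσ : ∀ z w, Q (σ z) (σ w) = Q z w)
    (hQ : ∀ (f : S → ENNReal) z, kapp Q f z = kapp R f z + c * f (σ z))
    (l : ℝ) (hl : 0 < l) (k : ℕ) : ∀ (p q : ℝ), 0 ≤ p → 0 ≤ q → ∀ z w,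
      k * c * kpow Q (k - 1) (σ z) w + ENNReal.ofReal p * kpow Q k z w ≤
      ENNReal.ofReal q * kpow Q k z w + ENNReal.ofReal (l⁻¹ * Real.exp (l * (p - q)))
        * kE R σ (c * ENNReal.ofReal (Real.exp l)) k z w := by
  induction k with
  | zero =>
    intro p q hp hq z w
    simp only [Nat.cast_zero, zero_mul, zero_add, kpow, kE]
    rw [← add_mul]
    refine mul_le_mul_left ?_ _
    rw [← ENNReal.ofReal_add hq (by positivity)]
    refine ENNReal.ofReal_le_ofReal ?_
    have h1 : l * (p - q) ≤ Real.exp (l * (p - q)) := by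
      have := Real.add_one_le_exp (l * (p - q)); linarith
    have h2 : l⁻¹ * (l * (p - q)) ≤ l⁻¹ * Real.exp (l * (p - q)) := by gcongr
    rw [← mul_assoc, inv_mul_cancel₀ hl.ne', one_mul] at h2
    linarith
  | succ k ih =>
    intro p q hp hq z w
    set x := c * ENNReal.ofReal (Real.exp l) with hx
    have hrec : ∀ z, (((k + 1 : ℕ) : ENNReal)) * c * kpow Q k (σ z) w =
        kapp Q (fun v => k * c * kpow Q (k - 1) (σ v) w) z + c * kpow Q k (σ z) w := by
      intro z
      rw [kapp_smul]
      rcases k with _ | k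
      · simp
      · have : kapp Q (fun v => kpow Q (k + 1 - 1) (σ v) w) z = kpow Q (k + 1) (σ z) w := by
          rw [kpow_succ', kmul_eq]
          simp only [kapp]
          conv_rhs => rw [← σ.tsum_eq]
          simp [hσ]
        rw [this]
        push_cast
        ring
    have hpow : ∀ z, kpow Q (k + 1) z w = kapp Q (fun v => kpow Q k v w) z := by
      intro z; rw [kpow_succ', kmul_eq]
    rw [Nat.add_sub_cancel, hrec z, hpow z]
    have hE : kE R σ x (k + 1) z w = kapp R (fun v => kE R σ x k v w) z + x * kE R σ x k (σ z) w := rfl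
    rw [hE]
    have i1 := kapp_mono R (fun v => ih p q hp hq v w) z
    have i2 := mul_le_mul_right (ih (p + 1) q (by linarith) hq (σ z) w) c
    rw [kapp_add, kapp_add, kapp_smul, kapp_smul, kapp_smul, kapp_smul] at i1
    rw [kapp_smul, hQ, hQ]
    have i3 := add_le_add i1 i2
    refine le_trans (le_of_eq ?_) (i3.trans (le_of_eq ?_))
    · rw [ENNReal.ofReal_add hp zero_le_one, ENNReal.ofReal_one]; ring
    · have : ENNReal.ofReal (l⁻¹ * Real.exp (l * (p + 1 - q))) =
          ENNReal.ofReal (l⁻¹ * Real.exp (l * (p - q))) * ENNReal.ofReal (Real.exp l) := by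
        rw [← ENNReal.ofReal_mul (by positivity), mul_assoc, ← Real.exp_add]
        congr 3; ring
      rw [this, hx]; ring

lemma ratio_kE_super (R : S → S → ENNReal) (σ : S ≃ S) (x : ENNReal) (f : S → ENNReal) (κ : ENNReal)
    (h : ∀ z, kapp R f z + x * f (σ z) ≤ κ * f z) (k : ℕ) :
    ∀ z, kapp (kE R σ x k) f z ≤ κ ^ k * f z := by
  induction k with
  | zero => intro z; simp [kE, kapp_kone]
  | succ k ih =>
    intro z
    have : kapp (kE R σ x (k + 1)) f z = kapp R (kapp (kE R σ x k) f) z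
        + x * kapp (kE R σ x k) f (σ z) := by
      have h1 := congrFun (kapp_kmul R (kE R σ x k) f) z
      rw [← h1]
      simp only [kapp, kE, kmul, add_mul, ENNReal.tsum_add, mul_assoc, ENNReal.tsum_mul_left]
    rw [this]
    refine (add_le_add (kapp_mono R ih z) (mul_le_mul_right (ih (σ z)) x)).trans ?_
    rw [kapp_smul, pow_succ]
    calc _ = κ ^ k * (kapp R f z + x * f (σ z)) := by ring
      _ ≤ κ ^ k * (κ * f z) := mul_le_mul_right (h z) _
      _ = _ := by ring

/-- The ratio estimate. -/
lemma ratio_lemma (A : S → S → ENNReal) (hfin : ∀ z w, kgreen A z w ≠ ⊤) (σ : S ≃ S)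
    (hσ : ∀ z w, A (σ z) (σ w) = A z w) (c : ENNReal) (hcQ : ∀ z, c ≤ kQ A z (σ z)) (hct : c ≠ ⊤)
    (f : S → ENNReal) (q τ θ : ENNReal) (hq : ∀ z, kapp (kQ A) f z ≤ q * f z)
    (hτ : ∀ z, f (σ z) ≤ τ * f z) (l γ : ℝ) (hl : 0 < l) (hγ : 0 ≤ γ)
    (hθ : ENNReal.ofReal (Real.exp (-(l * γ))) * (q + c * ENNReal.ofReal (Real.exp l - 1) * τ) ≤ θ)
    (z w : S) (hf0 : f w ≠ 0) (hft : f w ≠ ⊤) :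
    c * kgreen A (σ z) w ≤ ENNReal.ofReal γ * kgreen A z w
      + ENNReal.ofReal l⁻¹ * (1 - θ)⁻¹ * (f z / f w) := by
  set Q := kQ A with hQdef
  set R : S → S → ENNReal := fun z w => Q z w - (if w = σ z then c else 0) with hR
  have hQσ : ∀ z w, Q (σ z) (σ w) = Q z w := by
    intro z w
    simp only [hQdef, kQ, kpow_shift A σ hσ]
  have hQR : ∀ (f : S → ENNReal) z, kapp Q f z = kapp R f z + c * f (σ z) := by
    intro f z
    have h1 : c * f (σ z) = kapp (fun z w => if w = σ z then c else 0) f z := by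
      simp only [kapp]
      rw [tsum_eq_single (σ z)]
      · simp
      · intro v hv; simp [hv]
    rw [h1]
    simp only [kapp]
    rw [← ENNReal.tsum_add]
    congr 1; funext v
    rw [← add_mul]
    congr 1
    rw [hR]
    simp only
    split_ifs with h
    · rw [h]; exact (tsub_add_cancel_of_le (hcQ z)).symm
    · simp
  set x := c * ENNReal.ofReal (Real.exp l) with hx
  set κ := q + c * ENNReal.ofReal (Real.exp l - 1) * τ with hκ
  have hE : ∀ k z, kapp (kE R σ x k) f z ≤ κ ^ k * f z := by
    intro k
    refine ratio_kE_super R σ x f κ ?_ k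
    intro z
    have he : ENNReal.ofReal (Real.exp l) = 1 + ENNReal.ofReal (Real.exp l - 1) := by
      rw [← ENNReal.ofReal_one, ← ENNReal.ofReal_add zero_le_one]
      · congr 1; ring
      · have := Real.add_one_le_exp l; linarith
    calc kapp R f z + x * f (σ z) = kapp Q f z + c * ENNReal.ofReal (Real.exp l - 1) * f (σ z) := by
          rw [hQR, hx, he]; ring
      _ ≤ q * f z + c * ENNReal.ofReal (Real.exp l - 1) * (τ * f z) :=
          add_le_add (hq z) (mul_le_mul_right (hτ z) _)
      _ = κ * f z := by rw [hκ]; ring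
  have hEp : ∀ k, kE R σ x k z w ≤ κ ^ k * (f z / f w) := by
    intro k
    rw [← mul_div_assoc]
    rw [ENNReal.le_div_iff_mul_le (Or.inl hf0) (Or.inl hft)]
    exact (kapp_term _ f z w).trans (hE k z)
  have hstep : ∀ k : ℕ, c * kpow Q k (σ z) w ≤ ENNReal.ofReal γ * kpow Q (k + 1) z w
      + ENNReal.ofReal l⁻¹ * (θ ^ (k + 1) * (f z / f w)) := by
    intro k
    have h := ratio_step Q R σ c hQσ hQR l hl (k + 1) 0 (γ * (k + 1)) le_rfl (by positivity) z w
    simp only [Nat.add_sub_cancel, ENNReal.ofReal_zero, zero_mul, add_zero] at h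
    have h1 : ENNReal.ofReal (l⁻¹ * Real.exp (l * (0 - γ * (k + 1)))) * kE R σ x (k + 1) z w
        ≤ ENNReal.ofReal l⁻¹ * (θ ^ (k + 1) * (f z / f w)) := by
      rw [ENNReal.ofReal_mul (by positivity), mul_assoc]
      refine mul_le_mul_right ?_ _
      have : Real.exp (l * (0 - γ * (k + 1))) = Real.exp (-(l * γ)) ^ (k + 1) := by
        rw [← Real.exp_nat_mul]; congr 1; push_cast; ring
      rw [this, ENNReal.ofReal_pow (by positivity)]
      calc _ ≤ ENNReal.ofReal (Real.exp (-(l * γ))) ^ (k + 1) * (κ ^ (k + 1) * (f z / f w)) :=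
            mul_le_mul_right (hEp _) _
        _ = (ENNReal.ofReal (Real.exp (-(l * γ))) * κ) ^ (k + 1) * (f z / f w) := by
            rw [mul_pow]; ring
        _ ≤ _ := by gcongr
    have h2 := h.trans (add_le_add le_rfl h1)
    have hk1 : (1 : ENNReal) ≤ ((k + 1 : ℕ) : ENNReal) := by exact_mod_cast Nat.le_add_left 1 k
    have h3 : ((k + 1 : ℕ) : ENNReal) * (c * kpow Q k (σ z) w) ≤ ((k + 1 : ℕ) : ENNReal) *
        (ENNReal.ofReal γ * kpow Q (k + 1) z w + ENNReal.ofReal l⁻¹ * (θ ^ (k + 1) * (f z / f w))) := by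
      rw [← mul_assoc]
      refine h2.trans ?_
      rw [mul_add ((k + 1 : ℕ) : ENNReal)]
      refine add_le_add (le_of_eq ?_) (le_mul_of_one_le_left (zero_le) hk1)
      rw [ENNReal.ofReal_mul hγ]
      have : ENNReal.ofReal ((k : ℝ) + 1) = ((k + 1 : ℕ) : ENNReal) := by
        rw [← Nat.cast_succ, ENNReal.ofReal_natCast]
      rw [this]; ring
    exact (ENNReal.mul_le_mul_iff_right (by simp) (by simp)).1 h3
  have hG := kQ_sum A hfin
  calc c * kgreen A (σ z) w ≤ c * ∑' k, kpow Q k (σ z) w := by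
        refine mul_le_mul_right ?_ _
        rw [← hG]
        exact ENNReal.tsum_comp_le_tsum_of_injective (fun a b h => by simpa using h) (fun n => kpow Q n (σ z) w)
    _ = ∑' k, c * kpow Q k (σ z) w := by rw [ENNReal.tsum_mul_left]
    _ ≤ ∑' k, (ENNReal.ofReal γ * kpow Q (k + 1) z w
      + ENNReal.ofReal l⁻¹ * (θ ^ (k + 1) * (f z / f w))) := ENNReal.tsum_le_tsum hstep
    _ = ENNReal.ofReal γ * kgreen A z w + ENNReal.ofReal l⁻¹ * ((∑' k, θ ^ (k + 1)) * (f z / f w)) := by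
        rw [ENNReal.tsum_add, ENNReal.tsum_mul_left, ENNReal.tsum_mul_left, ENNReal.tsum_mul_right, hG]
    _ ≤ _ := by
        rw [mul_assoc]
        refine add_le_add le_rfl (mul_le_mul_right (mul_le_mul_left ?_ _) _)
        rw [← ENNReal.tsum_geometric]
        exact ENNReal.tsum_comp_le_tsum_of_injective (fun a b h => by simpa using h) (fun n => θ ^ n)

/-- resolvent of a superharmonic function -/
lemma kQ_super (A : S → S → ENNReal) (f : S → ENNReal) (x : ENNReal)
    (h : ∀ z, kapp A f z ≤ x * f z) (z : S) :
    kapp (kQ A) f z ≤ 2⁻¹ * (1 - 2⁻¹ * x)⁻¹ * f z := by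
  rw [kapp_kQ]
  calc _ ≤ ∑' n, (2⁻¹ : ENNReal) ^ (n + 1) * (x ^ n * f z) :=
        ENNReal.tsum_le_tsum fun n => mul_le_mul_right (kpow_super A f x h n z) _
    _ = ∑' n, 2⁻¹ * (2⁻¹ * x) ^ n * f z := by
        congr 1; funext n; rw [mul_pow, pow_succ]; ring
    _ = _ := by rw [ENNReal.tsum_mul_right, ENNReal.tsum_mul_left, ENNReal.tsum_geometric]

end ratio

section onedim
variable {ι : Type*}

/-- harmonic functions of the one dimensional left-continuous walk -/
def Har (p : ι → ℝ) (k : ι → ℕ) (g : ℕ → ℝ) : Prop :=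
  ∀ y, HasSum (fun i => p i * g (y + k i)) (g (y + 1))

/-- geometric sums -/
def geoS (r : ℝ) (y : ℕ) : ℝ := ∑ i ∈ Finset.range y, r ^ i

lemma geoS_add (r : ℝ) (y k : ℕ) : geoS r (y + k) = geoS r y + r ^ y * geoS r k := by
  simp only [geoS, Finset.sum_range_add, Finset.mul_sum, pow_add]

variable {p : ι → ℝ} {k : ι → ℕ}

lemma Har.add {f g : ℕ → ℝ} (hf : Har p k f) (hg : Har p k g) : Har p k (fun y => f y + g y) := by
  intro y
  simpa [mul_add] using (hf y).add (hg y)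

lemma Har.smul {f : ℕ → ℝ} (hf : Har p k f) (c : ℝ) : Har p k (fun y => c * f y) := by
  intro y
  have := (hf y).mul_left c
  simpa [mul_left_comm] using this

lemma Har.const (hp : HasSum p 1) (c : ℝ) : Har p k (fun _ => c) := by
  intro y
  simpa using hp.mul_right c

lemma Har.sub {f g : ℕ → ℝ} (hf : Har p k f) (hg : Har p k g) : Har p k (fun y => f y - g y) := by
  intro y
  simpa [mul_sub] using (hf y).sub (hg y)

lemma Har.shift {f : ℕ → ℝ} (hf : Har p k f) (m : ℕ) : Har p k (fun y => f (y + m)) := by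
  intro y
  have := hf (y + m)
  have e : y + m + 1 = y + 1 + m := by ring
  rw [e] at this
  refine this.congr_fun fun i => ?_
  have e2 : y + k i + m = y + m + k i := by ring
  simp only [e2]

/-- standing assumptions -/
structure OD (p : ι → ℝ) (k : ι → ℕ) : Prop where
  nn : ∀ i, 0 ≤ p i
  one : HasSum p 1
  down : ∃ i, 0 < p i ∧ k i = 0
  up : ∃ i, 0 < p i ∧ 2 ≤ k i
  mom : ∀ C : ℝ, 1 ≤ C → Summable (fun i => p i * C ^ (k i))

lemma geoS_har (hp : HasSum p 1) (r : ℝ) (h : HasSum (fun i => p i * geoS r (k i)) 1) :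
    Har p k (geoS r) := by
  intro y
  have h1 := (hp.mul_right (geoS r y)).add (h.mul_left (r ^ y))
  have : geoS r (y + 1) = 1 * geoS r y + r ^ y * 1 := by
    rw [geoS_add]; simp [geoS]
  rw [this]
  refine h1.congr_fun fun i => ?_
  rw [geoS_add]; ring

lemma geoS_ge (r : ℝ) (hr : 1 ≤ r) (y : ℕ) : (y : ℝ) ≤ geoS r y := by
  simp only [geoS]
  calc (y : ℝ) = ∑ i ∈ Finset.range y, (1 : ℝ) := by simp
    _ ≤ _ := Finset.sum_le_sum fun i _ => one_le_pow₀ hr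

lemma geoS_nonneg (r : ℝ) (hr : 1 ≤ r) (y : ℕ) : 0 ≤ geoS r y :=
  (Nat.cast_nonneg y).trans (geoS_ge r hr y)

lemma Har.ge_zero (H : OD p k) {r : ℝ} (hr : 1 ≤ r) (h : HasSum (fun i => p i * geoS r (k i)) 1)
    {f : ℕ → ℝ} (hf : Har p k f) (h0 : ∀ y, 0 ≤ f y) (y : ℕ) : f 0 ≤ f y := by
  have key : ∀ ε > 0, f 0 ≤ f y + ε * geoS r y := by
    intro ε hε
    set F : ℕ → ℝ := fun y => f y + ε * geoS r y with hF
    have hFh : Har p k F := hf.add ((geoS_har H.one r h).smul ε)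
    have hFge : ∀ y : ℕ, ε * y ≤ F y := fun y => by
      have := mul_le_mul_of_nonneg_left (geoS_ge r hr y) hε.le
      have := h0 y
      simp only [hF]; linarith
    obtain ⟨N, hN⟩ := exists_nat_gt (F 0 / ε)
    rw [div_lt_iff₀ hε] at hN
    obtain ⟨m, hm, hmin⟩ := Finset.exists_min_image (Finset.range (N + 1)) F ⟨0, by simp⟩
    have hglob : ∀ y, F m ≤ F y := by
      intro y
      by_cases hy : y < N + 1
      · exact hmin y (Finset.mem_range.2 hy)
      · have h1 := hmin 0 (by simp)
        have h2 := hFge y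
        have h3 : (N : ℝ) ≤ y := by exact_mod_cast (by omega : N ≤ y)
        nlinarith
    obtain ⟨i0, hi0, hk0⟩ := H.down
    have desc : ∀ y, F (y + 1) = F m → F y = F m := by
      intro y hy
      have h1 := (hFh y).sub ((H.one).mul_right (F m))
      rw [hy, one_mul, sub_self] at h1
      have hnn : ∀ i, 0 ≤ p i * F (y + k i) - p i * F m := fun i => by
        have := mul_le_mul_of_nonneg_left (hglob (y + k i)) (H.nn i)
        linarith
      have h2 := congrFun ((hasSum_zero_iff_of_nonneg hnn).1 h1) i0
      simp only [hk0, add_zero, Pi.zero_apply] at h2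
      have : p i0 * (F y - F m) = 0 := by linarith
      rcases mul_eq_zero.1 this with h | h
      · exact absurd h hi0.ne'
      · linarith
    have h0m : ∀ y, F y = F m → F 0 = F m := by
      intro y
      induction y with
      | zero => exact id
      | succ y ih => exact fun h => ih (desc y h)
    have h0F := h0m m rfl
    have : F 0 = f 0 := by simp [hF, geoS]
    have h2 := hglob y
    simp only [hF] at h2 this h0F ⊢
    linarith
  have hg := geoS_nonneg r hr y
  refine le_of_forall_pos_le_add fun ε hε => ?_
  have := key (ε / (geoS r y + 1)) (by positivity)
  have h3 : ε / (geoS r y + 1) * geoS r y ≤ ε := by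
    rw [div_mul_eq_mul_div, div_le_iff₀ (by positivity)]
    nlinarith
  linarith

lemma Har.mono (H : OD p k) {r : ℝ} (hr : 1 ≤ r) (h : HasSum (fun i => p i * geoS r (k i)) 1)
    {f : ℕ → ℝ} (hf : Har p k f) (h0 : ∀ y, 0 ≤ f y) : Monotone f := by
  refine monotone_nat_of_le_succ fun n => ?_
  have := (hf.shift n).ge_zero H hr h (fun y => h0 _) 1
  simpa [add_comm] using this

lemma Har.growth (H : OD p k) {r : ℝ} (hr : 1 ≤ r) (h : HasSum (fun i => p i * geoS r (k i)) 1) :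
    ∃ C : ℝ, 1 ≤ C ∧ ∀ f : ℕ → ℝ, Har p k f → (∀ y, 0 ≤ f y) → ∀ y, f (y + 2) ≤ C * f (y + 1) := by
  obtain ⟨i, hi, hk⟩ := H.up
  refine ⟨(p i)⁻¹, ?_, ?_⟩
  · refine (one_le_inv₀ hi).2 ?_
    exact le_hasSum H.one i fun j _ => H.nn j
  · intro f hf h0 y
    have h1 : p i * f (y + k i) ≤ f (y + 1) :=
      le_hasSum (hf y) i fun j _ => mul_nonneg (H.nn j) (h0 _)
    have h2 : f (y + 2) ≤ f (y + k i) := hf.mono H hr h h0 (by omega)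
    rw [inv_mul_eq_div, le_div_iff₀ hi]
    nlinarith

/-- The base of the cone of nonnegative harmonic functions vanishing at zero. -/
def baseB (p : ι → ℝ) (k : ι → ℕ) : Set (ℕ → ℝ) :=
  {g | Har p k g ∧ (∀ y, 0 ≤ g y) ∧ g 0 = 0 ∧ g 1 = 1}

lemma baseB_convex : Convex ℝ (baseB p k) := by
  rintro f ⟨hf, hf0, hf1, hf2⟩ g ⟨hg, hg0, hg1, hg2⟩ a b ha hb hab
  refine ⟨(hf.smul a).add (hg.smul b), fun y => ?_, ?_, ?_⟩
  · have := mul_nonneg ha (hf0 y)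
    have := mul_nonneg hb (hg0 y)
    simp only [Pi.add_apply, Pi.smul_apply, smul_eq_mul]; linarith
  · simp [hf1, hg1]
  · simp [hf2, hg2, hab]

lemma baseB_compact (H : OD p k) {r : ℝ} (hr : 1 ≤ r) (h : HasSum (fun i => p i * geoS r (k i)) 1) :
    IsCompact (baseB p k) := by
  obtain ⟨C, hC1, hC⟩ := Har.growth H hr h
  set K : Set (ℕ → ℝ) := Set.univ.pi fun y => Set.Icc (0 : ℝ) (C ^ y) with hK
  have hKc : IsCompact K := isCompact_univ_pi fun y => isCompact_Icc
  have hC0 : 0 ≤ C := by linarith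
  have hbd : ∀ y, ∀ i, ∀ g ∈ K, ‖p i * g (y + k i)‖ ≤ C ^ y * (p i * C ^ (k i)) := by
    intro y i g hg
    have := hg (y + k i) trivial
    rw [Real.norm_of_nonneg (mul_nonneg (H.nn i) this.1)]
    calc p i * g (y + k i) ≤ p i * C ^ (y + k i) := mul_le_mul_of_nonneg_left this.2 (H.nn i)
      _ = _ := by rw [pow_add]; ring
  have hsum : ∀ y, Summable fun i => C ^ y * (p i * C ^ (k i)) := fun y => (H.mom C hC1).mul_left _
  have hcont : ∀ y, ContinuousOn (fun g : ℕ → ℝ => ∑' i, p i * g (y + k i)) K := fun y =>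
    continuousOn_tsum (fun i => (continuous_const.mul (continuous_apply _)).continuousOn)
      (hsum y) (hbd y)
  have hsub : baseB p k ⊆ K := by
    rintro g ⟨hg, hg0, hg1, hg2⟩ y -
    refine ⟨hg0 y, ?_⟩
    induction y with
    | zero => simp [hg1]
    | succ y ih =>
      rcases y with _ | y
      · simp only [zero_add, pow_one, hg2]; exact hC1
      · refine (hC g hg hg0 y).trans ?_
        rw [pow_succ' _ (y + 1)]
        exact mul_le_mul_of_nonneg_left ih hC0
  have heq : baseB p k = K ∩ {g | g 0 = 0} ∩ {g | g 1 = 1} ∩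
      ⋂ y, (K ∩ (fun g : ℕ → ℝ => (∑' i, p i * g (y + k i)) - g (y + 1)) ⁻¹' {0}) := by
    ext g
    simp only [Set.mem_inter_iff, Set.mem_iInter, Set.mem_ofPred_eq, Set.mem_preimage,
      Set.mem_singleton_iff]
    constructor
    · intro hg
      refine ⟨⟨⟨hsub hg, hg.2.2.1⟩, hg.2.2.2⟩, fun y => ⟨hsub hg, ?_⟩⟩
      rw [(hg.1 y).tsum_eq, sub_self]
    · rintro ⟨⟨⟨h1, h2⟩, h3⟩, h4⟩
      refine ⟨fun y => ?_, fun y => (h1 y trivial).1, h2, h3⟩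
      have hs : Summable fun i => p i * g (y + k i) :=
        Summable.of_norm_bounded (hsum y) fun i => hbd y i g h1
      have := hs.hasSum
      rwa [sub_eq_zero.1 (h4 y).2] at this
  rw [heq]
  refine hKc.of_isClosed_subset ?_ fun g hg => hg.1.1.1
  refine ((hKc.isClosed.inter (isClosed_eq (continuous_apply 0) continuous_const)).inter
    (isClosed_eq (continuous_apply 1) continuous_const)).inter (isClosed_iInter fun y => ?_)
  exact ((hcont y).sub (continuous_apply _).continuousOn).preimage_isClosed_of_isClosed
    hKc.isClosed isClosed_singleton

lemma baseB_extreme (H : OD p k) {r : ℝ} (hr : 1 ≤ r) (h : HasSum (fun i => p i * geoS r (k i)) 1)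
    {g : ℕ → ℝ} (hg : g ∈ (baseB p k).extremePoints ℝ) : g = geoS r := by
  obtain ⟨C, hC1, hC⟩ := Har.growth H hr h
  rw [mem_extremePoints] at hg
  obtain ⟨⟨hg, hg0, hg1, hg2⟩, hext⟩ := hg
  have hmono := hg.mono H hr h hg0
  set s : ℕ → ℝ := fun y => g (y + 1) - g y - g 1 with hs
  have hD : Har p k (fun y => g (y + 1) - g y) := (hg.shift 1).sub hg
  have hsh : Har p k s := hD.sub (Har.const H.one (g 1))
  have hs0 : ∀ y, 0 ≤ s y := by
    intro y
    have := hD.ge_zero H hr h (fun y => by have := hmono (Nat.le_succ y); simp at this ⊢; linarith) y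
    simp only [hs, zero_add, hg1] at this ⊢
    linarith
  have hsz : s 0 = 0 := by simp [hs, hg1]
  have hsC : ∀ y, s y ≤ C * g y := by
    intro y
    rcases y with _ | y
    · rw [hsz, hg1, mul_zero]
    · have := hC g hg hg0 y
      have := hg0 (y + 1)
      have := hg0 1
      simp only [hs]; linarith
  have hs1 : s 1 ≤ C := by have := hsC 1; rwa [hg2, mul_one] at this
  have heig : ∃ l : ℝ, 0 ≤ l ∧ ∀ y, s y = l * g y := by
    rcases (hs0 1).eq_or_lt with h1 | h1
    · refine ⟨0, le_rfl, fun y => ?_⟩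
      have : ∀ y, s (y + 1) ≤ 0 := by
        intro y
        induction y with
        | zero => simp [← h1]
        | succ y ih => exact (hC s hsh hs0 y).trans (by nlinarith)
      rcases y with _ | y
      · simp [hsz]
      · rw [zero_mul]; exact le_antisymm (this y) (hs0 _)
    · refine ⟨s 1, h1.le, ?_⟩
      have hpos : 0 < C + 1 - s 1 := by linarith
      have m1 : (fun y => (s 1)⁻¹ * s y) ∈ baseB p k :=
        ⟨hsh.smul _, fun y => mul_nonneg (inv_nonneg.2 h1.le) (hs0 y), by simp [hsz],
          inv_mul_cancel₀ h1.ne'⟩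
      have m2 : (fun y => (C + 1 - s 1)⁻¹ * ((C + 1) * g y - s y)) ∈ baseB p k := by
        refine ⟨((hg.smul _).sub hsh).smul _, fun y => mul_nonneg (inv_nonneg.2 hpos.le) ?_,
          by simp [hsz, hg1], ?_⟩
        · have := hsC y; have := hg0 y; nlinarith
        · beta_reduce; rw [hg2, mul_one]; exact inv_mul_cancel₀ hpos.ne'
      have hC1' : 0 < C + 1 := by linarith
      have := (hext _ m1 _ m2 ⟨s 1 / (C + 1), (C + 1 - s 1) / (C + 1), by positivity, by positivity,
        by field_simp; ring, ?_⟩).1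
      · intro y
        have h3 := congrFun this y
        rw [← h3, ← mul_assoc, mul_inv_cancel₀ h1.ne', one_mul]
      · funext y
        simp only [Pi.add_apply, Pi.smul_apply, smul_eq_mul]
        field_simp
        ring
  obtain ⟨l, hl0, hl⟩ := heig
  have hgeo : ∀ y, g y = geoS (1 + l) y := by
    intro y
    induction y with
    | zero => simp [hg1, geoS]
    | succ y ih =>
      have h1 := hl y
      simp only [hs, hg2] at h1
      have : geoS (1 + l) (y + 1) = 1 + (1 + l) * geoS (1 + l) y := by
        rw [add_comm y 1, geoS_add]; simp [geoS]
      rw [this, ← ih]; linarith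
  have hfin : HasSum (fun i => p i * geoS (1 + l) (k i)) 1 := by
    have := hg 0
    rw [zero_add, hg2] at this
    refine this.congr_fun fun i => ?_
    rw [zero_add, hgeo]
  have hlt : ∀ r₁ r₂ : ℝ, 1 ≤ r₁ → r₁ < r₂ → HasSum (fun i => p i * geoS r₁ (k i)) 1 →
      HasSum (fun i => p i * geoS r₂ (k i)) 1 → False := by
    intro r₁ r₂ h1 h12 e1 e2
    obtain ⟨i, hi, hk⟩ := H.up
    refine (hasSum_lt (f := fun i => p i * geoS r₁ (k i)) (g := fun i => p i * geoS r₂ (k i))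
      (i := i) ?_ ?_ e1 e2).false
    · intro j
      refine mul_le_mul_of_nonneg_left ?_ (H.nn j)
      exact Finset.sum_le_sum fun n _ => pow_le_pow_left₀ (by linarith) h12.le n
    · refine mul_lt_mul_of_pos_left ?_ hi
      refine Finset.sum_lt_sum (fun n _ => pow_le_pow_left₀ (by linarith) h12.le n)
        ⟨1, Finset.mem_range.2 (by omega), by simpa using h12⟩
  have : 1 + l = r := by
    rcases lt_trichotomy (1 + l) r with h' | h' | h'
    · exact (hlt _ _ (by linarith) h' hfin h).elim
    · exact h'
    · exact (hlt _ _ hr h' h hfin).elim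
  funext y
  rw [hgeo, this]

/-- Classification of nonnegative harmonic functions. -/
lemma Har.classify (H : OD p k) {r : ℝ} (hr : 1 ≤ r) (h : HasSum (fun i => p i * geoS r (k i)) 1)
    {f : ℕ → ℝ} (hf : Har p k f) (h0 : ∀ y, 0 ≤ f y) :
    ∃ c : ℝ, ∀ y, f y = f 0 + c * geoS r y := by
  have hmono := hf.mono H hr h h0
  obtain ⟨C, hC1, hC⟩ := Har.growth H hr h
  set g : ℕ → ℝ := fun y => f y - f 0 with hg
  have hgh : Har p k g := hf.sub (Har.const H.one (f 0))
  have hg0 : ∀ y, 0 ≤ g y := fun y => by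
    have := hmono (Nat.zero_le y)
    simp only [hg]; linarith
  have hgz : g 0 = 0 := by simp [hg]
  refine ⟨g 1, fun y => ?_⟩
  suffices g y = g 1 * geoS r y by simp only [hg] at this ⊢; linarith
  rcases (hg0 1).eq_or_lt with h1 | h1
  · have : ∀ y, g (y + 1) ≤ 0 := by
      intro y
      induction y with
      | zero => simp [← h1]
      | succ y ih => exact (hC g hgh hg0 y).trans (by nlinarith)
    rcases y with _ | y
    · simp [hgz, geoS]
    · rw [← h1, zero_mul]; exact le_antisymm (this y) (hg0 _)
  · have hmem : (fun y => (g 1)⁻¹ * g y) ∈ baseB p k :=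
      ⟨hgh.smul _, fun y => mul_nonneg (inv_nonneg.2 h1.le) (hg0 y), by simp [hgz],
          inv_mul_cancel₀ h1.ne'⟩
    have hKM := closure_convexHull_extremePoints (baseB_compact H hr h) baseB_convex
    have hsub : closure (convexHull ℝ ((baseB p k).extremePoints ℝ)) ⊆ {geoS r} := by
      refine closure_minimal (convexHull_min ?_ (convex_singleton _)) isClosed_singleton
      intro x hx
      exact baseB_extreme H hr h hx
    rw [hKM] at hsub
    have := congrFun (hsub hmem) y
    rw [← this, ← mul_assoc, mul_inv_cancel₀ h1.ne', one_mul]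

end onedim

section chain
variable {d : ℕ}

/-- exponential with values in the extended nonnegative reals -/
def ex (r : ℝ) : ENNReal := ENNReal.ofReal (Real.exp r)

lemma ex_add (r s : ℝ) : ex (r + s) = ex r * ex s := by
  rw [ex, Real.exp_add, ENNReal.ofReal_mul (Real.exp_pos r).le]; rfl
lemma ex_zero : ex 0 = 1 := by simp [ex]
lemma ex_ne_zero (r : ℝ) : ex r ≠ 0 := by simp [ex, Real.exp_pos]
lemma ex_ne_top (r : ℝ) : ex r ≠ ⊤ := ENNReal.ofReal_ne_top
lemma ex_le {r s : ℝ} (h : r ≤ s) : ex r ≤ ex s := ENNReal.ofReal_le_ofReal (Real.exp_le_exp.2 h)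
lemma ex_le_iff {r s : ℝ} : ex r ≤ ex s ↔ r ≤ s := by
  rw [ex, ex, ENNReal.ofReal_le_ofReal_iff (Real.exp_pos s).le, Real.exp_le_exp]
lemma ex_mul_neg (r : ℝ) : ex r * ex (-r) = 1 := by rw [← ex_add, add_neg_cancel, ex_zero]
lemma ex_neg_mul (r : ℝ) : ex (-r) * ex r = 1 := by rw [mul_comm, ex_mul_neg]
lemma ex_nat_mul (n : ℕ) (r : ℝ) : ex (n * r) = ex r ^ n := by
  rw [ex, Real.exp_nat_mul, ENNReal.ofReal_pow (Real.exp_pos r).le]; rfl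
lemma ex_le_mul_iff {r : ℝ} {x y : ENNReal} : x * ex r ≤ y ↔ x ≤ y * ex (-r) := by
  constructor
  · intro h
    calc x = x * (ex r * ex (-r)) := by rw [ex_mul_neg, mul_one]
      _ = x * ex r * ex (-r) := by ring
      _ ≤ _ := mul_le_mul_left h _
  · intro h
    calc x * ex r ≤ y * ex (-r) * ex r := mul_le_mul_left h _
      _ = y * (ex (-r) * ex r) := by ring
      _ = y := by rw [ex_neg_mul, mul_one]

lemma exists_ex {x : ENNReal} (h0 : x ≠ 0) (ht : x ≠ ⊤) : ∃ r, x = ex r := by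
  refine ⟨Real.log x.toReal, ?_⟩
  rw [ex, Real.exp_log (ENNReal.toReal_pos h0 ht), ENNReal.ofReal_toReal ht]

/-- general reflected kernel -/
def Ak (m m0 : Zd d → ENNReal) (z z' : Ed d) : ENNReal :=
  if z.2 = 0 then m0 (jump z z') else m (jump z z')
/-- homogeneous kernel -/
def Hk (m : Zd d → ENNReal) (z z' : Zd d) : ENNReal := m (z' - z)
/-- generating function -/
def pm (m : Zd d → ENNReal) (a : Rd d) : ENNReal := ∑' j, m j * ex (dotZ a j)
/-- boundary measure of the auxiliary walk -/
def mpos (m : Zd d → ENNReal) (j : Zd d) : ENNReal := if j.2 < 0 then 0 else m j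
/-- translations along the boundary -/
def sft (u : Fin d → ℤ) : Ed d ≃ Ed d := Equiv.prodCongr (Equiv.addRight u) (Equiv.refl ℕ)

lemma sft_apply (u : Fin d → ℤ) (z : Ed d) : sft u z = (z.1 + u, z.2) := rfl

lemma jump_sft (u : Fin d → ℤ) (z w : Ed d) : jump (sft u z) (sft u w) = jump z w := by
  simp [jump, sft_apply]

lemma Ak_sft (m m0 : Zd d → ENNReal) (u : Fin d → ℤ) (z w : Ed d) :
    Ak m m0 (sft u z) (sft u w) = Ak m m0 z w := by
  simp only [Ak, jump_sft]
  rfl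

lemma dotE_add (a : Rd d) (z w : Ed d) : dotE a (z + w) = dotE a z + dotE a w := by
  simp only [dotE, Prod.fst_add, Prod.snd_add, Pi.add_apply]
  push_cast
  simp only [mul_add, Finset.sum_add_distrib]; ring

lemma dotE_jump (a : Rd d) (z w : Ed d) : dotE a w = dotE a z + dotZ a (jump z w) := by
  simp only [dotE, dotZ, jump, Pi.sub_apply]
  push_cast
  simp only [mul_sub, Finset.sum_sub_distrib]; ring

lemma dotE_zero (a : Rd d) : dotE a 0 = 0 := by simp [dotE]

lemma jump_inj (z : Ed d) : Function.Injective (jump z) := by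
  rintro ⟨x, y⟩ ⟨x', y'⟩ h
  simp only [jump, Prod.mk.injEq] at h
  ext1
  · simpa using h.1
  · have := h.2; simp only; omega

lemma exists_jump (z : Ed d) (j : Zd d) (h : 0 ≤ (z.2 : ℤ) + j.2) : ∃ w, jump z w = j ∧ (w.2 : ℤ) = z.2 + j.2 := by
  refine ⟨(z.1 + j.1, ((z.2 : ℤ) + j.2).toNat), ?_, ?_⟩
  · simp only [jump]
    ext1
    · simp
    · simp only; rw [Int.toNat_of_nonneg h]; ring
  · simp only; rw [Int.toNat_of_nonneg h]

lemma tsum_jump (z : Ed d) (F : Zd d → ENNReal) (h : ∀ j : Zd d, (z.2 : ℤ) + j.2 < 0 → F j = 0) :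
    ∑' w, F (jump z w) = ∑' j, F j := by
  refine (jump_inj z).tsum_eq (f := F) ?_
  intro j hj
  by_contra hn
  refine hj (h j ?_)
  by_contra h'
  obtain ⟨w, hw, _⟩ := exists_jump z j (by omega)
  exact hn ⟨w, hw⟩

/-- support conditions -/
structure Supp (m m0 : Zd d → ENNReal) : Prop where
  s1 : ∀ j : Zd d, j.2 < -1 → m j = 0
  s0 : ∀ j : Zd d, j.2 < 0 → m0 j = 0

lemma kapp_ex {m m0 : Zd d → ENNReal} (H : Supp m m0) (a : Rd d) (z : Ed d) :
    kapp (Ak m m0) (fun w => ex (dotE a w)) z =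
      (if z.2 = 0 then pm m0 a else pm m a) * ex (dotE a z) := by
  simp only [kapp, pm]
  have : ∀ w, Ak m m0 z w * ex (dotE a w) =
      ((fun j => (if z.2 = 0 then m0 j else m j) * ex (dotZ a j)) (jump z w)) * ex (dotE a z) := by
    intro w
    rw [dotE_jump a z w, ex_add]
    simp only [Ak]; ring
  simp_rw [this]
  rw [ENNReal.tsum_mul_right]
  rw [tsum_jump z (fun j => (if z.2 = 0 then m0 j else m j) * ex (dotZ a j))]
  · split_ifs <;> rfl
  · intro j hj
    split_ifs with h
    · rw [H.s0 j (by omega), zero_mul]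
    · rw [H.s1 j (by omega), zero_mul]

/-- the `ℓ¹` norm -/
def n1 (j : Zd d) : ℕ := ∑ i, (j.1 i).natAbs + j.2.natAbs
/-- sign patterns -/
def sgA (R : ℝ) (e : (Fin d → Bool) × Bool) : Rd d :=
  (fun i => if e.1 i then R else -R, if e.2 then R else -R)
/-- embedding of the half space -/
def toZ (z : Ed d) : Zd d := (z.1, (z.2 : ℤ))

lemma dotE_toZ (a : Rd d) (z : Ed d) : dotE a z = dotZ a (toZ z) := by
  simp [dotE, dotZ, toZ]

lemma jump_zero (z : Ed d) : jump 0 z = toZ z := by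
  simp [jump, toZ]

lemma ex_n1_le (R : ℝ) (j : Zd d) : ex (R * n1 j) ≤ ∑ e, ex (dotZ (sgA R e) j) := by
  set e : (Fin d → Bool) × Bool := (fun i => decide (0 ≤ j.1 i), decide (0 ≤ j.2)) with he
  have h1 : ∀ k : ℤ, (if decide (0 ≤ k) = true then R else -R) * (k : ℝ) = R * (k.natAbs : ℝ) := by
    intro k
    rw [Nat.cast_natAbs]
    by_cases h : 0 ≤ k
    · simp [h, abs_of_nonneg h]
    · simp only [decide_eq_true_eq, h, if_false]
      rw [abs_of_neg (by omega)]; push_cast; ring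
  have : R * n1 j = dotZ (sgA R e) j := by
    simp only [dotZ, sgA, he, h1, n1]
    push_cast
    rw [mul_add, Finset.mul_sum]
  rw [this]
  exact Finset.single_le_sum (f := fun e => ex (dotZ (sgA R e) j)) (fun i _ => zero_le) (Finset.mem_univ e)

lemma sum_n1_ne_top {m : Zd d → ENNReal} (h : ∀ a, pm m a ≠ ⊤) (R : ℝ) :
    ∑' j, m j * ex (R * n1 j) ≠ ⊤ := by
  refine ne_top_of_le_ne_top (b := ∑ e, pm m (sgA R e)) (by simp [ENNReal.sum_eq_top, h]) ?_
  simp only [pm]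
  rw [← Summable.tsum_finsetSum fun i _ => ENNReal.summable]
  refine ENNReal.tsum_le_tsum fun j => ?_
  rw [← Finset.mul_sum]
  exact mul_le_mul_right (ex_n1_le R j) _

lemma dotZ_le (a : Rd d) : ∃ R : ℝ, 0 ≤ R ∧ ∀ j : Zd d, |dotZ a j| ≤ R * n1 j := by
  refine ⟨∑ i, |a.1 i| + |a.2|, by positivity, fun j => ?_⟩
  simp only [dotZ, n1]
  push_cast
  have h1 : ∀ i, |a.1 i * (j.1 i : ℝ)| ≤ (∑ i, |a.1 i| + |a.2|) * |(j.1 i : ℝ)| := by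
    intro i
    rw [abs_mul]
    refine mul_le_mul_of_nonneg_right ?_ (abs_nonneg _)
    have := Finset.single_le_sum (f := fun i => |a.1 i|) (fun i _ => abs_nonneg _) (Finset.mem_univ i)
    have := abs_nonneg a.2
    linarith
  have h2 : |a.2 * (j.2 : ℝ)| ≤ (∑ i, |a.1 i| + |a.2|) * |(j.2 : ℝ)| := by
    rw [abs_mul]
    refine mul_le_mul_of_nonneg_right ?_ (abs_nonneg _)
    have : 0 ≤ ∑ i, |a.1 i| := by positivity
    linarith
  calc _ ≤ |∑ i, a.1 i * (j.1 i : ℝ)| + |a.2 * (j.2 : ℝ)| := abs_add_le _ _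
    _ ≤ ∑ i, |a.1 i * (j.1 i : ℝ)| + |a.2 * (j.2 : ℝ)| := by gcongr; exact Finset.abs_sum_le_sum_abs _ _
    _ ≤ ∑ i, (∑ i, |a.1 i| + |a.2|) * |(j.1 i : ℝ)| + (∑ i, |a.1 i| + |a.2|) * |(j.2 : ℝ)| := by
        gcongr with i; exact h1 i
    _ = _ := by rw [← Finset.mul_sum, ← mul_add]; simp only [Nat.cast_natAbs, Int.cast_abs]

lemma kpow_decay {m m0 : Zd d → ENNReal} (H : Supp m m0) (h : ∀ a, pm m a ≠ ⊤) (h' : ∀ a, pm m0 a ≠ ⊤)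
    (R : ℝ) : ∃ C M : ℝ, ∀ n w, kpow (Ak m m0) n 0 w * ex (R * n1 (toZ w)) ≤ ex (C + M * n) := by
  set f : Ed d → ENNReal := fun w => ∑ e, ex (dotE (sgA R e) w) with hf
  set M : ENNReal := 1 + ∑ e, (pm m (sgA R e) + pm m0 (sgA R e)) with hM
  have hfM : ∀ z, kapp (Ak m m0) f z ≤ M * f z := by
    intro z
    have : kapp (Ak m m0) f z = ∑ e, kapp (Ak m m0) (fun w => ex (dotE (sgA R e) w)) z := by
      simp only [kapp, hf, Finset.mul_sum]
      rw [Summable.tsum_finsetSum fun i _ => ENNReal.summable]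
    rw [this, hf, Finset.mul_sum]
    refine Finset.sum_le_sum fun e _ => ?_
    rw [kapp_ex H]
    refine mul_le_mul_left ?_ _
    have h1 := Finset.single_le_sum (f := fun e => pm m (sgA R e) + pm m0 (sgA R e)) (fun i _ => zero_le) (Finset.mem_univ e)
    refine le_trans ?_ (h1.trans le_add_self)
    split_ifs
    · exact le_add_self
    · exact le_self_add
  have hM0 : M ≠ 0 := by simp [hM]
  have hMt : M ≠ ⊤ := by simp [hM, ENNReal.sum_eq_top, h, h']
  have hf0 : f 0 ≠ 0 := by
    simp [hf, ex_ne_zero]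
  have hft : f 0 ≠ ⊤ := by simp [hf, ENNReal.sum_eq_top, ex_ne_top]
  obtain ⟨C, hC⟩ := exists_ex hf0 hft
  obtain ⟨M', hM'⟩ := exists_ex hM0 hMt
  refine ⟨C, M', fun n w => ?_⟩
  have h1 := kpow_super (Ak m m0) f M hfM n 0
  have h2 := (kapp_term (kpow (Ak m m0) n) f 0 w).trans h1
  rw [ex_add, mul_comm M', ex_nat_mul, ← hC, ← hM', mul_comm (f 0)]
  refine le_trans (mul_le_mul_right ?_ _) h2
  refine (ex_n1_le R (toZ w)).trans (le_of_eq ?_)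
  simp only [hf, dotE_toZ]

lemma sum_pi_ne_top (f : ℤ → ENNReal) (h : ∑' k, f k ≠ ⊤) : ∑' x : Fin d → ℤ, ∏ i, f (x i) ≠ ⊤ := by
  refine ne_top_of_le_ne_top (b := (∑' k, f k) ^ d) (by simp [h]) ?_
  rw [ENNReal.tsum_eq_iSup_sum]
  refine iSup_le fun s => ?_
  set t : Finset ℤ := s.biUnion fun x => Finset.univ.image x with ht
  calc ∑ x ∈ s, ∏ i, f (x i) ≤ ∑ x ∈ Fintype.piFinset (fun _ : Fin d => t), ∏ i, f (x i) := by
        refine Finset.sum_le_sum_of_subset fun x hx => ?_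
        rw [Fintype.mem_piFinset]
        intro i
        rw [ht, Finset.mem_biUnion]
        exact ⟨x, hx, Finset.mem_image_of_mem _ (Finset.mem_univ i)⟩
    _ = ∏ i : Fin d, ∑ k ∈ t, f k := by rw [Finset.prod_univ_sum]
    _ = (∑ k ∈ t, f k) ^ d := by simp
    _ ≤ _ := by gcongr; exact ENNReal.sum_le_tsum t

lemma sum_int_ne_top (r : ℝ) (hr : 0 < r) : ∑' k : ℤ, ex (-(r * (k.natAbs : ℝ))) ≠ ⊤ := by
  have hgeo : ∑' n : ℕ, ex (-(r * (n : ℝ))) ≠ ⊤ := by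
    have : ∀ n : ℕ, ex (-(r * (n : ℝ))) = ex (-r) ^ n := fun n => by
      rw [← ex_nat_mul]; congr 1; ring
    simp_rw [this]
    rw [ENNReal.tsum_geometric, ENNReal.inv_ne_top, Ne, tsub_eq_zero_iff_le, not_le, ← ex_zero]
    rw [lt_iff_not_ge, ex_le_iff]; linarith
  have h1 : ∑' k : ℤ, ex (-(r * (k.natAbs : ℝ))) ≤ ∑' n : ℕ, ex (-(r * (n : ℝ))) + ∑' n : ℕ, ex (-(r * (n : ℝ))) := by
    rw [tsum_of_nat_of_neg_add_one ENNReal.summable ENNReal.summable]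
    refine add_le_add (le_of_eq (by simp)) (ENNReal.tsum_le_tsum fun n => ex_le ?_)
    have : ((-((n : ℤ) + 1)).natAbs : ℝ) = n + 1 := by
      have : (-((n : ℤ) + 1)).natAbs = n + 1 := by omega
      rw [this]; push_cast; ring
    rw [this]; nlinarith
  exact ne_top_of_le_ne_top (by simp [hgeo]) h1

lemma sum_Zd_ne_top (r : ℝ) (hr : 0 < r) : ∑' j : Zd d, ex (-(r * n1 j)) ≠ ⊤ := by
  have h1 := sum_int_ne_top r hr
  have h2 := sum_pi_ne_top (d := d) _ h1
  rw [ENNReal.tsum_prod' (f := fun j : Zd d => ex (-(r * n1 j)))]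
  have : ∀ (x : Fin d → ℤ) (y : ℤ), ex (-(r * n1 ((x, y) : Zd d))) =
      (∏ i, ex (-(r * ((x i).natAbs : ℝ)))) * ex (-(r * (y.natAbs : ℝ))) := by
    intro x y
    have h3 : ∀ s : Finset (Fin d), ∏ i ∈ s, ex (-(r * ((x i).natAbs : ℝ))) = ex (∑ i ∈ s, -(r * ((x i).natAbs : ℝ))) := by
      intro s
      induction s using Finset.induction_on with
      | empty => simp [ex_zero]
      | insert i s hi ih => rw [Finset.prod_insert hi, Finset.sum_insert hi, ex_add, ih]
    rw [h3, ← ex_add]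
    congr 1
    simp only [n1]
    push_cast
    rw [Finset.sum_neg_distrib, ← Finset.mul_sum]
    ring
  simp_rw [this, ENNReal.tsum_mul_left, ENNReal.tsum_mul_right]
  exact ENNReal.mul_ne_top h2 h1

lemma toZ_inj : Function.Injective (toZ (d := d)) := by
  intro z w h
  rw [← jump_zero, ← jump_zero] at h
  exact jump_inj 0 h

lemma sum_Ed_ne_top (r : ℝ) (hr : 0 < r) : ∑' w : Ed d, ex (-(r * n1 (toZ w))) ≠ ⊤ :=
  ne_top_of_le_ne_top (sum_Zd_ne_top r hr)
    (ENNReal.tsum_comp_le_tsum_of_injective toZ_inj fun j : Zd d => ex (-(r * n1 j)))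

end chain

section harnack
variable {d : ℕ}

/-- abstract assumptions on the killed reflected chain -/
structure Chain (m m0 : Zd d → ENNReal) : Prop extends Supp m m0 where
  irr : ∀ z z', ∃ n, kpow (Ak m m0) n z z' ≠ 0
  irrh : ∀ z, ∃ n, kpow (Hk m) n 0 z ≠ 0
  mom : ∀ a, pm m a ≠ ⊤
  mom0 : ∀ a, pm m0 a ≠ ⊤
  fin : ∀ z w, kgreen (Ak m m0) z w ≠ ⊤

variable {m m0 : Zd d → ENNReal}

lemma tsum_ne_zero_exists {S : Type*} {f : S → ENNReal} (h : ∑' v, f v ≠ 0) : ∃ v, f v ≠ 0 := by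
  by_contra hn
  push Not at hn
  exact h (by simp [hn])

lemma jump_add_jump (z w v : Ed d) : jump z w + jump w v = jump z v := by
  simp only [jump]
  ext1
  · simp
  · simp

lemma harnack_high (H : Supp m m0) (n : ℕ) : ∀ e : Zd d, kpow (Hk m) n 0 e ≠ 0 →
    (-(n : ℤ) ≤ e.2 ∧ ∃ c : ENNReal, c ≠ 0 ∧ ∀ z z' : Ed d, n ≤ z.2 → jump z z' = e →
      c ≤ kpow (Ak m m0) n z z') := by
  induction n with
  | zero =>
    intro e he
    have : e = 0 := by
      by_contra h
      exact he (by simp [kpow, kone, Ne.symm h])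
    subst this
    refine ⟨by simp, 1, one_ne_zero, fun z z' _ hz => ?_⟩
    have : z = z' := by
      apply jump_inj z
      rw [hz]; simp [jump]
    simp [this, kpow, kone]
  | succ n ih =>
    intro e he
    rw [kpow, kmul] at he
    obtain ⟨v, hv⟩ := tsum_ne_zero_exists he
    obtain ⟨hv1, hv2⟩ := mul_ne_zero_iff.1 hv
    obtain ⟨hn, c, hc, hcc⟩ := ih v hv1
    have hstep : -1 ≤ (e - v).2 := by
      by_contra h
      exact hv2 (H.s1 _ (by omega))
    simp only [Prod.snd_sub] at hstep
    refine ⟨by push_cast; omega, c * m (e - v), mul_ne_zero hc hv2, fun z z' hz hzz => ?_⟩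
    obtain ⟨w, hw, hw2⟩ := exists_jump z v (by omega)
    have h1 := hcc z w (by omega) hw
    have h2 : Ak m m0 w z' = m (e - v) := by
      have : w.2 ≠ 0 := by omega
      simp only [Ak, this, if_false]
      congr 1
      rw [← hzz, ← hw, ← jump_add_jump z w z']; simp
    rw [kpow, kmul_eq]
    refine le_trans ?_ (kapp_term _ _ z w)
    rw [h2]
    exact mul_le_mul_left h1 _

lemma kpow_sft (m m0 : Zd d → ENNReal) (u : Fin d → ℤ) (n : ℕ) (z w : Ed d) :
    kpow (Ak m m0) n (sft u z) (sft u w) = kpow (Ak m m0) n z w :=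
  kpow_shift _ _ (Ak_sft m m0 u) n z w

lemma harnack_low (H : Chain m m0) (e : Zd d) (n : ℕ) : ∃ c : ENNReal, c ≠ 0 ∧ ∃ N : ℕ,
    ∀ z z' : Ed d, z.2 < n → jump z z' = e → ∃ k ≤ N, c ≤ kpow (Ak m m0) k z z' := by
  induction n with
  | zero => exact ⟨1, one_ne_zero, 0, fun z z' hz => by omega⟩
  | succ n ih =>
    obtain ⟨c, hc, N, hN⟩ := ih
    by_cases h : 0 ≤ (n : ℤ) + e.2
    · obtain ⟨w, hw, hw2⟩ := exists_jump ((0, n) : Ed d) e h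
      obtain ⟨k, hk⟩ := H.irr (0, n) w
      refine ⟨min c (kpow (Ak m m0) k (0, n) w), by simp [hc, hk], max N k, fun z z' hz hzz => ?_⟩
      by_cases hzn : z.2 < n
      · obtain ⟨k', h1, h2⟩ := hN z z' hzn hzz
        exact ⟨k', h1.trans (le_max_left _ _), (min_le_left _ _).trans h2⟩
      · have hzn' : z.2 = n := by omega
        refine ⟨k, le_max_right _ _, (min_le_right _ _).trans ?_⟩
        obtain ⟨u, y⟩ := z
        have e1 : ((u, y) : Ed d) = sft u (0, n) := by
          rw [sft_apply]; ext1
          · simp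
          · exact hzn'
        have e2 : z' = sft u w := by
          apply jump_inj (u, y)
          rw [hzz, e1, jump_sft, hw]
        rw [e2, e1, kpow_sft]
    · refine ⟨c, hc, N, fun z z' hz hzz => ?_⟩
      by_cases hzn : z.2 < n
      · exact hN z z' hzn hzz
      · exfalso
        have : e.2 = (z'.2 : ℤ) - z.2 := by rw [← hzz]; rfl
        omega

lemma harnack (H : Chain m m0) (e : Zd d) : ∃ c : ENNReal, c ≠ 0 ∧ ∃ N : ℕ,
    ∀ z z' : Ed d, jump z z' = e → ∃ k ≤ N, c ≤ kpow (Ak m m0) k z z' := by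
  obtain ⟨n, hn⟩ := H.irrh e
  obtain ⟨-, c, hc, hcc⟩ := harnack_high H.toSupp n e hn
  obtain ⟨c', hc', N, hN⟩ := harnack_low H e n
  refine ⟨min c c', by simp [hc, hc'], max n N, fun z z' h => ?_⟩
  by_cases hz : z.2 < n
  · obtain ⟨k, hk, hk2⟩ := hN z z' hz h
    exact ⟨k, hk.trans (le_max_right _ _), (min_le_right _ _).trans hk2⟩
  · exact ⟨n, le_max_left _ _, (min_le_left _ _).trans (hcc z z' (by omega) h)⟩

lemma kpow_le_kQ (K : Ed d → Ed d → ENNReal) (k N : ℕ) (h : k ≤ N) (z w : Ed d) :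
    2⁻¹ ^ (N + 1) * kpow K k z w ≤ kQ K z w := by
  refine le_trans (mul_le_mul_left ?_ _) (ENNReal.le_tsum (f := fun n => (2⁻¹ : ENNReal) ^ (n + 1) * kpow K n z w) k)
  exact pow_le_pow_right_of_le_one' (by simp [ENNReal.inv_le_one]) (by omega)

lemma harnack_kQ (H : Chain m m0) (u : Fin d → ℤ) : ∃ c : ℝ, 0 < c ∧
    ∀ z : Ed d, ENNReal.ofReal c ≤ kQ (Ak m m0) z (sft u z) := by
  obtain ⟨c, hc, N, hN⟩ := harnack H (u, 0)
  set c' : ENNReal := min 1 (2⁻¹ ^ (N + 1) * c) with hc'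
  have h0 : c' ≠ 0 := by simp [hc', hc]
  have ht : c' ≠ ⊤ := by simp [hc']
  refine ⟨c'.toReal, ENNReal.toReal_pos h0 ht, fun z => ?_⟩
  rw [ENNReal.ofReal_toReal ht]
  obtain ⟨k, hk, hk2⟩ := hN z (sft u z) (by simp [jump, sft_apply])
  exact (min_le_right _ _).trans ((mul_le_mul_right hk2 _).trans (kpow_le_kQ _ k N hk z _))

/-- unit vectors -/
def unitV (s : (Fin d × Bool) ⊕ Bool) : Zd d :=
  match s with
  | Sum.inl (i, b) => (Pi.single i (if b then 1 else -1), 0)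
  | Sum.inr b => (0, if b then 1 else -1)

lemma unit_step (z z' : Ed d) (n : ℕ) (h : n1 (jump z z') = n + 1) :
    ∃ s w, jump z w = unitV s ∧ n1 (jump w z') = n := by
  by_cases hx : z.1 = z'.1
  · have hy : ((z'.2 : ℤ) - z.2).natAbs = n + 1 := by
      simpa [n1, jump, hx] using h
    by_cases hlt : z.2 < z'.2
    · refine ⟨Sum.inr true, (z.1, z.2 + 1), by simp [jump, unitV], ?_⟩
      simp only [n1, jump, hx, sub_self, Pi.zero_apply, Int.natAbs_zero, Finset.sum_const_zero, zero_add]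
      push_cast; omega
    · refine ⟨Sum.inr false, (z.1, z.2 - 1), ?_, ?_⟩
      · simp only [jump, unitV, sub_self, Prod.mk.injEq, true_and]
        simp only [Bool.false_eq_true, if_false]
        omega
      · simp only [n1, jump, hx, sub_self, Pi.zero_apply, Int.natAbs_zero, Finset.sum_const_zero, zero_add]
        omega
  · obtain ⟨i, hi⟩ := Function.ne_iff.1 hx
    have key : ∀ b : Bool, ((z'.1 i - z.1 i - (if b then 1 else -1)).natAbs + 1 = (z'.1 i - z.1 i).natAbs) →
        ∃ s w, jump z w = unitV s ∧ n1 (jump w z') = n := by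
      intro b hb
      refine ⟨Sum.inl (i, b), (z.1 + Pi.single i (if b then 1 else -1), z.2), by simp [jump, unitV], ?_⟩
      simp only [n1, jump] at h ⊢
      rw [← Finset.add_sum_erase _ _ (Finset.mem_univ i)] at h ⊢
      have : ∑ x ∈ Finset.univ.erase i, ((z'.1 - (z.1 + (Pi.single i (if b = true then 1 else -1) : Fin d → ℤ))) x).natAbs
          = ∑ x ∈ Finset.univ.erase i, ((z'.1 - z.1) x).natAbs := by
        refine Finset.sum_congr rfl fun x hx => ?_
        have : x ≠ i := (Finset.mem_erase.1 hx).1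
        simp [this]
      rw [this]
      simp only [Pi.sub_apply, Pi.add_apply, Pi.single_eq_same] at h hb ⊢
      have e : z'.1 i - (z.1 i + if b = true then 1 else -1) = z'.1 i - z.1 i - (if b then 1 else -1) := by ring
      rw [e]; omega
    by_cases hlt : z.1 i < z'.1 i
    · exact key true (by simp only [if_true]; omega)
    · exact key false (by simp only [Bool.false_eq_true, if_false]; omega)

/-- Global Harnack inequality. -/
lemma harnack_n1 (H : Chain m m0) : ∃ κ : ℝ, 0 ≤ κ ∧ ∀ z z' : Ed d, ∃ k,
    ex (-(κ * n1 (jump z z'))) ≤ kpow (Ak m m0) k z z' := by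
  have hu := fun s : (Fin d × Bool) ⊕ Bool => harnack H (unitV s)
  choose c hc N hN using hu
  obtain ⟨s0, hs0⟩ := Finite.exists_min c
  set c0 : ENNReal := min 1 (c s0) with hc0
  obtain ⟨r, hr⟩ := exists_ex (x := c0) (by simp [hc0, hc]) (by simp [hc0])
  have hr0 : r ≤ 0 := by
    rw [← ex_le_iff, ← hr, ex_zero]; exact min_le_left _ _
  refine ⟨-r, by linarith, ?_⟩
  have : ∀ n z z', n1 (jump z z') = n → ∃ k, ex (-(-r * (n : ℝ))) ≤ kpow (Ak m m0) k z z' := by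
    intro n
    induction n with
    | zero =>
      intro z z' h
      refine ⟨0, ?_⟩
      have : z = z' := by
        simp only [n1, Nat.add_eq_zero_iff, Finset.sum_eq_zero_iff, Int.natAbs_eq_zero, jump] at h
        ext1
        · funext i
          have := h.1 i (Finset.mem_univ i)
          simp only [Pi.sub_apply] at this; omega
        · omega
      simp [this, kpow, kone, ex_zero]
    | succ n ih =>
      intro z z' h
      obtain ⟨s, w, hw, hn⟩ := unit_step z z' n h
      obtain ⟨k, hk⟩ := ih w z' hn
      obtain ⟨k', -, hk'⟩ := hN s z w hw
      refine ⟨k' + k, le_trans ?_ (kpow_mul_le _ k' k z w z')⟩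
      have : -(-r * ((n + 1 : ℕ) : ℝ)) = r + -(-r * n) := by push_cast; ring
      rw [this, ex_add, ← hr]
      exact mul_le_mul' ((min_le_right _ _).trans ((hs0 s).trans hk')) hk
  exact fun z z' => this _ z z' rfl

/-- scaled kernels -/
lemma kpow_scale {S : Type*} (K : S → S → ENNReal) (x : ENNReal) (n : ℕ) (z w : S) :
    kpow (fun z w => x * K z w) n z w = x ^ n * kpow K n z w := by
  induction n generalizing w with
  | zero => simp [kpow]
  | succ n ih =>
    simp only [kpow, kmul]
    rw [← ENNReal.tsum_mul_left]
    congr 1; funext v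
    rw [ih, pow_succ]; ring

lemma Ak_scale (m m0 : Zd d → ENNReal) (x : ENNReal) :
    Ak (fun j => x * m j) (fun j => x * m0 j) = fun z w => x * Ak m m0 z w := by
  funext z w
  simp only [Ak]
  split_ifs <;> rfl

lemma pm_scale (m : Zd d → ENNReal) (x : ENNReal) (a : Rd d) :
    pm (fun j => x * m j) a = x * pm m a := by
  simp only [pm, mul_assoc, ENNReal.tsum_mul_left]

/-- summability of bounded exponentially weighted powers after killing -/
lemma sum_trick (H : Supp m m0) (h : ∀ a, pm m a ≠ ⊤) (h' : ∀ a, pm m0 a ≠ ⊤)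
    {I : Type*} (ι : I → Ed d) (hι : Function.Injective ι) (a : Rd d)
    (hle : ∀ n i, kpow (Ak m m0) n 0 (ι i) * ex (dotE a (ι i)) ≤ 1) (r : ℝ) (hr : 0 < r) :
    ∑' i, kgreen (fun z w => ex (-r) * Ak m m0 z w) 0 (ι i) * ex (dotE a (ι i)) ≠ ⊤ := by
  obtain ⟨R, hR0, hR⟩ := dotZ_le a
  obtain ⟨C, M, hCM⟩ := kpow_decay H h h' (R + 1)
  have hb : ∀ n i, kpow (Ak m m0) n 0 (ι i) * ex (dotE a (ι i)) ≤ ex (C + M * n - n1 (toZ (ι i))) := by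
    intro n i
    have h1 := hCM n (ι i)
    have h2 : dotE a (ι i) ≤ R * n1 (toZ (ι i)) := by
      rw [dotE_toZ]; exact (le_abs_self _).trans (hR _)
    calc _ ≤ kpow (Ak m m0) n 0 (ι i) * ex ((R + 1) * n1 (toZ (ι i)) + -(n1 (toZ (ι i)) : ℝ)) :=
          mul_le_mul_right (ex_le (by linarith)) _
      _ = kpow (Ak m m0) n 0 (ι i) * ex ((R + 1) * n1 (toZ (ι i))) * ex (-(n1 (toZ (ι i)) : ℝ)) := by
          rw [ex_add]; ring
      _ ≤ ex (C + M * n) * ex (-(n1 (toZ (ι i)) : ℝ)) := mul_le_mul_left h1 _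
      _ = _ := by rw [← ex_add]; congr 1
  set θ : ℝ := min 1 (r / (2 * (|M| + 1))) with hθ
  have hθ0 : 0 < θ := by positivity
  have hθ1 : θ ≤ 1 := min_le_left _ _
  have hθM : θ * M ≤ r / 2 := by
    have h1 : θ ≤ r / (2 * (|M| + 1)) := min_le_right _ _
    calc θ * M ≤ θ * (|M| + 1) := by
          refine mul_le_mul_of_nonneg_left ?_ hθ0.le
          have := le_abs_self M; linarith
      _ ≤ r / (2 * (|M| + 1)) * (|M| + 1) := by gcongr
      _ = r / 2 := by field_simp
  have hb2 : ∀ n i, kpow (Ak m m0) n 0 (ι i) * ex (dotE a (ι i)) ≤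
      ex (θ * C) * (ex (r / 2) ^ n * ex (-(θ * n1 (toZ (ι i))))) := by
    intro n i
    have h3 : kpow (Ak m m0) n 0 (ι i) * ex (dotE a (ι i)) ≤ ex (θ * (C + M * n - n1 (toZ (ι i)))) := by
      by_cases hs : 0 ≤ C + M * n - n1 (toZ (ι i))
      · refine (hle n i).trans ?_
        rw [← ex_zero]; exact ex_le (by positivity)
      · exact (hb n i).trans (ex_le (by nlinarith))
    refine h3.trans ?_
    rw [← ex_nat_mul, ← ex_add, ← ex_add]
    refine ex_le ?_
    have : (0 : ℝ) ≤ n := Nat.cast_nonneg n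
    nlinarith
  have hsum : ∑' i, ex (-(θ * n1 (toZ (ι i)))) ≠ ⊤ :=
    ne_top_of_le_ne_top (sum_Ed_ne_top θ hθ0)
      (ENNReal.tsum_comp_le_tsum_of_injective hι fun w : Ed d => ex (-(θ * n1 (toZ w))))
  have hgeo : ∑' n : ℕ, ex (-(r / 2)) ^ n ≠ ⊤ := by
    rw [ENNReal.tsum_geometric, ENNReal.inv_ne_top, Ne, tsub_eq_zero_iff_le, not_le, ← ex_zero]
    rw [lt_iff_not_ge, ex_le_iff]; linarith
  refine ne_top_of_le_ne_top (b := ∑' i, ∑' n : ℕ, ex (θ * C) * (ex (-(r / 2)) ^ n * ex (-(θ * n1 (toZ (ι i)))))) ?_ ?_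
  · simp_rw [ENNReal.tsum_mul_left, ENNReal.tsum_mul_right, ENNReal.tsum_mul_left]
    exact ENNReal.mul_ne_top (ex_ne_top _) (ENNReal.mul_ne_top hgeo hsum)
  · refine ENNReal.tsum_le_tsum fun i => ?_
    rw [kgreen, ← ENNReal.tsum_mul_right]
    refine ENNReal.tsum_le_tsum fun n => ?_
    rw [kpow_scale, mul_assoc]
    refine (mul_le_mul_right (hb2 n i) _).trans (le_of_eq ?_)
    have : ex (-(r / 2)) = ex (-r) * ex (r / 2) := by rw [← ex_add]; congr 1; ring
    rw [this, mul_pow]; ring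

end harnack

section theta
variable {d : ℕ} {m m0 : Zd d → ENNReal}

lemma hom_closed (P : Zd d → Prop) (h0 : P 0) (hadd : ∀ x y, P x → P y → P (x + y))
    (hm : ∀ j, m j ≠ 0 → P j) (n : ℕ) : ∀ e, kpow (Hk m) n 0 e ≠ 0 → P e := by
  induction n with
  | zero =>
    intro e he
    have : e = 0 := by
      by_contra h
      exact he (by simp [kpow, kone, Ne.symm h])
    rwa [this]
  | succ n ih =>
    intro e he
    rw [kpow, kmul] at he
    obtain ⟨v, hv⟩ := tsum_ne_zero_exists he
    obtain ⟨hv1, hv2⟩ := mul_ne_zero_iff.1 hv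
    have := hadd _ _ (ih v hv1) (hm _ hv2)
    simpa using this

lemma Chain.down (H : Chain m m0) : ∃ j : Zd d, m j ≠ 0 ∧ j.2 = -1 := by
  by_contra hn
  push Not at hn
  obtain ⟨n, hk⟩ := H.irrh (0, -1)
  have := hom_closed (m := m) (fun j => 0 ≤ j.2) le_rfl (fun x y hx hy => by simp only [Prod.snd_add]; omega)
    (fun j hj => by
      by_contra h
      by_cases h1 : j.2 < -1
      · exact hj (H.s1 j h1)
      · exact hn j hj (by omega)) n _ hk
  simp at this

lemma Chain.up (H : Chain m m0) : ∃ j : Zd d, m j ≠ 0 ∧ 0 < j.2 := by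
  by_contra hn
  push Not at hn
  obtain ⟨n, hk⟩ := H.irrh (0, 1)
  have := hom_closed (m := m) (fun j => j.2 ≤ 0) le_rfl (fun x y hx hy => by simp only [Prod.snd_add]; omega)
    hn n _ hk
  simp at this

lemma Chain.up0 (H : Chain m m0) : ∃ j : Zd d, m0 j ≠ 0 ∧ 0 < j.2 := by
  by_contra hn
  push Not at hn
  obtain ⟨n, hk⟩ := H.irr 0 (0, 1)
  have : ∀ n w, kpow (Ak m m0) n 0 w ≠ 0 → w.2 = 0 := by
    intro n
    induction n with
    | zero =>
      intro w hw
      have : w = 0 := by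
        by_contra h
        exact hw (by simp [kpow, kone, Ne.symm h])
      rw [this]; rfl
    | succ n ih =>
      intro w hw
      rw [kpow, kmul] at hw
      obtain ⟨v, hv⟩ := tsum_ne_zero_exists hw
      obtain ⟨hv1, hv2⟩ := mul_ne_zero_iff.1 hv
      have h1 := ih v hv1
      simp only [Ak, h1, if_true] at hv2
      have := hn _ hv2
      simp only [jump, h1] at this
      omega
  have := this n _ hk
  simp at this

lemma ex_continuous : Continuous ex := ENNReal.continuous_ofReal.comp Real.continuous_exp

lemma dotZ_continuous (j : Zd d) : Continuous fun a : Rd d => dotZ a j := by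
  unfold dotZ
  fun_prop

lemma m_ne_top (h : ∀ a, pm m a ≠ ⊤) (j : Zd d) : m j ≠ ⊤ := by
  have h1 : m j * ex (dotZ 0 j) ≤ pm m 0 := ENNReal.le_tsum (f := fun j => m j * ex (dotZ 0 j)) j
  have h2 : dotZ (0 : Rd d) j = 0 := by simp [dotZ]
  rw [h2, ex_zero, mul_one] at h1
  exact ne_top_of_le_ne_top (h 0) h1

lemma pm_limit (h : ∀ a, pm m a ≠ ⊤) {ι : Type*} {l : Filter ι} [l.NeBot] {u : ι → Rd d} {a : Rd d}
    (hu : Tendsto u l (nhds a)) {c : ι → ENNReal} {c0 : ENNReal} (hc : Tendsto c l (nhds c0))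
    (hle : ∀ i, pm m (u i) ≤ c i) : pm m a ≤ c0 := by
  rw [pm, ENNReal.tsum_eq_iSup_sum]
  refine iSup_le fun s => ?_
  have h1 : Tendsto (fun i => ∑ j ∈ s, m j * ex (dotZ (u i) j)) l (nhds (∑ j ∈ s, m j * ex (dotZ a j))) := by
    refine tendsto_finsetSum _ fun j _ => ?_
    refine ENNReal.Tendsto.const_mul ?_ (Or.inr (m_ne_top h j))
    exact ((ex_continuous.comp (dotZ_continuous j)).tendsto a).comp hu
  refine le_of_tendsto_of_tendsto' h1 hc fun i => ?_
  exact (ENNReal.sum_le_tsum s).trans (hle i)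

lemma dotZ_split (a : Rd d) (j : Zd d) : dotZ a j = dotZ (a.1, 0) j + a.2 * j.2 := by
  simp [dotZ]

lemma theta_closed (H : Chain m m0) (m' : Zd d → ENNReal) (h' : ∀ a, pm m' a ≠ ⊤) (α : Fin d → ℝ)
    (P : Set ℝ) (hP : IsClosed P)
    (h : ∀ r > 0, ∃ b ∈ P, pm m (α, b) ≤ ex r ∧ pm m' (α, b) ≤ ex r) :
    ∃ b ∈ P, pm m (α, b) ≤ 1 ∧ pm m' (α, b) ≤ 1 := by
  obtain ⟨j, hj, hj2⟩ := H.down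
  obtain ⟨k, hk, hk2⟩ := H.up
  obtain ⟨s, hs⟩ := exists_ex hj (m_ne_top H.mom j)
  obtain ⟨s', hs'⟩ := exists_ex hk (m_ne_top H.mom k)
  have hr : ∀ n : ℕ, (0 : ℝ) < 1 / ((n : ℝ) + 1) := fun n => by positivity
  choose b hbP hb1 hb2 using fun n : ℕ => h _ (hr n)
  have hle1 : ∀ n : ℕ, 1 / ((n : ℝ) + 1) ≤ 1 := fun n => by
    rw [div_le_one (by positivity)]
    have : (0 : ℝ) ≤ n := n.cast_nonneg
    linarith
  have hb1' : ∀ n i, m i * ex (dotZ (α, b n) i) ≤ ex 1 := fun n i =>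
    (ENNReal.le_tsum (f := fun i => m i * ex (dotZ (α, b n) i)) i).trans ((hb1 n).trans (ex_le (hle1 n)))
  have hbd : ∀ n, b n ∈ Set.Icc (s + dotZ (α, 0) j - 1) (|1 - s' - dotZ (α, 0) k|) := by
    intro n
    have e1 := hb1' n j
    have e2 := hb1' n k
    rw [hs, ← ex_add, ex_le_iff, dotZ_split, hj2] at e1
    rw [hs', ← ex_add, ex_le_iff, dotZ_split] at e2
    simp only at e1 e2
    push_cast at e1
    refine ⟨by linarith, ?_⟩
    have h1 : b n * k.2 ≤ |1 - s' - dotZ (α, 0) k| := by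
      refine le_trans ?_ (le_abs_self _); linarith
    by_cases h0 : b n ≤ 0
    · exact h0.trans (abs_nonneg _)
    · have : (1 : ℝ) ≤ k.2 := by exact_mod_cast hk2
      nlinarith
  obtain ⟨b0, -, f, hf, hlim⟩ := isCompact_Icc.tendsto_subseq hbd
  refine ⟨b0, hP.mem_of_tendsto hlim (Eventually.of_forall fun n => hbP _), ?_⟩
  have hc : Tendsto (fun n => ex (1 / (((f n : ℕ) : ℝ) + 1))) atTop (nhds 1) := by
    rw [← ex_zero]
    refine (ex_continuous.tendsto 0).comp ?_
    exact tendsto_one_div_add_atTop_nhds_zero_nat.comp hf.tendsto_atTop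
  have hu : Tendsto (fun n => ((α, b (f n)) : Rd d)) atTop (nhds (α, b0)) :=
    tendsto_const_nhds.prodMk_nhds hlim
  exact ⟨pm_limit H.mom hu hc fun n => hb1 _, pm_limit h' hu hc fun n => hb2 _⟩

/-- the canonical boundary point -/
def bd (x : Fin d → ℤ) : Ed d := (x, 0)

lemma bd_inj : Function.Injective (bd (d := d)) := fun x y h => congrArg Prod.fst h

lemma theta_of_bound (H : Chain m m0) (α : Fin d → ℝ)
    (hle : ∀ n x, kpow (Ak m m0) n 0 (bd x) * ex (dotE (α, 0) (bd x)) ≤ 1) (r : ℝ) (hr : 0 < r) :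
    ∃ b, pm m (α, b) ≤ ex r ∧ pm m0 (α, b) ≤ ex r := by
  set A := Ak m m0 with hA
  set B : Ed d → Ed d → ENNReal := fun z w => ex (-r) * A z w with hB
  set h : Ed d → ENNReal := fun z => ∑' x, kgreen B z (bd x) * ex (dotE (α, 0) (bd x)) with hh
  have hfin0 : h 0 ≠ ⊤ := sum_trick H.toSupp H.mom H.mom0 bd bd_inj (α, 0) hle r hr
  have hpow : ∀ k z z', kpow B k z z' * h z' ≤ h z := by
    intro k z z'
    simp only [hh]
    rw [← ENNReal.tsum_mul_left]
    refine ENNReal.tsum_le_tsum fun x => ?_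
    rw [← mul_assoc]
    exact mul_le_mul_left (kpow_mul_green_le B k z z' _) _
  have hsuper : ∀ z, kapp B h z ≤ h z := by
    intro z
    simp only [hh]
    rw [kapp_tsum]
    refine ENNReal.tsum_le_tsum fun x => ?_
    simp_rw [mul_comm _ (ex _)]
    rw [kapp_smul, green_left B z]
    exact mul_le_mul_right le_add_self _
  have hBs : ∀ u z w, B (sft u z) (sft u w) = B z w := fun u z w => by
    simp only [hB, hA, Ak_sft]
  have htr : ∀ u z, h (sft u z) = ex (dotE (α, 0) (bd u)) * h z := by
    intro u z
    simp only [hh]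
    rw [← (Equiv.addRight u).tsum_eq, ← ENNReal.tsum_mul_left]
    congr 1; funext x
    have e1 : bd ((Equiv.addRight u) x) = sft u (bd x) := by simp [bd, sft_apply]
    have e2 : dotE (α, 0) (sft u (bd x)) = dotE (α, 0) (bd u) + dotE (α, 0) (bd x) := by
      rw [← dotE_add]; congr 1; simp [bd, sft_apply, add_comm]
    rw [e1, kgreen_shift B (sft u) (hBs u), e2, ex_add]; ring
  have hscale : ∀ k z w, kpow B k z w = ex (-r) ^ k * kpow A k z w := fun k z w => kpow_scale A _ k z w
  have hfin : ∀ z, h z ≠ ⊤ := by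
    intro z
    obtain ⟨k, hk⟩ := H.irr 0 z
    intro ht
    have := hpow k 0 z
    rw [ht, hscale, ENNReal.mul_top (mul_ne_zero (pow_ne_zero _ (ex_ne_zero _)) hk), top_le_iff] at this
    exact hfin0 this
  have h00 : h 0 ≠ 0 := by
    have h1 : kgreen B 0 (bd 0) * ex (dotE (α, 0) (bd 0)) ≤ h 0 := 
      ENNReal.le_tsum (f := fun x => kgreen B 0 (bd x) * ex (dotE (α, 0) (bd x))) 0
    have h2 : (bd 0 : Ed d) = 0 := rfl
    have h3 : (1 : ENNReal) ≤ kgreen B 0 0 := by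
      refine le_trans (le_of_eq ?_) (kpow_le_green B 0 0 0)
      simp [kpow, kone]
    intro h4
    rw [h4, h2, dotE_zero, ex_zero, mul_one] at h1
    exact absurd (h3.trans h1) (by simp)
  have hne : ∀ z, h z ≠ 0 := by
    intro z hz
    obtain ⟨k, hk⟩ := H.irr z 0
    have := hpow k z 0
    rw [hz, hscale] at this
    exact mul_ne_zero (mul_ne_zero (pow_ne_zero _ (ex_ne_zero _)) hk) h00 (le_zero_iff.1 this)
  set g : ℕ → ENNReal := fun y => h (0, y) with hg
  have hsplit : ∀ w : Ed d, h w = ex (dotE (α, 0) w) * g w.2 := by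
    intro w
    have e1 : w = sft w.1 (0, w.2) := by simp [sft_apply]
    have e2 : dotE (α, 0) w = dotE (α, 0) (bd w.1) := by simp [dotE, bd]
    conv_lhs => rw [e1]
    rw [htr, e2]
  set r0 : ENNReal := ⨅ y, g (y + 1) / g y with hr0
  have hr0t : r0 ≠ ⊤ := by
    refine ne_top_of_le_ne_top ?_ (iInf_le _ 0)
    exact ENNReal.div_ne_top (hfin _) (hne _)
  have hr00 : r0 ≠ 0 := by
    obtain ⟨c, hc, N, hN⟩ := harnack H (0, -1)
    have : ex (-r) ^ N * c ≤ r0 := by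
      refine le_iInf fun y => ?_
      rw [ENNReal.le_div_iff_mul_le (Or.inl (hne _)) (Or.inl (hfin _))]
      obtain ⟨k, hk, hk2⟩ := hN (0, y + 1) (0, y) (by simp [jump])
      refine le_trans (mul_le_mul_left ?_ _) (hpow k (0, y + 1) (0, y))
      rw [hscale]
      refine mul_le_mul' ?_ hk2
      refine pow_le_pow_right_of_le_one' ?_ hk
      rw [← ex_zero]; exact ex_le (by linarith)
    intro h0
    rw [h0] at this
    exact mul_ne_zero (pow_ne_zero _ (ex_ne_zero _)) hc (le_zero_iff.1 this)
  obtain ⟨β, hβ⟩ := exists_ex hr00 hr0t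
  have hg1 : ∀ y, ex β * g y ≤ g (y + 1) := by
    intro y
    rw [← ENNReal.le_div_iff_mul_le (Or.inl (hne _)) (Or.inl (hfin _)), ← hβ]
    exact iInf_le _ y
  have hgk : ∀ k y : ℕ, ex (β * k) * g y ≤ g (y + k) := by
    intro k y
    induction k with
    | zero => simp [ex_zero]
    | succ k ih =>
      refine le_trans ?_ (hg1 (y + k))
      refine le_trans (le_of_eq ?_) (mul_le_mul_right ih _)
      rw [← mul_assoc, ← ex_add]; congr 2; push_cast; ring
  have hkey : ∀ (z : Ed d) (y : ℕ), (∀ w : Ed d, w.2 < y → A z w = 0) →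
      ex (-r) * kapp A (fun w => ex (dotE (α, β) w)) z * (ex (-(β * y)) * g y) ≤ h z := by
    intro z y hzy
    refine le_trans ?_ (hsuper z)
    simp only [kapp]
    rw [mul_assoc, ← ENNReal.tsum_mul_right, ← ENNReal.tsum_mul_left]
    refine ENNReal.tsum_le_tsum fun w => ?_
    by_cases hw : w.2 < y
    · rw [hzy w hw]; simp
    · simp only [hB]
      rw [mul_assoc, mul_assoc]
      refine mul_le_mul_right (mul_le_mul_right ?_ _) _
      rw [hsplit w]
      obtain ⟨k, hk⟩ := Nat.exists_eq_add_of_le (not_lt.1 hw)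
      rw [hk]
      refine le_trans (le_of_eq ?_) (mul_le_mul_right (hgk k y) _)
      rw [← mul_assoc, ← mul_assoc, ← ex_add, ← ex_add]
      congr 2
      simp only [dotE, hk]
      push_cast; ring
  refine ⟨β, ?_, ?_⟩
  · have h1 : ex (-r) * pm m (α, β) * ex β ≤ ex β := by
      nth_rewrite 2 [← hβ]
      refine le_iInf fun y => ?_
      rw [ENNReal.le_div_iff_mul_le (Or.inl (hne _)) (Or.inl (hfin _))]
      have := hkey (0, y + 1) y (fun w hw => by
        simp only [hA, Ak]
        rw [if_neg (by simp)]
        exact H.s1 _ (by simp only [jump]; push_cast; omega))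
      rw [kapp_ex H.toSupp, if_neg (by simp)] at this
      refine le_trans (le_of_eq ?_) this
      have e : ex β = ex (dotE (α, β) (0, y + 1)) * ex (-(β * y)) := by
        rw [← ex_add]; congr 1; simp [dotE]; ring
      rw [e]; ring
    have h2 : ex (-r) * pm m (α, β) ≤ 1 := by
      have := ex_le_mul_iff.1 h1
      rwa [ex_mul_neg] at this
    rw [mul_comm, ex_le_mul_iff, one_mul, neg_neg] at h2
    exact h2
  · have := hkey 0 0 (fun w hw => by omega)
    rw [kapp_ex H.toSupp, if_pos (show (0 : Ed d).2 = 0 from rfl), dotE_zero] at this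
    simp only [ex_zero, mul_one, Nat.cast_zero, mul_zero, neg_zero, one_mul] at this
    have h2 : ex (-r) * pm m0 (α, β) ≤ 1 := by
      have h3 : (h 0) = g 0 := rfl
      rw [h3] at this
      have := ENNReal.div_le_of_le_mul (a := ex (-r) * pm m0 (α, β) * g 0) (b := 1) (c := g 0) (by rwa [one_mul])
      rwa [ENNReal.mul_div_cancel_right (hne _) (hfin _)] at this
    rw [mul_comm, ex_le_mul_iff, one_mul, neg_neg] at h2
    exact h2

end theta

section liftb
variable {d : ℕ} {m m0 : Zd d → ENNReal}

lemma Chain.supp_pos (H : Chain m m0) : Supp m (mpos m) :=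
  ⟨H.s1, fun j hj => by simp [mpos, hj]⟩

lemma pm_mpos_le (m : Zd d → ENNReal) (a : Rd d) : pm (mpos m) a ≤ pm m a := by
  refine ENNReal.tsum_le_tsum fun j => mul_le_mul_left ?_ _
  simp only [mpos]; split_ifs <;> simp

lemma pm_split (H : Chain m m0) (α : Fin d → ℝ) (s : ℝ) :
    pm m (α, s) = pm (mpos m) (α, s) +
      ex (-s) * ∑' j, (if j.2 < 0 then m j * ex (dotZ (α, 0) j) else 0) := by
  simp only [pm]
  rw [← ENNReal.tsum_mul_left, ← ENNReal.tsum_add]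
  congr 1; funext j
  simp only [mpos]
  split_ifs with h
  · by_cases h1 : j.2 < -1
    · simp [H.s1 j h1]
    · have h2 : j.2 = -1 := by omega
      rw [dotZ_split (α, s) j, h2, ex_add]
      push_cast
      rw [mul_neg_one]; ring
  · simp

lemma lift_bound (H : Chain m m0) (α : Fin d → ℝ) (β' : ℝ)
    (hle : ∀ n w, kpow (Ak m (mpos m)) n 0 w * ex (dotE (α, β') w) ≤ 1) (r : ℝ) (hr : 0 < r)
    (b : ℝ) (hb : pm m (α, b) ≤ ex r) : ∃ s, β' ≤ s ∧ pm m (α, s) ≤ ex r := by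
  by_cases hbb : β' ≤ b
  · exact ⟨b, hbb, hb⟩
  push Not at hbb
  have HS := H.supp_pos
  set A := Ak m (mpos m) with hA
  set B : Ed d → Ed d → ENNReal := fun z w => ex (-r) * A z w with hB
  set M : ℝ → ENNReal := fun s => ∑' w, kgreen B 0 w * ex (dotE (α, s) w) with hM
  have hMfin : M β' ≠ ⊤ := sum_trick HS H.mom
    (fun a => ne_top_of_le_ne_top (H.mom a) (pm_mpos_le m a)) (fun w : Ed d => w) (fun _ _ h => h) (α, β') hle r hr
  have hMb : M b ≤ M β' := by
    refine ENNReal.tsum_le_tsum fun w => mul_le_mul_right (ex_le ?_) _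
    simp only [dotE]
    have : (0 : ℝ) ≤ w.2 := Nat.cast_nonneg _
    nlinarith
  set κ0 : ENNReal := ∑' j, (if j.2 < 0 then m j * ex (dotZ (α, 0) j) else 0) with hκ0
  have hps : ∀ s, pm m (α, s) = pm (mpos m) (α, s) + ex (-s) * κ0 := pm_split H α
  clear_value κ0
  set S0 : ENNReal := ∑' v, kgreen B 0 v * (if v.2 = 0 then ex (dotE (α, 0) v) else 0) with hS0
  have hid : ∀ s, M s + ex (-s) * (ex (-r) * κ0 * S0) = 1 + ex (-r) * pm m (α, s) * M s := by
    intro s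
    have e1 : M s = 1 + ∑' v, kgreen B 0 v * (ex (-r) * ((if v.2 = 0 then pm (mpos m) (α, s) else pm m (α, s)) * ex (dotE (α, s) v))) := by
      have e2 : ∀ w, kgreen B 0 w * ex (dotE (α, s) w) = kone 0 w * ex (dotE (α, s) w) +
          ∑' v, kgreen B 0 v * (ex (-r) * (A v w * ex (dotE (α, s) w))) := by
        intro w
        conv_lhs => rw [green_right]
        rw [add_mul, ← ENNReal.tsum_mul_right]
        congr 2; funext v
        simp only [hB]; ring
      simp only [hM]
      rw [tsum_congr e2, ENNReal.tsum_add, ENNReal.tsum_comm]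
      congr 1
      · have := congrFun (kapp_kone (S := Ed d) (fun w => ex (dotE (α, s) w))) 0
        simp only [kapp] at this
        rw [this, dotE_zero, ex_zero]
      · congr 1; funext v
        rw [ENNReal.tsum_mul_left, ENNReal.tsum_mul_left]
        have := kapp_ex HS (α, s) v
        simp only [kapp] at this
        rw [this]
    conv_lhs => rw [e1]
    rw [add_assoc]
    congr 1
    simp only [hM, hS0]
    rw [← ENNReal.tsum_mul_left, ← ENNReal.tsum_mul_left, ← ENNReal.tsum_mul_left, ← ENNReal.tsum_add]
    congr 1; funext v
    split_ifs with h
    · rw [hps s]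
      have : dotE (α, s) v = dotE (α, 0) v := by simp [dotE, h]
      rw [this]; ring
    · ring
  have hκ : ex (-b) * (ex (-r) * κ0 * S0) ≤ 1 := by
    have h1 := hid b
    have h2 : ex (-r) * pm m (α, b) ≤ 1 := by
      rw [← ex_neg_mul r]; exact mul_le_mul_right hb _
    have h3 : M b + ex (-b) * (ex (-r) * κ0 * S0) ≤ M b + 1 := by
      rw [h1, add_comm (M b) 1]
      refine add_le_add_right ?_ _
      exact (mul_le_mul_left h2 _).trans (by rw [one_mul])
    exact (ENNReal.add_le_add_iff_left (ne_top_of_le_ne_top hMfin hMb)).1 h3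
  have hκ' : ex (-β') * (ex (-r) * κ0 * S0) ≤ 1 :=
    (mul_le_mul_left (ex_le (by linarith)) _).trans hκ
  refine ⟨β', le_rfl, ?_⟩
  have h1 := hid β'
  have h2 : 1 + ex (-r) * pm m (α, β') * M β' ≤ 1 + 1 * M β' := by
    rw [← h1, add_comm, one_mul]; exact add_le_add_left hκ' _
  have h3 := (ENNReal.add_le_add_iff_left ENNReal.one_ne_top).1 h2
  have hM0 : M β' ≠ 0 := by
    intro h0
    rw [h0] at h1
    have h4 : (1 : ENNReal) ≤ kgreen B 0 0 * ex (dotE (α, β') 0) := by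
      rw [dotE_zero, ex_zero, mul_one]
      refine le_trans (le_of_eq ?_) (kpow_le_green B 0 0 0)
      simp [kpow, kone]
    have h5 : kgreen B 0 0 * ex (dotE (α, β') 0) ≤ M β' :=
      ENNReal.le_tsum (f := fun w => kgreen B 0 w * ex (dotE (α, β') w)) 0
    rw [h0] at h5
    exact absurd (h4.trans h5) (by simp)
  have h4 := (ENNReal.mul_le_mul_iff_left hM0 hMfin).1 h3
  rw [mul_comm, ex_le_mul_iff, one_mul, neg_neg] at h4
  exact h4

end liftb

section cone

/-- semigroups fill the closed convex cone they generate -/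
lemma semigroup_cone {V : Type*} [NormedAddCommGroup V] [NormedSpace ℝ V] (T : AddSubmonoid V) (q : V)
    (hq : ∀ f : V →L[ℝ] ℝ, (∀ τ ∈ T, f τ ≤ 0) → f q ≤ 0) (ε : ℝ) (hε : 0 < ε) :
    ∃ N0 : ℝ, ∀ N, N0 ≤ N → ∃ τ ∈ T, ‖τ - N • q‖ ≤ ε * N := by
  set S : Set V := {v | ∀ ε : ℝ, 0 < ε → ∃ N0 : ℝ, ∀ N, N0 ≤ N → ∃ τ ∈ T, ‖τ - N • v‖ ≤ ε * N} with hS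
  have hTS : ∀ v ∈ T, v ∈ S := by
    intro v hv ε hε
    refine ⟨max 0 (‖v‖ / ε), fun N hN => ⟨⌊N⌋₊ • v, T.nsmul_mem hv _, ?_⟩⟩
    have h0 : 0 ≤ N := (le_max_left _ _).trans hN
    have h1 : ‖v‖ / ε ≤ N := (le_max_right _ _).trans hN
    rw [div_le_iff₀ hε] at h1
    rw [← Nat.cast_smul_eq_nsmul ℝ, ← sub_smul, norm_smul]
    have h2 : ‖(⌊N⌋₊ : ℝ) - N‖ ≤ 1 := by
      rw [Real.norm_eq_abs, abs_le]
      have := Nat.floor_le h0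
      have := Nat.lt_floor_add_one N
      constructor <;> linarith
    nlinarith [norm_nonneg v]
  have hadd : ∀ v ∈ S, ∀ w ∈ S, v + w ∈ S := by
    intro v hv w hw ε hε
    obtain ⟨N1, h1⟩ := hv (ε / 2) (by positivity)
    obtain ⟨N2, h2⟩ := hw (ε / 2) (by positivity)
    refine ⟨max N1 N2, fun N hN => ?_⟩
    obtain ⟨τ, hτ, h3⟩ := h1 N ((le_max_left _ _).trans hN)
    obtain ⟨σ, hσ, h4⟩ := h2 N ((le_max_right _ _).trans hN)
    refine ⟨τ + σ, T.add_mem hτ hσ, ?_⟩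
    have e : τ + σ - N • (v + w) = (τ - N • v) + (σ - N • w) := by rw [smul_add]; abel
    rw [e]
    refine (norm_add_le _ _).trans (by linarith)
  have hsmul : ∀ c : ℝ, 0 < c → ∀ v ∈ S, c • v ∈ S := by
    intro c hc v hv ε hε
    obtain ⟨N1, h1⟩ := hv (ε / c) (by positivity)
    refine ⟨N1 / c, fun N hN => ?_⟩
    obtain ⟨τ, hτ, h3⟩ := h1 (N * c) (by rwa [div_le_iff₀ hc] at hN)
    refine ⟨τ, hτ, ?_⟩
    rw [smul_smul]
    refine h3.trans (le_of_eq ?_)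
    field_simp
  have hconv : Convex ℝ S := by
    intro v hv w hw x y hx hy hxy
    rcases hx.eq_or_lt with h | h
    · have : y = 1 := by linarith
      rw [← h, this]; simpa using hw
    rcases hy.eq_or_lt with h' | h'
    · have : x = 1 := by linarith
      rw [← h', this]; simpa using hv
    exact hadd _ (hsmul x h v hv) _ (hsmul y h' w hw)
  have hclosed : IsClosed S := by
    rw [← closure_subset_iff_isClosed]
    intro v hv ε hε
    obtain ⟨w, hw, hvw⟩ := Metric.mem_closure_iff.1 hv (ε / 2) (by positivity)
    obtain ⟨N1, h1⟩ := hw (ε / 2) (by positivity)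
    refine ⟨max 0 N1, fun N hN => ?_⟩
    have h0 : 0 ≤ N := (le_max_left _ _).trans hN
    obtain ⟨τ, hτ, h3⟩ := h1 N ((le_max_right _ _).trans hN)
    refine ⟨τ, hτ, ?_⟩
    have e : τ - N • v = (τ - N • w) - N • (v - w) := by rw [smul_sub]; abel
    rw [e]
    refine (norm_sub_le _ _).trans ?_
    rw [dist_eq_norm] at hvw
    rw [norm_smul, Real.norm_of_nonneg h0]
    nlinarith
  have h0S : (0 : V) ∈ S := hTS 0 T.zero_mem
  have : q ∈ S := by
    by_contra hqS
    obtain ⟨f, u, hf, hu⟩ := geometric_hahn_banach_closed_point hconv hclosed hqS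
    have hu0 : 0 < u := by simpa using hf 0 h0S
    have hneg : ∀ v ∈ S, f v ≤ 0 := by
      intro v hv
      by_contra h
      push Not at h
      have := hf _ (hsmul (u / f v) (by positivity) v hv)
      rw [map_smul, smul_eq_mul, div_mul_cancel₀ _ h.ne'] at this
      exact lt_irrefl _ this
    have := hq f fun τ hτ => hneg τ (hTS τ hτ)
    linarith
  exact this ε hε

lemma kpow_embed {S S' : Type*} (K : S → S → ENNReal) (L : S' → S' → ENNReal) (σ : S → S')
    (hσ : Function.Injective σ) (h : ∀ z w, K z w ≤ L (σ z) (σ w)) (n : ℕ) :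
    ∀ z w, kpow K n z w ≤ kpow L n (σ z) (σ w) := by
  induction n with
  | zero =>
    intro z w
    simp only [kpow, kone, hσ.eq_iff]
    exact le_rfl
  | succ n ih =>
    intro z w
    simp only [kpow, kmul]
    refine le_trans (ENNReal.tsum_le_tsum fun v => mul_le_mul' (ih z v) (h v w)) ?_
    exact ENNReal.tsum_comp_le_tsum_of_injective hσ fun v => kpow L n (σ z) v * L v (σ w)

variable {d : ℕ} {m m0 : Zd d → ENNReal}

lemma kpow_pos_embed (m m' : Zd d → ENNReal) (u : Ed d) (hu : u.2 = 0 → m' = mpos m) (n : ℕ) (z w : Ed d) :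
    kpow (Ak m (mpos m)) n z w ≤ kpow (Ak m m') n (z + u) (w + u) := by
  refine kpow_embed (Ak m (mpos m)) (Ak m m') (fun z => z + u) (add_left_injective u) ?_ n z w
  intro z w
  have e : jump (z + u) (w + u) = jump z w := by
    simp only [jump, Prod.fst_add, Prod.snd_add]
    push_cast
    simp
  simp only [Ak, e, Prod.snd_add]
  have hle : mpos m (jump z w) ≤ m (jump z w) := by simp only [mpos]; split_ifs <;> simp
  by_cases h1 : z.2 = 0 <;> by_cases h2 : u.2 = 0
  · simp [h1, h2, hu h2]
  · simp [h1, h2, hle]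
  · simp [h1]
  · simp [h1]

/-- the semigroup of accessible weighted displacements -/
def accT (m m0 : Zd d → ENNReal) : AddSubmonoid (Rd d × ℝ) where
  carrier := {p | ∃ X w n k, p.1 = vecE (bd X + w) ∧
    ex (-p.2) ≤ kpow (Ak m m0) n 0 (bd X) * kpow (Ak m (mpos m)) k 0 w}
  zero_mem' := ⟨0, 0, 0, 0, by simp [vecE, bd]; rfl, by
    have : (bd 0 : Ed d) = 0 := rfl
    simp [kpow, kone, this, ex_zero]⟩
  add_mem' := by
    rintro p p' ⟨X, w, n, k, h1, h2⟩ ⟨X', w', n', k', h1', h2'⟩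
    refine ⟨X' + X, w' + w, n + n', k + k', ?_, ?_⟩
    · rw [Prod.fst_add, h1, h1']
      simp only [vecE, bd, Prod.fst_add, Prod.snd_add, Prod.mk_add_mk]
      refine Prod.ext ?_ ?_
      · funext i; simp; ring
      · simp; ring
    · rw [Prod.snd_add, neg_add, ex_add]
      refine (mul_le_mul' h2 h2').trans ?_
      have e1 : kpow (Ak m m0) n 0 (bd X) * kpow (Ak m m0) n' 0 (bd X') ≤ kpow (Ak m m0) (n + n') 0 (bd (X' + X)) := by
        refine le_trans (le_of_eq ?_) (kpow_mul_le _ n n' 0 (bd X) _)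
        congr 1
        have := kpow_sft m m0 X n' 0 (bd X')
        have e3 : sft X (0 : Ed d) = bd X := by simp [sft_apply, bd]
        have e4 : sft X (bd X') = bd (X' + X) := by simp [sft_apply, bd]
        rw [e3, e4] at this
        exact this.symm
      have e2 : kpow (Ak m (mpos m)) k 0 w * kpow (Ak m (mpos m)) k' 0 w' ≤ kpow (Ak m (mpos m)) (k + k') 0 (w' + w) := by
        refine le_trans (mul_le_mul_right ?_ _) (kpow_mul_le _ k k' 0 w _)
        have := kpow_pos_embed m (mpos m) w (fun _ => rfl) k' 0 w'
        rwa [zero_add] at this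
      calc _ = (kpow (Ak m m0) n 0 (bd X) * kpow (Ak m m0) n' 0 (bd X')) *
          (kpow (Ak m (mpos m)) k 0 w * kpow (Ak m (mpos m)) k' 0 w') := by ring
        _ ≤ _ := mul_le_mul' e1 e2

lemma dotR_vecE (a : Rd d) (z : Ed d) : dotR a (vecE z) = dotE a z := rfl

lemma lin_form (f : Rd d × ℝ →L[ℝ] ℝ) : ∃ (a : Rd d) (s : ℝ), ∀ v r, f (v, r) = dotR a v - s * r := by
  refine ⟨(fun i => f ((Pi.single i 1, 0), 0), f ((0, 1), 0)), - f (0, 1), fun v r => ?_⟩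
  have e : ((v, r) : Rd d × ℝ) = (∑ i, v.1 i • (((Pi.single i 1, 0), 0) : Rd d × ℝ)) +
      v.2 • (((0, 1), 0) : Rd d × ℝ) + r • ((0, 1) : Rd d × ℝ) := by
    refine Prod.ext (Prod.ext ?_ ?_) ?_
    · funext j
      simp [Prod.fst_sum, Finset.sum_apply, Pi.single_apply]
    · simp [Prod.fst_sum, Prod.snd_sum]
    · simp [Prod.snd_sum]
  rw [e, map_add, map_add, map_sum]
  simp only [map_smul, smul_eq_mul, dotR]
  simp only [mul_comm]; ring

lemma accT_bd (H : Chain m m0) (n : ℕ) (X : Fin d → ℤ) (h : kpow (Ak m m0) n 0 (bd X) ≠ 0) :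
    ∃ r, kpow (Ak m m0) n 0 (bd X) = ex (-r) ∧ (vecE (bd X), r) ∈ accT m m0 := by
  obtain ⟨r, hr⟩ := exists_ex h (ne_top_of_le_ne_top (H.fin _ _) (kpow_le_green _ n 0 (bd X)))
  refine ⟨-r, by rw [neg_neg, hr], X, 0, n, 0, by simp, ?_⟩
  simp only [neg_neg, hr]
  simp [kpow, kone]

lemma kpow_pos_le (m m0 : Zd d → ENNReal) (H : Chain m m0) (n : ℕ) (w : Ed d) : kpow (Ak m (mpos m)) n 0 w ≠ ⊤ := by
  have := kpow_pos_embed m m0 (0, 1) (by simp) n 0 w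
  exact ne_top_of_le_ne_top (H.fin _ _) (this.trans (kpow_le_green _ n _ _))

lemma accT_w (H : Chain m m0) (n : ℕ) (w : Ed d) (h : kpow (Ak m (mpos m)) n 0 w ≠ 0) :
    ∃ r, kpow (Ak m (mpos m)) n 0 w = ex (-r) ∧ (vecE w, r) ∈ accT m m0 := by
  obtain ⟨r, hr⟩ := exists_ex h (kpow_pos_le m m0 H n w)
  have hb : (bd 0 : Ed d) = 0 := rfl
  refine ⟨-r, by rw [neg_neg, hr], 0, w, 0, n, by simp [hb], ?_⟩
  simp only [neg_neg, hr]
  simp [kpow, kone, hb]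

lemma accT_key (H : Chain m m0) (a q : Rd d) (hq2 : 0 ≤ q.2)
    (hq : ∀ a' : Rd d, (∃ b, pm m (a'.1, b) ≤ 1 ∧ pm m0 (a'.1, b) ≤ 1) → pm m a' ≤ 1 → dotR a' q ≤ dotR a q)
    (f : Rd d × ℝ →L[ℝ] ℝ) (hf : ∀ τ ∈ accT m m0, f τ ≤ 0) : f (q, dotR a q) ≤ 0 := by
  obtain ⟨a', s, hfs⟩ := lin_form f
  have hb : (bd 0 : Ed d) = 0 := rfl
  have hs : 0 ≤ s := by
    have h1 : ((0, 1) : Rd d × ℝ) ∈ accT m m0 := ⟨0, 0, 0, 0, by simp [vecE, hb]; rfl, by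
      simp only [kpow, kone, hb, if_true, mul_one]; rw [← ex_zero]; exact ex_le (by norm_num)⟩
    have := hf _ h1
    rw [hfs] at this
    simp [dotR] at this
    exact this
  rw [hfs]
  have hbd : ∀ n X, kpow (Ak m m0) n 0 (bd X) ≠ 0 → ∃ r, kpow (Ak m m0) n 0 (bd X) = ex (-r) ∧
      dotE a' (bd X) ≤ s * r := by
    intro n X h
    obtain ⟨r, h1, h2⟩ := accT_bd H n X h
    have := hf _ h2
    rw [hfs, dotR_vecE] at this
    exact ⟨r, h1, by linarith⟩
  have hw : ∀ n w, kpow (Ak m (mpos m)) n 0 w ≠ 0 → ∃ r, kpow (Ak m (mpos m)) n 0 w = ex (-r) ∧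
      dotE a' w ≤ s * r := by
    intro n X h
    obtain ⟨r, h1, h2⟩ := accT_w H n X h
    have := hf _ h2
    rw [hfs, dotR_vecE] at this
    exact ⟨r, h1, by linarith⟩
  rcases hs.eq_or_lt with h | h
  · have hX : ∀ X, dotE a' (bd X) ≤ 0 := by
      intro X
      obtain ⟨n, hn⟩ := H.irr 0 (bd X)
      obtain ⟨r, -, h1⟩ := hbd n X hn
      rwa [← h, zero_mul] at h1
    have h1 : ∀ i, a'.1 i = 0 := by
      intro i
      have e1 := hX (Pi.single i 1)
      have e2 := hX (Pi.single i (-1))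
      simp [dotE, bd, Pi.single_apply] at e1 e2
      linarith
    have h2 : a'.2 ≤ 0 := by
      obtain ⟨j, hj, hj2⟩ := H.up
      obtain ⟨w, hw1, hw2⟩ := exists_jump (0 : Ed d) j (by simp; omega)
      obtain ⟨r, -, h3⟩ := hw 1 w (by
        rw [kpow_one]
        simp only [Ak, hw1]
        rw [if_pos (show (0 : Ed d).2 = 0 from rfl)]
        simp [mpos, not_lt.2 hj2.le, hj])
      rw [← h, zero_mul] at h3
      simp only [dotE, h1, zero_mul, Finset.sum_const_zero, zero_add] at h3
      have h4 : (0 : ℝ) < w.2 := by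
        have : (0 : ℤ) < w.2 := by rw [hw2]; simp; omega
        exact_mod_cast this
      by_contra h5
      push Not at h5
      nlinarith
    rw [← h]
    simp only [dotR, h1, zero_mul, Finset.sum_const_zero, zero_add]
    nlinarith
  · set α : Fin d → ℝ := fun i => s⁻¹ * a'.1 i with hα
    have hdot : ∀ v : Rd d, dotR (α, s⁻¹ * a'.2) v = s⁻¹ * dotR a' v := by
      intro v
      simp only [dotR, hα, mul_add, Finset.mul_sum]
      congr 1
      · exact Finset.sum_congr rfl fun i _ => by ring
      · ring
    have e1 : ∀ n x, kpow (Ak m m0) n 0 (bd x) * ex (dotE (α, 0) (bd x)) ≤ 1 := by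
      intro n x
      by_cases h0 : kpow (Ak m m0) n 0 (bd x) = 0
      · simp [h0]
      obtain ⟨r, h1, h2⟩ := hbd n x h0
      rw [h1, ← ex_add, ← ex_zero]
      refine ex_le ?_
      have h3 : dotE (α, 0) (bd x) = s⁻¹ * dotE a' (bd x) := by
        rw [← dotR_vecE, ← dotR_vecE, ← hdot]; simp [dotR, vecE, bd]
      rw [h3]
      have : s⁻¹ * dotE a' (bd x) ≤ r := by rw [inv_mul_le_iff₀ h]; exact h2
      linarith
    have e2 : ∀ n w, kpow (Ak m (mpos m)) n 0 w * ex (dotE (α, s⁻¹ * a'.2) w) ≤ 1 := by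
      intro n w
      by_cases h0 : kpow (Ak m (mpos m)) n 0 w = 0
      · simp [h0]
      obtain ⟨r, h1, h2⟩ := hw n w h0
      rw [h1, ← ex_add, ← ex_zero]
      refine ex_le ?_
      rw [← dotR_vecE, hdot, dotR_vecE]
      have : s⁻¹ * dotE a' w ≤ r := by rw [inv_mul_le_iff₀ h]; exact h2
      linarith
    obtain ⟨b, -, hb1, hb2⟩ := theta_closed H m0 H.mom0 α Set.univ isClosed_univ (fun r hr => by
      obtain ⟨b, hb⟩ := theta_of_bound H α e1 r hr
      exact ⟨b, trivial, hb⟩)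
    obtain ⟨b', hb', hb3, -⟩ := theta_closed H (fun _ => 0) (fun a => by simp [pm]) α (Set.Ici (s⁻¹ * a'.2)) isClosed_Ici (fun r hr => by
      have h1 : (1 : ENNReal) ≤ ex r := by rw [← ex_zero]; exact ex_le hr.le
      obtain ⟨c, hc, hc2⟩ := lift_bound H α _ e2 r hr b (hb1.trans h1)
      exact ⟨c, hc, hc2, by simp [pm]⟩)
    have h3 := hq (α, b') ⟨b, hb1, hb2⟩ hb3
    have h4 : dotR (α, s⁻¹ * a'.2) q ≤ dotR (α, b') q := by
      simp only [dotR]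
      have := mul_le_mul_of_nonneg_right (Set.mem_Ici.1 hb') hq2
      linarith
    rw [hdot] at h4
    have h5 : s⁻¹ * dotR a' q ≤ dotR a q := h4.trans h3
    rw [inv_mul_le_iff₀ h] at h5
    linarith

lemma n1_le_norm (z w : Ed d) (N : ℝ) (h : ‖vecE w - vecE z‖ ≤ N) : (n1 (jump z w) : ℝ) ≤ (d + 1) * N := by
  have hN := h
  rw [Prod.norm_def, max_le_iff] at h
  have hN0 : 0 ≤ N := (norm_nonneg _).trans hN
  rw [pi_norm_le_iff_of_nonneg hN0] at h
  simp only [n1, jump]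
  push_cast
  rw [add_mul, one_mul]
  refine add_le_add ?_ ?_
  · refine (Finset.sum_le_card_nsmul _ _ N fun i _ => ?_).trans (by simp)
    have := h.1 i
    rw [Nat.cast_natAbs]
    simpa [vecE, Real.norm_eq_abs] using this
  · have := h.2
    rw [Nat.cast_natAbs]
    simpa [vecE, Real.norm_eq_abs] using this

/-- the lower bound for the Green function -/
lemma green_lower (H : Chain m m0) (a q : Rd d) (hq2 : 0 ≤ q.2)
    (hq : ∀ a' : Rd d, (∃ b, pm m (a'.1, b) ≤ 1 ∧ pm m0 (a'.1, b) ≤ 1) → pm m a' ≤ 1 → dotR a' q ≤ dotR a q)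
    (δ : ℝ) (hδ : 0 < δ) (z : Ed d) :
    ∃ η > 0, ∃ N0 : ℝ, ∀ N, N0 ≤ N → ∀ z', ‖vecE z' - N • q‖ ≤ η * N →
      ex (-(N * dotR a q) - δ * N) ≤ kgreen (Ak m m0) z z' := by
  obtain ⟨κ, hκ0, hκ⟩ := harnack_n1 H
  obtain ⟨i0, hi0⟩ := hκ z 0
  obtain ⟨i1, hi1⟩ := hκ 0 ((0, 1) : Ed d)
  set c0 : ℝ := κ * n1 (jump z 0) with hc0
  set c1 : ℝ := κ * n1 (jump 0 ((0, 1) : Ed d)) with hc1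
  set κ' : ℝ := κ * (d + 1) with hκ'
  have hκ'0 : 0 ≤ κ' := by positivity
  set ε : ℝ := δ / (2 * (1 + 2 * κ')) with hε
  have hε0 : 0 < ε := by positivity
  have hεδ : ε * (1 + 2 * κ') = δ / 2 := by rw [hε]; field_simp
  obtain ⟨N1, hN1⟩ := semigroup_cone (accT m m0) (q, dotR a q) (fun f hf => accT_key H a q hq2 hq f hf) ε hε0
  refine ⟨ε, hε0, max N1 (2 * (c0 + c1 + κ') / δ), fun N hN z' hz' => ?_⟩
  have hNδ : c0 + c1 + κ' ≤ δ / 2 * N := by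
    have := (le_max_right _ _).trans hN
    rw [div_le_iff₀ hδ] at this
    linarith
  obtain ⟨⟨v, r⟩, ⟨X, w, n, k, hv, hr⟩, hτ⟩ := hN1 N ((le_max_left _ _).trans hN)
  simp only at hv hr
  rw [Prod.norm_def, max_le_iff] at hτ
  obtain ⟨hτ1, hτ2⟩ := hτ
  simp only [Prod.fst_sub, Prod.snd_sub, Prod.smul_fst, Prod.smul_snd, smul_eq_mul] at hτ1 hτ2
  rw [Real.norm_eq_abs, abs_le] at hτ2
  set p1 : Ed d := bd X + (0, 1) with hp1
  set p2 : Ed d := w + p1 with hp2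
  obtain ⟨i2, hi2⟩ := hκ p2 z'
  have hn : (n1 (jump p2 z') : ℝ) ≤ (d + 1) * (ε * N + ε * N + 1) := by
    refine n1_le_norm _ _ _ ?_
    have e : vecE z' - vecE p2 = (vecE z' - N • q) - (v - N • q) - ((0, 1) : Rd d) := by
      rw [hv]
      refine Prod.ext ?_ ?_
      · funext i; simp [vecE, hp2, hp1, bd]; ring
      · simp [vecE, hp2, hp1, bd]; ring
    rw [e]
    refine (norm_sub_le _ _).trans (add_le_add ((norm_sub_le _ _).trans (add_le_add hz' hτ1)) ?_)
    simp [Prod.norm_def]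
  have s1 : ex (-c1) ≤ kpow (Ak m m0) i1 (bd X) p1 := by
    refine hi1.trans (le_of_eq ?_)
    have := kpow_sft m m0 X i1 0 ((0, 1) : Ed d)
    rw [← this]
    congr 1
    · simp [sft_apply, bd]
    · simp [sft_apply, hp1, bd]
  have s2 : kpow (Ak m (mpos m)) k 0 w ≤ kpow (Ak m m0) k p1 p2 := by
    have := kpow_pos_embed m m0 p1 (by simp [hp1, bd]) k 0 w
    rwa [zero_add] at this
  have hpath : kpow (Ak m m0) i0 z 0 * (kpow (Ak m m0) n 0 (bd X) * (kpow (Ak m m0) i1 (bd X) p1 *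
      (kpow (Ak m m0) k p1 p2 * kpow (Ak m m0) i2 p2 z'))) ≤ kgreen (Ak m m0) z z' := by
    refine le_trans ?_ (kpow_le_green _ (i0 + (n + (i1 + (k + i2)))) _ _)
    refine le_trans (mul_le_mul_right ?_ _) (kpow_mul_le _ _ _ _ _ _)
    refine le_trans (mul_le_mul_right ?_ _) (kpow_mul_le _ _ _ _ _ _)
    refine le_trans (mul_le_mul_right ?_ _) (kpow_mul_le _ _ _ _ _ _)
    exact kpow_mul_le _ _ _ _ _ _
  refine le_trans ?_ hpath
  calc ex (-(N * dotR a q) - δ * N) ≤ ex (-c0 + (-r + (-c1 + -(κ * n1 (jump p2 z'))))) := by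
        refine ex_le ?_
        have h1 : κ * n1 (jump p2 z') ≤ κ' * (ε * N + ε * N + 1) := by
          rw [hκ', mul_assoc]; exact mul_le_mul_of_nonneg_left hn hκ0
        have h2 : δ / 2 * N = ε * (1 + 2 * κ') * N := by rw [hεδ]
        nlinarith
    _ = ex (-c0) * (ex (-r) * (ex (-c1) * ex (-(κ * n1 (jump p2 z'))))) := by simp only [ex_add]
    _ ≤ ex (-c0) * ((kpow (Ak m m0) n 0 (bd X) * kpow (Ak m (mpos m)) k 0 w) * (ex (-c1) * ex (-(κ * n1 (jump p2 z'))))) := by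
        gcongr
    _ = ex (-c0) * (kpow (Ak m m0) n 0 (bd X) * (ex (-c1) * (kpow (Ak m (mpos m)) k 0 w * ex (-(κ * n1 (jump p2 z')))))) := by ring
    _ ≤ _ := by gcongr

end cone

section ratiolim
variable {d : ℕ} {m m0 : Zd d → ENNReal}

lemma dotZ_add_smul (a v : Rd d) (δ : ℝ) (j : Zd d) : dotZ (a + δ • v) j = dotZ a j + δ * dotZ v j := by
  simp only [dotZ, Prod.fst_add, Prod.snd_add, Prod.smul_fst, Prod.smul_snd, Pi.add_apply, Pi.smul_apply,
    smul_eq_mul, add_mul, Finset.sum_add_distrib, mul_add, Finset.mul_sum]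
  have : ∀ i, δ * v.1 i * (j.1 i : ℝ) = δ * (v.1 i * j.1 i) := fun i => by ring
  simp only [this]; ring

lemma dotE_add_smul (a v : Rd d) (δ : ℝ) (z : Ed d) : dotE (a + δ • v) z = dotE a z + δ * dotE v z := by
  simp only [dotE_toZ, dotZ_add_smul]

lemma dotR_add_smul (a v : Rd d) (δ : ℝ) (q : Rd d) : dotR (a + δ • v) q = dotR a q + δ * dotR v q := by
  simp only [dotR, Prod.fst_add, Prod.snd_add, Prod.smul_fst, Prod.smul_snd, Pi.add_apply, Pi.smul_apply,
    smul_eq_mul, add_mul, Finset.sum_add_distrib, mul_add, Finset.mul_sum]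
  have : ∀ i, δ * v.1 i * (q.1 i : ℝ) = δ * (v.1 i * q.1 i) := fun i => by ring
  simp only [this]; ring

lemma pm_perturb (h : ∀ a, pm m a ≠ ⊤) (a v : Rd d) (ha : pm m a ≤ 1) (x : ℝ) (hx : 1 < x) :
    ∃ δ0 : ℝ, 0 < δ0 ∧ ∀ δ : ℝ, 0 < δ → δ ≤ δ0 → pm m (a + δ • v) ≤ ENNReal.ofReal x := by
  set K : ℝ := (pm m (a + v)).toReal with hK
  have hK0 : 0 ≤ K := ENNReal.toReal_nonneg
  refine ⟨min 1 ((x - 1) / (K + 1)), lt_min one_pos (by apply div_pos <;> linarith), fun δ hδ hδ0 => ?_⟩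
  have h1 : δ ≤ 1 := hδ0.trans (min_le_left _ _)
  have h2 : δ ≤ (x - 1) / (K + 1) := hδ0.trans (min_le_right _ _)
  rw [le_div_iff₀ (by linarith)] at h2
  have h3 : pm m (a + δ • v) ≤ pm m a + ENNReal.ofReal δ * pm m (a + v) := by
    simp only [pm]
    rw [← ENNReal.tsum_mul_left, ← ENNReal.tsum_add]
    refine ENNReal.tsum_le_tsum fun j => ?_
    have e : ex (dotZ (a + δ • v) j) ≤ ex (dotZ a j) + ENNReal.ofReal δ * ex (dotZ (a + v) j) := by
      simp only [ex]
      rw [← ENNReal.ofReal_mul hδ.le, ← ENNReal.ofReal_add (by positivity) (by positivity)]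
      refine ENNReal.ofReal_le_ofReal ?_
      have := convexOn_exp.2 (Set.mem_univ (dotZ a j)) (Set.mem_univ (dotZ (a + v) j))
        (show (0 : ℝ) ≤ 1 - δ by linarith) hδ.le (by ring)
      have e2 : dotZ (a + v) j = dotZ a j + dotZ v j := by
        have := dotZ_add_smul a v 1 j
        rwa [one_smul, one_mul] at this
      simp only [smul_eq_mul] at this
      have e3 : (1 - δ) * dotZ a j + δ * dotZ (a + v) j = dotZ (a + δ • v) j := by
        rw [e2, dotZ_add_smul]; ring
      rw [e3] at this
      nlinarith [Real.exp_pos (dotZ a j)]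
    calc _ ≤ m j * (ex (dotZ a j) + ENNReal.ofReal δ * ex (dotZ (a + v) j)) := mul_le_mul_right e _
      _ = _ := by ring
  refine h3.trans ?_
  rw [← ENNReal.ofReal_toReal (h (a + v)), ← hK, ← ENNReal.ofReal_mul hδ.le]
  refine (add_le_add_left ha _).trans ?_
  rw [← ENNReal.ofReal_one, ← ENNReal.ofReal_add zero_le_one (by positivity)]
  exact ENNReal.ofReal_le_ofReal (by nlinarith)

/-- choice of the tilting parameters -/
lemma choose_l (p γ : ℝ) (hp : 0 < p) (hγ : p < γ) : ∃ l x : ℝ, 0 < l ∧ 1 < x ∧ x < 2 ∧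
    Real.exp (-(l * γ)) * (1 / (2 - x) + p * (Real.exp l - 1) * x) < 1 := by
  have h1 : HasDerivAt Real.exp 1 0 := by simpa using Real.hasDerivAt_exp 0
  have h2 := h1.tendsto_slope_zero_right
  have h3 : ∀ᶠ l in nhdsWithin (0 : ℝ) (Set.Ioi 0), l⁻¹ * (Real.exp l - 1) < γ / p := by
    have : (1 : ℝ) < γ / p := by rwa [one_lt_div hp]
    have := (h2.eventually (gt_mem_nhds this))
    simpa using this
  obtain ⟨l, hl, hl0⟩ := (h3.and self_mem_nhdsWithin).exists
  have hl0 : 0 < l := hl0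
  rw [inv_mul_lt_iff₀ hl0] at hl
  have h4 : p * (Real.exp l - 1) < l * γ := by
    have : p * (Real.exp l - 1) < p * (l * (γ / p)) := mul_lt_mul_of_pos_left hl hp
    rwa [show p * (l * (γ / p)) = l * γ by field_simp] at this
  have h5 : Real.exp (-(l * γ)) * (1 + p * (Real.exp l - 1)) < 1 := by
    have h6 : 1 + p * (Real.exp l - 1) ≤ Real.exp (p * (Real.exp l - 1)) := by
      have := Real.add_one_le_exp (p * (Real.exp l - 1)); linarith
    calc _ ≤ Real.exp (-(l * γ)) * Real.exp (p * (Real.exp l - 1)) := by gcongr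
      _ = Real.exp (p * (Real.exp l - 1) - l * γ) := by rw [← Real.exp_add]; congr 1; ring
      _ < 1 := by rw [Real.exp_lt_one_iff]; linarith
  have h7 : ContinuousAt (fun x : ℝ => Real.exp (-(l * γ)) * (1 / (2 - x) + p * (Real.exp l - 1) * x)) 1 := by
    refine ContinuousAt.mul continuousAt_const (ContinuousAt.add (ContinuousAt.div ?_ ?_ ?_) ?_)
    · fun_prop
    · fun_prop
    · norm_num
    · fun_prop
  have h8 : ∀ᶠ x in nhds (1 : ℝ), Real.exp (-(l * γ)) * (1 / (2 - x) + p * (Real.exp l - 1) * x) < 1 := by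
    refine h7.eventually (gt_mem_nhds ?_)
    norm_num
    simpa using h5
  have h9 : ∀ᶠ x in nhds (1 : ℝ), x < 2 := gt_mem_nhds (by norm_num)
  obtain ⟨x, ⟨hx1, hx2⟩, hx3⟩ := (((h8.and h9).filter_mono nhdsWithin_le_nhds).and
    (self_mem_nhdsWithin (a := (1 : ℝ)) (s := Set.Ioi 1))).exists
  exact ⟨l, x, hl0, hx3, hx2, hx1⟩

/-- data of a direction in the normal cone together with a sequence going to infinity along it -/
structure DirH {ι : Type*} (m m0 : Zd d → ENNReal) (a q : Rd d) (U : Filter ι) (zs : ι → Ed d)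
    (N : ι → ℝ) : Prop where
  q2 : 0 ≤ q.2
  qq : 0 < dotR q q
  cone : ∀ a' : Rd d, (∃ b, pm m (a'.1, b) ≤ 1 ∧ pm m0 (a'.1, b) ≤ 1) → pm m a' ≤ 1 → dotR a' q ≤ dotR a q
  inf : Tendsto N U atTop
  lim : Tendsto (fun n => (N n)⁻¹ • vecE (zs n)) U (nhds q)

lemma DirH.lower {ι : Type*} {a q : Rd d} {U : Filter ι} {zs : ι → Ed d} {N : ι → ℝ} (H : Chain m m0)
    (D : DirH m m0 a q U zs N) (δ : ℝ) (hδ : 0 < δ) (z : Ed d) :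
    ∀ᶠ n in U, ex (-(N n * dotR a q) - δ * N n) ≤ kgreen (Ak m m0) z (zs n) := by
  obtain ⟨η, hη, N0, h⟩ := green_lower H a q D.q2 D.cone δ hδ z
  filter_upwards [D.inf.eventually_ge_atTop N0, D.inf.eventually_gt_atTop 0,
    D.lim.eventually (Metric.ball_mem_nhds q hη)] with n h1 h2 h3
  refine h _ h1 _ ?_
  have e : vecE (zs n) - N n • q = N n • ((N n)⁻¹ • vecE (zs n) - q) := by
    rw [smul_sub, smul_smul, mul_inv_cancel₀ h2.ne', one_smul]
  rw [dist_eq_norm] at h3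
  rw [e, norm_smul, Real.norm_of_nonneg h2.le, mul_comm]
  gcongr

lemma dotR_continuous (a : Rd d) : Continuous fun q : Rd d => dotR a q := by
  unfold dotR; fun_prop

lemma DirH.upper {ι : Type*} {a q : Rd d} {U : Filter ι} {zs : ι → Ed d} {N : ι → ℝ}
    (D : DirH m m0 a q U zs N) (b : Rd d) (δ : ℝ) (hδ : 0 < δ) :
    ∀ᶠ n in U, N n * (dotR b q - δ) ≤ dotE b (zs n) := by
  have h1 : Tendsto (fun n => dotR b ((N n)⁻¹ • vecE (zs n))) U (nhds (dotR b q)) :=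
    ((dotR_continuous b).tendsto q).comp D.lim
  filter_upwards [D.inf.eventually_gt_atTop 0, h1.eventually (lt_mem_nhds (show dotR b q - δ < dotR b q by linarith))] with n h2 h3
  have e : dotR b ((N n)⁻¹ • vecE (zs n)) = (N n)⁻¹ * dotE b (zs n) := by
    simp only [dotR, dotE, vecE, Prod.smul_fst, Prod.smul_snd, Pi.smul_apply, smul_eq_mul, mul_add, Finset.mul_sum]
    congr 1
    · exact Finset.sum_congr rfl fun i _ => by ring
    · ring
  rw [e, lt_inv_mul_iff₀ h2] at h3
  exact h3.le

lemma ratio_upper {ι : Type*} {a q : Rd d} {U : Filter ι} {zs : ι → Ed d} {N : ι → ℝ} (H : Chain m m0)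
    (D : DirH m m0 a q U zs N) (ha : pm m a ≤ 1) (b : ℝ) (hb : pm m (a.1, b) ≤ 1) (hb0 : pm m0 (a.1, b) ≤ 1)
    (u : Fin d → ℤ) (z : Ed d) (ε : ℝ) (hε : 0 < ε) :
    ∀ᶠ n in U, kgreen (Ak m m0) (sft u z) (zs n) ≤
      ENNReal.ofReal (Real.exp (dotE a (bd u)) + ε) * kgreen (Ak m m0) z (zs n) := by
  obtain ⟨c, hc, hcQ⟩ := harnack_kQ H u
  set τ0 : ℝ := Real.exp (dotE a (bd u)) with hτ0
  have hτ0p : 0 < τ0 := Real.exp_pos _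
  set γ : ℝ := c * τ0 + c * ε / 2 with hγ
  obtain ⟨l, x, hl, hx1, hx2, hlx⟩ := choose_l (c * τ0) γ (by positivity) (by rw [hγ]; linarith [show 0 < c * ε / 2 by positivity])
  set q0 : Rd d := (q.1, 0) with hq0
  obtain ⟨δ1, hδ1, P1⟩ := pm_perturb H.mom a q ha x hx1
  obtain ⟨δ2, hδ2, P2⟩ := pm_perturb H.mom (a.1, b) q0 hb x hx1
  obtain ⟨δ3, hδ3, P3⟩ := pm_perturb H.mom0 (a.1, b) q0 hb0 ((1 + x) / 2) (by linarith)
  obtain ⟨δ4, hδ4, P4⟩ : ∃ δ4 : ℝ, 0 < δ4 ∧ ∀ δ : ℝ, 0 < δ → δ ≤ δ4 → Real.exp (δ * dotE q (bd u)) ≤ x := by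
    refine ⟨Real.log x / (|dotE q (bd u)| + 1), div_pos (Real.log_pos hx1) (by positivity), fun δ hδ h => ?_⟩
    rw [le_div_iff₀ (by positivity)] at h
    rw [← Real.le_log_iff_exp_le (by linarith)]
    nlinarith [le_abs_self (dotE q (bd u))]
  set δ : ℝ := min (min δ1 δ2) (min δ3 δ4) with hδ
  have hδ0 : 0 < δ := by positivity
  have hA1 := P1 δ hδ0 ((min_le_left _ _).trans (min_le_left _ _))
  have hA2 := P2 δ hδ0 ((min_le_left _ _).trans (min_le_right _ _))
  have hA3 := P3 δ hδ0 ((min_le_right _ _).trans (min_le_left _ _))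
  have hA4 := P4 δ hδ0 ((min_le_right _ _).trans (min_le_right _ _))
  clear_value δ
  set as : Rd d := a + δ • q with has
  set bs : Rd d := (a.1, b) + δ • q0 with hbs
  have hy0 : 0 < (x - 1) / 2 := by linarith
  set C : ENNReal := pm m0 as / ENNReal.ofReal ((x - 1) / 2) with hC
  have hCt : C ≠ ⊤ := ENNReal.div_ne_top (H.mom0 _) (by simpa using hy0)
  have hCx : C * ENNReal.ofReal ((x - 1) / 2) = pm m0 as :=
    ENNReal.div_mul_cancel (by simpa using hy0) ENNReal.ofReal_ne_top
  set f : Ed d → ENNReal := fun z => ex (dotE as z) + C * ex (dotE bs z) with hf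
  have hbdeq : ∀ z : Ed d, z.2 = 0 → dotE bs z = dotE as z := by
    intro z hz
    simp [dotE, hbs, has, hq0, hz]
  have hAf : ∀ z, kapp (Ak m m0) f z ≤ ENNReal.ofReal x * f z := by
    intro z
    simp only [hf]
    rw [kapp_add, kapp_smul, kapp_ex H.toSupp, kapp_ex H.toSupp]
    by_cases hz : z.2 = 0
    · simp only [hz, if_true]
      rw [hbdeq z hz, ← mul_assoc, ← add_mul, ← one_add_mul C, ← mul_assoc]
      refine mul_le_mul_left ?_ _
      calc pm m0 as + C * pm m0 bs ≤ C * ENNReal.ofReal ((x - 1) / 2) + C * ENNReal.ofReal ((1 + x) / 2) := by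
            rw [hCx]; gcongr
        _ = ENNReal.ofReal x * C := by
            rw [← mul_add, ← ENNReal.ofReal_add hy0.le (by linarith), mul_comm]; congr 2; ring
        _ ≤ _ := by rw [mul_add, mul_one]; exact le_add_self
    · simp only [hz, if_false]
      rw [mul_add]
      refine add_le_add (mul_le_mul_left hA1 _) ?_
      calc _ ≤ C * (ENNReal.ofReal x * ex (dotE bs z)) := by gcongr
        _ = _ := by ring
  have hsft : ∀ z, f (sft u z) = ENNReal.ofReal (Real.exp (dotE a (bd u)) * Real.exp (δ * dotE q (bd u))) * f z := by
    intro z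
    have e0 : sft u z = bd u + z := by simp [sft_apply, bd, Prod.ext_iff, add_comm]
    have e1 : dotE bs (bd u) = dotE as (bd u) := hbdeq _ rfl
    have e2 : ENNReal.ofReal (Real.exp (dotE a (bd u)) * Real.exp (δ * dotE q (bd u))) = ex (dotE as (bd u)) := by
      rw [← Real.exp_add, has, dotE_add_smul]; rfl
    simp only [hf]
    rw [e0, dotE_add, dotE_add, e1, e2, ex_add, ex_add]; ring
  have hτ : ∀ z, f (sft u z) ≤ ENNReal.ofReal (τ0 * x) * f z := by
    intro z
    rw [hsft]
    refine mul_le_mul_left (ENNReal.ofReal_le_ofReal ?_) _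
    gcongr
  set qq : ENNReal := 2⁻¹ * (1 - 2⁻¹ * ENNReal.ofReal x)⁻¹ with hqq
  have hqv : qq = ENNReal.ofReal (1 / (2 - x)) := by
    have e1 : (2⁻¹ : ENNReal) = ENNReal.ofReal 2⁻¹ := by
      rw [ENNReal.ofReal_inv_of_pos (by norm_num)]; simp
    rw [hqq, e1, ← ENNReal.ofReal_mul (by norm_num), ← ENNReal.ofReal_one, ← ENNReal.ofReal_sub _ (by linarith),
      ← ENNReal.ofReal_inv_of_pos (by linarith), ← ENNReal.ofReal_mul (by norm_num)]
    congr 1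
    have : 2 - x ≠ 0 := by linarith
    have h2 : 1 - 2⁻¹ * x ≠ 0 := by intro h; apply this; linarith
    field_simp
  have hel : 0 < Real.exp l - 1 := by have := Real.add_one_lt_exp hl.ne'; linarith
  set θr : ℝ := Real.exp (-(l * γ)) * (1 / (2 - x) + c * τ0 * (Real.exp l - 1) * x) with hθr
  have hθ : ENNReal.ofReal (Real.exp (-(l * γ))) * (qq + ENNReal.ofReal c * ENNReal.ofReal (Real.exp l - 1) * ENNReal.ofReal (τ0 * x))
      ≤ ENNReal.ofReal θr := by
    rw [hqv, ← ENNReal.ofReal_mul hc.le, ← ENNReal.ofReal_mul (by positivity),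
      ← ENNReal.ofReal_add (by apply div_nonneg <;> linarith) (by positivity), ← ENNReal.ofReal_mul (by positivity)]
    refine ENNReal.ofReal_le_ofReal (le_of_eq ?_)
    rw [hθr]; ring
  have hf0 : ∀ w, f w ≠ 0 := fun w => by simp [hf, ex_ne_zero]
  have hft : ∀ w, f w ≠ ⊤ := fun w => by
    simp only [hf]
    exact ENNReal.add_ne_top.2 ⟨ex_ne_top _, ENNReal.mul_ne_top hCt (ex_ne_top _)⟩
  have main := fun w => ratio_lemma (Ak m m0) H.fin (sft u) (Ak_sft m m0 u) (ENNReal.ofReal c) hcQ ENNReal.ofReal_ne_top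
    f qq (ENNReal.ofReal (τ0 * x)) (ENNReal.ofReal θr) (kQ_super _ f _ hAf) hτ l γ hl (by positivity) hθ z w (hf0 w) (hft w)
  set K : ENNReal := ENNReal.ofReal l⁻¹ * (1 - ENNReal.ofReal θr)⁻¹ * f z with hK
  have hKt : K ≠ ⊤ := by
    refine ENNReal.mul_ne_top (ENNReal.mul_ne_top ENNReal.ofReal_ne_top ?_) (hft z)
    rw [ENNReal.inv_ne_top, Ne, tsub_eq_zero_iff_le, not_le]
    rw [← ENNReal.ofReal_one]
    exact (ENNReal.ofReal_lt_ofReal_iff one_pos).2 hlx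
  set δ' : ℝ := δ * dotR q q / 4 with hδ'
  have hδ'0 : 0 < δ' := by have := D.qq; positivity
  have hbig : ∀ᶠ n in U, K * ex (-(2 * δ' * N n)) ≤ ENNReal.ofReal (c * ε / 2) := by
    have hz : Tendsto (fun n => K * ex (-(2 * δ' * N n))) U (nhds (K * 0)) := by
      refine ENNReal.Tendsto.const_mul ?_ (Or.inr hKt)
      have : Tendsto (fun n => Real.exp (-(2 * δ' * N n))) U (nhds 0) := by
        refine Real.tendsto_exp_neg_atTop_nhds_zero.comp ?_
        exact D.inf.const_mul_atTop (by positivity)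
      have := (ENNReal.continuous_ofReal.tendsto 0).comp this
      simpa [ex, Function.comp_def] using this
    rw [mul_zero] at hz
    exact hz.eventually (ge_mem_nhds (by rw [ENNReal.ofReal_pos]; positivity))
  filter_upwards [hbig, D.lower H δ' hδ'0 z, D.upper as δ' hδ'0] with n h1 h2 h3
  have h4 : ENNReal.ofReal l⁻¹ * (1 - ENNReal.ofReal θr)⁻¹ * (f z / f (zs n)) ≤
      ENNReal.ofReal (c * ε / 2) * kgreen (Ak m m0) z (zs n) := by
    have h5 : (f (zs n))⁻¹ ≤ ex (-(2 * δ' * N n)) * ex (-(N n * dotR a q) - δ' * N n) := by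
      rw [ENNReal.inv_le_iff_inv_le, ← ex_add]
      have h6 : ex (dotE as (zs n)) ≤ f (zs n) := le_self_add
      refine le_trans ?_ h6
      rw [ENNReal.inv_le_iff_le_mul]
      · rw [← ex_add, ← ex_zero]
        refine ex_le ?_
        rw [has, dotR_add_smul] at h3
        have : δ * dotR q q = 4 * δ' := by rw [hδ']; ring
        rw [this] at h3
        rw [has]
        nlinarith
      · intro _; exact ex_ne_zero _
      · intro _; exact ex_ne_zero _
    calc _ = K * (f (zs n))⁻¹ := by rw [hK, div_eq_mul_inv]; ring
      _ ≤ K * (ex (-(2 * δ' * N n)) * ex (-(N n * dotR a q) - δ' * N n)) := by gcongr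
      _ = K * ex (-(2 * δ' * N n)) * ex (-(N n * dotR a q) - δ' * N n) := by ring
      _ ≤ _ := mul_le_mul' h1 h2
  have h7 := (main (zs n)).trans (add_le_add_right h4 _)
  rw [← add_mul, ← ENNReal.ofReal_add (by positivity) (by positivity)] at h7
  have e : γ + c * ε / 2 = c * (τ0 + ε) := by rw [hγ]; ring
  rw [e, ENNReal.ofReal_mul hc.le, mul_assoc] at h7
  exact (ENNReal.mul_le_mul_iff_right (by simpa using hc) ENNReal.ofReal_ne_top).1 h7

end ratiolim

section limfun
variable {d : ℕ} {m m0 : Zd d → ENNReal}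

lemma n1_add (i j : Zd d) : n1 (i + j) ≤ n1 i + n1 j := by
  simp only [n1, Prod.fst_add, Prod.snd_add, Pi.add_apply]
  have h1 : ∑ x, (i.1 x + j.1 x).natAbs ≤ ∑ x, (i.1 x).natAbs + ∑ x, (j.1 x).natAbs := by
    rw [← Finset.sum_add_distrib]
    exact Finset.sum_le_sum fun x _ => Int.natAbs_add_le _ _
  have h2 := Int.natAbs_add_le i.2 j.2
  omega

lemma green_ne_zero (H : Chain m m0) (z w : Ed d) : kgreen (Ak m m0) z w ≠ 0 := by
  obtain ⟨n, hn⟩ := H.irr z w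
  intro h
  exact hn (le_zero_iff.1 ((kpow_le_green _ n z w).trans h.le))

lemma Ak_sum_dom (H : Chain m m0) (κ : ℝ) (hκ : 0 ≤ κ) (z0 z : Ed d) :
    ∑' w, Ak m m0 z w * ex (κ * n1 (jump z0 w)) ≠ ⊤ := by
  set M : Zd d → ENNReal := fun j => if z.2 = 0 then m0 j else m j with hM
  have hMt : ∑' j, M j * ex (κ * n1 j) ≠ ⊤ := by
    simp only [hM]
    by_cases hz : z.2 = 0
    · simp only [hz, if_true]; exact sum_n1_ne_top H.mom0 κ
    · simp only [hz, if_false]; exact sum_n1_ne_top H.mom κ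
  refine ne_top_of_le_ne_top (b := ex (κ * n1 (jump z0 z)) * ∑' j, M j * ex (κ * n1 j)) (ENNReal.mul_ne_top (ex_ne_top _) hMt) ?_
  refine le_trans ?_ (mul_le_mul_right (ENNReal.tsum_comp_le_tsum_of_injective (jump_inj z) fun j => M j * ex (κ * n1 j)) _)
  rw [← ENNReal.tsum_mul_left]
  refine ENNReal.tsum_le_tsum fun w => ?_
  have e : Ak m m0 z w = M (jump z w) := rfl
  rw [e, ← mul_assoc, mul_comm (ex _) (M _), mul_assoc, ← ex_add]
  refine mul_le_mul_right (ex_le ?_) _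
  have h1 : (n1 (jump z0 w) : ℝ) ≤ n1 (jump z0 z) + n1 (jump z w) := by
    have := n1_add (jump z0 z) (jump z w)
    rw [jump_add_jump] at this
    exact_mod_cast this
  nlinarith

lemma limit_fun {ι : Type*} {a q : Rd d} {U : Ultrafilter ι} {zs : ι → Ed d} {N : ι → ℝ} (H : Chain m m0)
    (D : DirH m m0 a q U zs N) (ha : pm m a ≤ 1) (b : ℝ) (hb : pm m (a.1, b) ≤ 1) (hb0 : pm m0 (a.1, b) ≤ 1)
    (z0 : Ed d) :
    ∃ h : Ed d → ℝ, (∀ z, Tendsto (fun n => (kgreen (Ak m m0) z (zs n)).toReal / (kgreen (Ak m m0) z0 (zs n)).toReal) U (nhds (h z)))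
      ∧ h z0 = 1 ∧ (∀ z, 0 ≤ h z) ∧ (∀ z, HasSum (fun w => (Ak m m0 z w).toReal * h w) (h z)) ∧
      ∀ u z, h (sft u z) = Real.exp (dotE a (bd u)) * h z := by
  set A := Ak m m0 with hA
  obtain ⟨κ, hκ0, hκ⟩ := harnack_n1 H
  set g : ι → Ed d → ℝ := fun n z => (kgreen A z (zs n)).toReal with hg
  have hgp : ∀ n z, 0 < g n z := fun n z => ENNReal.toReal_pos (green_ne_zero H _ _) (H.fin _ _)
  have hgk : ∀ n z z', Real.exp (-(κ * n1 (jump z z'))) * g n z' ≤ g n z := by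
    intro n z z'
    obtain ⟨k, hk⟩ := hκ z z'
    have h1 : ex (-(κ * n1 (jump z z'))) * kgreen A z' (zs n) ≤ kgreen A z (zs n) :=
      (mul_le_mul_left hk _).trans (kpow_mul_green_le _ k z z' _)
    have h2 := ENNReal.toReal_mono (H.fin _ _) h1
    rw [ENNReal.toReal_mul, ex, ENNReal.toReal_ofReal (Real.exp_pos _).le] at h2
    exact h2
  set K : ι → Ed d → ℝ := fun n z => g n z / g n z0 with hK
  have hKup : ∀ n z, K n z ≤ Real.exp (κ * n1 (jump z0 z)) := by
    intro n z
    simp only [hK]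
    rw [div_le_iff₀ (hgp _ _)]
    have := hgk n z0 z
    rw [Real.exp_neg, inv_mul_le_iff₀ (Real.exp_pos _)] at this
    exact this
  have hK0 : ∀ n z, 0 ≤ K n z := fun n z => (div_pos (hgp _ _) (hgp _ _)).le
  have hex : ∀ z, ∃ x, Tendsto (fun n => K n z) U (nhds x) := by
    intro z
    obtain ⟨x, -, hx⟩ := (isCompact_Icc (a := (0 : ℝ)) (b := Real.exp (κ * n1 (jump z0 z)))).ultrafilter_le_nhds
      (U.map fun n => K n z) (by
        rw [le_principal_iff]
        exact Eventually.of_forall (f := (U : Filter ι)) fun n => ⟨hK0 n z, hKup n z⟩)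
    exact ⟨x, hx⟩
  choose h hh using hex
  have hpos : ∀ z, 0 ≤ h z := fun z => ge_of_tendsto' (hh z) fun n => hK0 n z
  refine ⟨h, hh, ?_, hpos, ?_, ?_⟩
  · refine tendsto_nhds_unique (hh z0) ?_
    refine tendsto_const_nhds.congr fun n => ?_
    simp only [hK]; rw [div_self (hgp _ _).ne']
  · intro z
    have hAt : ∀ w, A z w ≠ ⊤ := by
      intro w
      simp only [hA, Ak]
      split_ifs
      · exact m_ne_top H.mom0 _
      · exact m_ne_top H.mom _
    have hdom : Summable fun w => (A z w).toReal * Real.exp (κ * n1 (jump z0 w)) := by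
      refine (ENNReal.summable_toReal (Ak_sum_dom H κ hκ0 z0 z)).congr fun w => ?_
      rw [ENNReal.toReal_mul, ex, ENNReal.toReal_ofReal (Real.exp_pos _).le]
    have hsum : ∀ n, z ≠ zs n → ∑' w, (A z w).toReal * K n w = K n z := by
      intro n hn
      have h1 := green_left A z (zs n)
      simp only [kone, hn, if_false, zero_add, kapp] at h1
      have h2 := congrArg ENNReal.toReal h1
      rw [ENNReal.tsum_toReal_eq (fun w => ENNReal.mul_ne_top (hAt w) (H.fin _ _))] at h2
      simp only [ENNReal.toReal_mul] at h2
      simp only [hK, ← mul_div_assoc]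
      rw [tsum_div_const]
      congr 1
      exact h2.symm
    have hz : ∀ᶠ n in (U : Filter ι), z ≠ zs n := by
      have h1 := D.upper q (dotR q q / 2) (by have := D.qq; positivity)
      have h2 : Tendsto (fun n => N n * (dotR q q / 2)) U atTop := D.inf.atTop_mul_const (by have := D.qq; positivity)
      filter_upwards [h1, h2.eventually_gt_atTop (dotE q z)] with n h3 h4 h5
      rw [← h5] at h3
      have : dotR q q - dotR q q / 2 = dotR q q / 2 := by ring
      rw [this] at h3
      linarith
    have hT := tendsto_tsum_of_dominated_convergence (𝓕 := (U : Filter ι)) (f := fun n w => (A z w).toReal * K n w)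
      (g := fun w => (A z w).toReal * h w) hdom (fun w => (hh w).const_mul _)
      (Eventually.of_forall fun n w => by
        rw [Real.norm_of_nonneg (mul_nonneg ENNReal.toReal_nonneg (hK0 n w))]
        exact mul_le_mul_of_nonneg_left (hKup n w) ENNReal.toReal_nonneg)
    have hT2 : Tendsto (fun n => K n z) U (nhds (∑' w, (A z w).toReal * h w)) := by
      refine hT.congr' ?_
      filter_upwards [hz] with n hn using hsum n hn
    have e := tendsto_nhds_unique hT2 (hh z)
    rw [← e]
    refine Summable.hasSum ?_
    refine Summable.of_nonneg_of_le (fun w => mul_nonneg ENNReal.toReal_nonneg (hpos w)) (fun w => ?_) hdom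
    exact mul_le_mul_of_nonneg_left (le_of_tendsto' (hh w) fun n => hKup n w) ENNReal.toReal_nonneg
  · have hup : ∀ u z, h (sft u z) ≤ Real.exp (dotE a (bd u)) * h z := by
      intro u z
      have h1 : ∀ ε : ℝ, 0 < ε → h (sft u z) ≤ (Real.exp (dotE a (bd u)) + ε) * h z := by
        intro ε hε
        refine le_of_tendsto_of_tendsto (hh (sft u z)) ((hh z).const_mul _) ?_
        filter_upwards [ratio_upper H D ha b hb hb0 u z ε hε] with n hn
        have h2 := ENNReal.toReal_mono (ENNReal.mul_ne_top ENNReal.ofReal_ne_top (H.fin _ _)) hn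
        rw [ENNReal.toReal_mul, ENNReal.toReal_ofReal (by positivity)] at h2
        simp only [hK, ← mul_div_assoc]
        exact div_le_div_of_nonneg_right h2 (hgp _ _).le
      have h3 : Tendsto (fun ε : ℝ => (Real.exp (dotE a (bd u)) + ε) * h z) (nhdsWithin 0 (Set.Ioi 0)) (nhds ((Real.exp (dotE a (bd u)) + 0) * h z)) := by
        refine Tendsto.mono_left ?_ nhdsWithin_le_nhds
        exact Continuous.tendsto (by fun_prop) 0
      rw [add_zero] at h3
      refine ge_of_tendsto h3 ?_
      filter_upwards [self_mem_nhdsWithin] with ε hε using h1 ε hε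
    intro u z
    refine le_antisymm (hup u z) ?_
    have h1 := hup (-u) (sft u z)
    have e1 : sft (-u) (sft u z) = z := by simp [sft_apply]
    have e2 : dotE a (bd (-u)) = -dotE a (bd u) := by simp [dotE, bd]
    rw [e1, e2, Real.exp_neg, le_inv_mul_iff₀ (Real.exp_pos _)] at h1
    exact h1

/-- the one dimensional equations satisfied by the limit -/
lemma limit_eqs (H : Chain m m0) (α : Fin d → ℝ) (h : Ed d → ℝ)
    (hh : ∀ z, HasSum (fun w => (Ak m m0 z w).toReal * h w) (h z)) (f : ℕ → ℝ)
    (hf : ∀ z : Ed d, h z = Real.exp (dotE (α, 0) z) * f z.2) :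
    (∀ y, HasSum (fun j : Zd d => (m j).toReal * Real.exp (dotZ (α, 0) j) * f (y + (j.2 + 1).toNat)) (f (y + 1))) ∧
    HasSum (fun j : Zd d => (m0 j).toReal * Real.exp (dotZ (α, 0) j) * f (j.2.toNat)) (f 0) := by
  constructor
  · intro y
    set z : Ed d := (0, y + 1) with hz
    have hz0 : dotE (α, 0) z = 0 := by simp [dotE, hz]
    have h1 := hh z
    rw [hf z, hz0, Real.exp_zero, one_mul] at h1
    refine ((jump_inj z).hasSum_iff ?_).1 ?_
    · intro j hj
      by_cases h2 : (z.2 : ℤ) + j.2 < 0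
      · rw [H.s1 j (by simp only [hz] at h2; push_cast at h2; omega)]; simp
      · obtain ⟨w, hw, -⟩ := exists_jump z j (by omega)
        exact absurd ⟨w, hw⟩ hj
    · refine h1.congr_fun fun w => ?_
      simp only [Function.comp_apply, Ak]
      rw [if_neg (by simp [hz])]
      by_cases h2 : (jump z w).2 < -1
      · rw [H.s1 _ h2]; simp
      · have e : y + ((jump z w).2 + 1).toNat = w.2 := by
          simp only [jump, hz] at h2 ⊢; push_cast at h2 ⊢; omega
        rw [e, hf w, dotE_jump (α, 0) z w, hz0, zero_add]; ring
  · set z : Ed d := 0 with hz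
    have hz0 : dotE (α, 0) z = 0 := by simp [dotE, hz]
    have h1 := hh z
    rw [hf z, hz0, Real.exp_zero, one_mul] at h1
    refine ((jump_inj z).hasSum_iff ?_).1 ?_
    · intro j hj
      by_cases h2 : (z.2 : ℤ) + j.2 < 0
      · rw [H.s0 j (by simp [hz] at h2; omega)]; simp
      · obtain ⟨w, hw, -⟩ := exists_jump z j (by omega)
        exact absurd ⟨w, hw⟩ hj
    · refine h1.congr_fun fun w => ?_
      simp only [Function.comp_apply, Ak]
      rw [if_pos (by simp [hz])]
      have e : ((jump z w).2).toNat = w.2 := by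
        simp [jump, hz]
      rw [e, hf w, dotE_jump (α, 0) z w, hz0, zero_add]; ring

end limfun

section calc11
variable {d : ℕ}

lemma pm_ofReal (μ : Zd d → ℝ) (hn : ∀ z, 0 ≤ μ z) (h3 : H3 μ) (t : ℝ) (ht : 0 < t) (a : Rd d) :
    pm (fun j => ENNReal.ofReal (μ j / t)) a = ENNReal.ofReal (phi μ a / t) := by
  have hs : Summable fun z => μ z / t * Real.exp (dotZ a z) := by
    refine ((h3 a).div_const t).congr fun z => ?_
    ring
  have : phi μ a / t = ∑' z, μ z / t * Real.exp (dotZ a z) := by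
    rw [phi, ← tsum_div_const]
    refine tsum_congr fun z => ?_
    ring
  rw [this, ENNReal.ofReal_tsum_of_nonneg _ hs]
  · simp only [pm, ex]
    refine tsum_congr fun z => ?_
    rw [ENNReal.ofReal_mul (div_nonneg (hn z) ht.le)]
  · intro z
    have := hn z
    positivity

lemma pm_le_one_iff (μ : Zd d → ℝ) (hn : ∀ z, 0 ≤ μ z) (h3 : H3 μ) (t : ℝ) (ht : 0 < t) (a : Rd d) :
    pm (fun j => ENNReal.ofReal (μ j / t)) a ≤ 1 ↔ phi μ a ≤ t := by
  rw [pm_ofReal μ hn h3 t ht, ENNReal.ofReal_le_one, div_le_one ht]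

lemma summable_n1 (μ : Zd d → ℝ) (hn : ∀ z, 0 ≤ μ z) (h3 : H3 μ) (R : ℝ) :
    Summable fun j => μ j * Real.exp (R * n1 j) := by
  have h := sum_n1_ne_top (m := fun j => ENNReal.ofReal (μ j / 1))
    (fun a => by rw [pm_ofReal μ hn h3 1 one_pos]; exact ENNReal.ofReal_ne_top) R
  refine (ENNReal.summable_toReal h).congr fun j => ?_
  rw [ENNReal.toReal_mul, ENNReal.toReal_ofReal (by rw [div_one]; exact hn j), ex,
    ENNReal.toReal_ofReal (Real.exp_pos _).le, div_one]

/-- `dotZ` as a continuous linear form -/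
def Lz (j : Zd d) : Rd d →L[ℝ] ℝ :=
  LinearMap.toContinuousLinearMap
    { toFun := fun a => dotZ a j
      map_add' := fun a b => by
        simp only [dotZ, Prod.fst_add, Prod.snd_add, Pi.add_apply, add_mul, Finset.sum_add_distrib]
        ring
      map_smul' := fun c a => by
        simp only [dotZ, Prod.smul_fst, Prod.smul_snd, Pi.smul_apply, smul_eq_mul, RingHom.id_apply,
          mul_add, Finset.mul_sum, mul_assoc] }

lemma Lz_apply (j : Zd d) (a : Rd d) : Lz j a = dotZ a j := rfl

lemma dotZ_norm (a : Rd d) (j : Zd d) : |dotZ a j| ≤ n1 j * ‖a‖ := by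
  simp only [dotZ, n1]
  push_cast
  have h1 : ∀ i, |a.1 i * (j.1 i : ℝ)| ≤ |(j.1 i : ℝ)| * ‖a‖ := by
    intro i
    rw [abs_mul, mul_comm]
    refine mul_le_mul_of_nonneg_left ?_ (abs_nonneg _)
    exact (norm_le_pi_norm a.1 i).trans (norm_fst_le a)
  have h2 : |a.2 * (j.2 : ℝ)| ≤ |(j.2 : ℝ)| * ‖a‖ := by
    rw [abs_mul, mul_comm]
    exact mul_le_mul_of_nonneg_left (norm_snd_le a) (abs_nonneg _)
  calc _ ≤ |∑ i, a.1 i * (j.1 i : ℝ)| + |a.2 * (j.2 : ℝ)| := abs_add_le _ _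
    _ ≤ ∑ i, |a.1 i * (j.1 i : ℝ)| + |a.2 * (j.2 : ℝ)| := by gcongr; exact Finset.abs_sum_le_sum_abs _ _
    _ ≤ ∑ i, |(j.1 i : ℝ)| * ‖a‖ + |(j.2 : ℝ)| * ‖a‖ := by
        gcongr with i; exact h1 i
    _ = _ := by rw [← Finset.sum_mul, ← add_mul]; simp only [Nat.cast_natAbs, Int.cast_abs]

lemma Lz_norm (j : Zd d) : ‖Lz j‖ ≤ n1 j :=
  ContinuousLinearMap.opNorm_le_bound _ (by positivity) fun a => dotZ_norm a j

lemma phi_hasFDeriv (μ : Zd d → ℝ) (hn : ∀ z, 0 ≤ μ z) (h3 : H3 μ) (a : Rd d) :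
    HasFDerivAt (phi μ) (∑' j, (μ j * Real.exp (dotZ a j)) • Lz j) a ∧
    Summable (fun j => (μ j * Real.exp (dotZ a j)) • Lz j) := by
  have hb : ∀ j : Zd d, ∀ x ∈ Metric.ball (0 : Rd d) (‖a‖ + 1),
      ‖(μ j * Real.exp (dotZ x j)) • Lz j‖ ≤ μ j * Real.exp ((‖a‖ + 2) * n1 j) := by
    intro j x hx
    rw [norm_smul, Real.norm_of_nonneg (mul_nonneg (hn j) (Real.exp_pos _).le), mul_assoc]
    refine mul_le_mul_of_nonneg_left ?_ (hn j)
    have h1 : ‖Lz j‖ ≤ Real.exp (n1 j) := (Lz_norm j).trans (by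
      have := Real.add_one_le_exp (n1 j : ℝ); linarith)
    have h2 : dotZ x j ≤ (‖a‖ + 1) * n1 j := by
      refine (le_abs_self _).trans ((dotZ_norm x j).trans ?_)
      rw [mul_comm]
      refine mul_le_mul_of_nonneg_right ?_ (by positivity)
      rw [mem_ball_zero_iff] at hx; exact hx.le
    calc _ ≤ Real.exp ((‖a‖ + 1) * n1 j) * Real.exp (n1 j) := by
          gcongr
      _ = _ := by rw [← Real.exp_add]; congr 1; ring
  have hs := summable_n1 μ hn h3 (‖a‖ + 2)
  have ha : a ∈ Metric.ball (0 : Rd d) (‖a‖ + 1) := by rw [mem_ball_zero_iff]; linarith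
  constructor
  · refine hasFDerivAt_tsum_of_isPreconnected (f := fun j x => μ j * Real.exp (dotZ x j))
      (f' := fun j x => (μ j * Real.exp (dotZ x j)) • Lz j) hs Metric.isOpen_ball
      (convex_ball _ _).isPreconnected ?_ hb ha (h3 a) ha
    intro j x _
    have := ((Lz j).hasFDerivAt (x := x)).exp.const_mul (μ j)
    rw [smul_smul] at this
    exact this
  · exact Summable.of_norm_bounded hs fun j => hb j a ha

lemma phi_continuous (μ : Zd d → ℝ) (hn : ∀ z, 0 ≤ μ z) (h3 : H3 μ) : Continuous (phi μ) :=
  continuous_iff_continuousAt.2 fun a => (phi_hasFDeriv μ hn h3 a).1.continuousAt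

lemma dBeta_hasSum (μ : Zd d → ℝ) (hn : ∀ z, 0 ≤ μ z) (h3 : H3 μ) (a : Rd d) :
    HasSum (fun j => μ j * Real.exp (dotZ a j) * (j.2 : ℝ)) (dBeta (phi μ) a) := by
  obtain ⟨h1, h2⟩ := phi_hasFDeriv μ hn h3 a
  rw [dBeta, h1.fderiv]
  have := (ContinuousLinearMap.apply ℝ ℝ ((0, 1) : Rd d)).hasSum h2.hasSum
  refine HasSum.congr_fun this fun j => ?_
  simp [Lz_apply, dotZ]

lemma phi_hasSum (μ : Zd d → ℝ) (h3 : H3 μ) (a : Rd d) :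
    HasSum (fun j => μ j * Real.exp (dotZ a j)) (phi μ a) := (h3 a).hasSum

/-- tangent inequality in the last coordinate -/
lemma phi_tangent (μ : Zd d → ℝ) (hn : ∀ z, 0 ≤ μ z) (h3 : H3 μ) (α : Fin d → ℝ) (b c : ℝ) :
    phi μ (α, b) + dBeta (phi μ) (α, b) * (c - b) ≤ phi μ (α, c) := by
  have h := (phi_hasSum μ h3 (α, b)).add ((dBeta_hasSum μ hn h3 (α, b)).mul_right (c - b))
  refine hasSum_le (fun j => ?_) h (phi_hasSum μ h3 (α, c))
  have e : dotZ (α, c) j = dotZ (α, b) j + j.2 * (c - b) := by simp only [dotZ]; ring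
  rw [e, Real.exp_add]
  have h1 := Real.add_one_le_exp ((j.2 : ℝ) * (c - b))
  have h2 : 0 ≤ μ j * Real.exp (dotZ (α, b) j) := mul_nonneg (hn j) (Real.exp_pos _).le
  nlinarith

/-- strict tangent inequality -/
lemma phi_tangent_lt (μ : Zd d → ℝ) (hn : ∀ z, 0 ≤ μ z) (h3 : H3 μ) (α : Fin d → ℝ) (b c : ℝ)
    (hbc : b ≠ c) (hj : ∃ j : Zd d, 0 < μ j ∧ j.2 ≠ 0) :
    phi μ (α, b) + dBeta (phi μ) (α, b) * (c - b) < phi μ (α, c) := by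
  have h := (phi_hasSum μ h3 (α, b)).add ((dBeta_hasSum μ hn h3 (α, b)).mul_right (c - b))
  obtain ⟨j0, hj0, hj0'⟩ := hj
  have e : ∀ j, dotZ (α, c) j = dotZ (α, b) j + j.2 * (c - b) := by intro j; simp only [dotZ]; ring
  refine hasSum_lt (fun j => ?_) (i := j0) ?_ h (phi_hasSum μ h3 (α, c))
  · simp only
    rw [e, Real.exp_add]
    have h1 := Real.add_one_le_exp ((j.2 : ℝ) * (c - b))
    have h2 : 0 ≤ μ j * Real.exp (dotZ (α, b) j) := mul_nonneg (hn j) (Real.exp_pos _).le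
    nlinarith
  · rw [e, Real.exp_add]
    have h1 := Real.add_one_lt_exp (x := (j0.2 : ℝ) * (c - b))
      (mul_ne_zero (by exact_mod_cast hj0') (sub_ne_zero.2 hbc.symm))
    have h2 : 0 < μ j0 * Real.exp (dotZ (α, b) j0) := mul_pos hj0 (Real.exp_pos _)
    nlinarith

lemma frontier_eq (μ : Zd d → ℝ) (hn : ∀ z, 0 ≤ μ z) (h3 : H3 μ) (t : ℝ) (a : Rd d)
    (ha : a ∈ frontier (Dset μ t)) : phi μ a = t :=
  frontier_le_subset_eq (phi_continuous μ hn h3) continuous_const ha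

/-- everything about `betaBar` -/
lemma betaBar_spec (μ : Zd d → ℝ) (hn : ∀ z, 0 ≤ μ z) (h3 : H3 μ) (t : ℝ) (α : Fin d → ℝ)
    (hj : ∃ j : Zd d, 0 < μ j ∧ j.2 = -1) (c : ℝ) (hc : phi μ (α, c) ≤ t) :
    phi μ (α, betaBar μ t α) = t ∧ ∀ b, phi μ (α, b) ≤ t → betaBar μ t α ≤ b := by
  set S : Set ℝ := {b : ℝ | phi μ (α, b) ≤ t} with hS
  have hcont : Continuous fun b : ℝ => phi μ (α, b) := (phi_continuous μ hn h3).comp (by fun_prop)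
  have hcl : IsClosed S := isClosed_le hcont continuous_const
  obtain ⟨j, hj, hj2⟩ := hj
  have hbd : BddBelow S := by
    set K := μ j * Real.exp (dotZ (α, 0) j) with hK
    have hKp : 0 < K := mul_pos hj (Real.exp_pos _)
    refine ⟨1 - t / K, fun b hb => ?_⟩
    have h1 : μ j * Real.exp (dotZ (α, b) j) ≤ phi μ (α, b) :=
      (h3 (α, b)).le_tsum j fun i _ => mul_nonneg (hn i) (Real.exp_pos _).le
    have h2 : dotZ (α, b) j = dotZ (α, 0) j + (-b) := by
      simp only [dotZ, hj2]; push_cast; ring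
    rw [h2, Real.exp_add, ← mul_assoc] at h1
    have h3 := Real.add_one_le_exp (-b)
    have h4 : K * (-b + 1) ≤ t := (mul_le_mul_of_nonneg_left h3 hKp.le).trans (h1.trans hb)
    have h5 : -b + 1 ≤ t / K := by rw [le_div_iff₀ hKp]; linarith
    linarith
  have hmem : betaBar μ t α ∈ S := hcl.csInf_mem ⟨c, hc⟩ hbd
  refine ⟨?_, fun b hb => csInf_le hbd hb⟩
  refine le_antisymm hmem ?_
  by_contra hlt
  push Not at hlt
  have : ∀ᶠ b in nhds (betaBar μ t α), phi μ (α, b) < t := hcont.continuousAt.eventually_lt continuousAt_const hlt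
  obtain ⟨ε, hε, h⟩ := Metric.eventually_nhds_iff.1 this
  have h6 := h (y := betaBar μ t α - ε / 2) (by rw [Real.dist_eq]; rw [abs_lt]; constructor <;> linarith)
  have h7 : betaBar μ t α ≤ betaBar μ t α - ε / 2 := csInf_le hbd h6.le
  linarith

/-- monotonicity of the boundary generating function -/
lemma phi0_mono (μ₀ : Zd d → ℝ) (hn : ∀ z, 0 ≤ μ₀ z) (h3 : H3 μ₀) (hs : ∀ z : Zd d, z.2 < 0 → μ₀ z = 0)
    (α : Fin d → ℝ) {b c : ℝ} (h : b ≤ c) : phi μ₀ (α, b) ≤ phi μ₀ (α, c) := by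
  refine hasSum_le (fun j => ?_) (phi_hasSum μ₀ h3 (α, b)) (phi_hasSum μ₀ h3 (α, c))
  rcases lt_or_ge j.2 0 with hj | hj
  · simp [hs j hj]
  · refine mul_le_mul_of_nonneg_left (Real.exp_le_exp.2 ?_) (hn j)
    simp only [dotZ]
    have : (0 : ℝ) ≤ j.2 := by exact_mod_cast hj
    nlinarith

lemma phi0_dBeta_pos (μ₀ : Zd d → ℝ) (hn : ∀ z, 0 ≤ μ₀ z) (h3 : H3 μ₀) (hs : ∀ z : Zd d, z.2 < 0 → μ₀ z = 0)
    (hj : ∃ j : Zd d, 0 < μ₀ j ∧ 0 < j.2) (a : Rd d) : 0 < dBeta (phi μ₀) a := by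
  obtain ⟨j0, h1, h2⟩ := hj
  have h2' : (0 : ℝ) < j0.2 := by exact_mod_cast h2
  refine hasSum_lt (f := fun _ => (0 : ℝ)) (g := fun j => μ₀ j * Real.exp (dotZ a j) * (j.2 : ℝ)) (i := j0) (fun j => ?_) (by positivity) hasSum_zero (dBeta_hasSum μ₀ hn h3 a)
  simp only
  rcases lt_or_ge j.2 0 with hj | hj
  · simp [hs j hj]
  · have : (0 : ℝ) ≤ j.2 := by exact_mod_cast hj
    exact mul_nonneg (mul_nonneg (hn j) (Real.exp_pos _).le) this

/-- the `Theta` condition -/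
lemma mem_Theta_of (μ μ₀ : Zd d → ℝ) (hn : ∀ z, 0 ≤ μ z) (t : ℝ) (α : Fin d → ℝ)
    (b : ℝ) (h : phi μ (α, b) ≤ t) (h' : phi μ₀ (α, b) ≤ t) : α ∈ Theta μ μ₀ t := by
  have hb : BddBelow (Set.range fun β : ℝ => max (phi μ (α, β)) (phi μ₀ (α, β))) := ?_
  · exact le_trans (csInf_le hb ⟨b, rfl⟩) (max_le h h')
  refine ⟨0, ?_⟩
  rintro _ ⟨c, rfl⟩
  exact le_max_of_le_left (tsum_nonneg fun j => mul_nonneg (hn j) (Real.exp_pos _).le)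

end calc11

section concrete
variable {d : ℕ}

/-- the normalized step measure -/
def Mt (μ : Zd d → ℝ) (t : ℝ) : Zd d → ENNReal := fun j => ENNReal.ofReal (μ j / t)

lemma pm_Mt_ne_top (μ : Zd d → ℝ) (hn : ∀ z, 0 ≤ μ z) (h3 : H3 μ) (t : ℝ) (ht : 0 < t) (a : Rd d) :
    pm (Mt μ t) a ≠ ⊤ := by
  unfold Mt
  rw [pm_ofReal μ hn h3 t ht]; exact ENNReal.ofReal_ne_top

lemma pm_Mt_le (μ : Zd d → ℝ) (hn : ∀ z, 0 ≤ μ z) (h3 : H3 μ) (t : ℝ) (ht : 0 < t) (a : Rd d) :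
    pm (Mt μ t) a ≤ 1 ↔ phi μ a ≤ t := pm_le_one_iff μ hn h3 t ht a

lemma Mt_toReal (μ : Zd d → ℝ) (hn : ∀ z, 0 ≤ μ z) (t : ℝ) (ht : 0 < t) (j : Zd d) :
    (Mt μ t j).toReal = μ j / t := ENNReal.toReal_ofReal (div_nonneg (hn j) ht.le)

lemma Mt_ne_zero (μ : Zd d → ℝ) (t : ℝ) (ht : 0 < t) (j : Zd d) :
    Mt μ t j ≠ 0 ↔ 0 < μ j := by
  simp only [Mt, ne_eq, ENNReal.ofReal_eq_zero, not_le, div_pos_iff_of_pos_right ht]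

lemma Mt_supp {μ μ₀ : Zd d → ℝ} (h0 : H0 μ μ₀) (t : ℝ) : Supp (Mt μ t) (Mt μ₀ t) where
  s1 := fun j hj => by simp [Mt, h0.1 j hj]
  s0 := fun j hj => by simp [Mt, h0.2 j hj]

lemma kpow_row {m m0 : Zd d → ENNReal} (H : Supp m m0) (x : ENNReal) (h : pm m 0 ≤ x) (h' : pm m0 0 ≤ x)
    (n : ℕ) (z w : Ed d) : kpow (Ak m m0) n z w ≤ x ^ n := by
  have e : ∀ w : Ed d, ex (dotE 0 w) = 1 := fun w => by simp [dotE, ex_zero]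
  have := kpow_super (Ak m m0) (fun w => ex (dotE 0 w)) x (fun z => by
    rw [kapp_ex H]
    refine mul_le_mul_left ?_ _
    split_ifs <;> assumption) n z
  have h2 := (kapp_term (kpow (Ak m m0) n) (fun w => ex (dotE 0 w)) z w).trans this
  simpa [e] using h2

variable {μ μ₀ : Zd d → ℝ}


lemma kpow_Mt_ne_top
    (hn : ∀ z, 0 ≤ μ z) (hn0 : ∀ z, 0 ≤ μ₀ z) (h0 : H0 μ μ₀) (h3 : H3 μ) (h3' : H3 μ₀)
    (t : ℝ) (ht : 0 < t) (n : ℕ) (z w : Ed d) :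
    kpow (Ak (Mt μ t) (Mt μ₀ t)) n z w ≠ ⊤ := by
  refine ne_top_of_le_ne_top ?_ (kpow_row (Mt_supp h0 t) (pm (Mt μ t) 0 + pm (Mt μ₀ t) 0) le_self_add le_add_self n z w)
  exact ENNReal.pow_ne_top (ENNReal.add_ne_top.2
    ⟨pm_Mt_ne_top μ hn h3 t ht 0, pm_Mt_ne_top μ₀ hn0 h3' t ht 0⟩)

lemma kerN_eq
    (hn : ∀ z, 0 ≤ μ z) (hn0 : ∀ z, 0 ≤ μ₀ z) (h0 : H0 μ μ₀) (h3 : H3 μ) (h3' : H3 μ₀)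
    (t : ℝ) (ht : 0 < t) (n : ℕ) : ∀ z w : Ed d,
    (t ^ n)⁻¹ * kerN μ μ₀ n z w = (kpow (Ak (Mt μ t) (Mt μ₀ t)) n z w).toReal := by
  induction n with
  | zero =>
    intro z w
    by_cases h : z = w <;> simp [kerN, kpow, kone, h]
  | succ n ih =>
    intro z w
    have hK : ∀ v, (Ak (Mt μ t) (Mt μ₀ t) v w).toReal = t⁻¹ * ker μ μ₀ v w := by
      intro v
      simp only [Ak, ker]
      split_ifs
      · rw [Mt_toReal μ₀ hn0 t ht]; ring
      · rw [Mt_toReal μ hn t ht]; ring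
    have hKt : ∀ v, Ak (Mt μ t) (Mt μ₀ t) v w ≠ ⊤ := by
      intro v; simp only [Ak, Mt]; split_ifs <;> exact ENNReal.ofReal_ne_top
    simp only [kerN, kpow, kmul]
    rw [ENNReal.tsum_toReal_eq fun v => ENNReal.mul_ne_top
      (kpow_Mt_ne_top hn hn0 h0 h3 h3' t ht n z v) (hKt v), ← tsum_mul_left]
    refine tsum_congr fun v => ?_
    rw [ENNReal.toReal_mul, hK, ← ih z v, pow_succ, mul_inv]; ring

lemma kerN_nonneg
    (hn : ∀ z, 0 ≤ μ z) (hn0 : ∀ z, 0 ≤ μ₀ z) (h0 : H0 μ μ₀) (h3 : H3 μ) (h3' : H3 μ₀)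
    (n : ℕ) (z w : Ed d) : 0 ≤ kerN μ μ₀ n z w := by
  have := kerN_eq hn hn0 h0 h3 h3' 1 one_pos n z w
  rw [one_pow, inv_one, one_mul] at this
  rw [this]; exact ENNReal.toReal_nonneg

lemma kerN_le_one
    (hn : ∀ z, 0 ≤ μ z) (hn0 : ∀ z, 0 ≤ μ₀ z) (h0 : H0 μ μ₀) (h3 : H3 μ) (h3' : H3 μ₀)
    (hs : ∑' z, μ z ≤ 1) (hs0 : ∑' z, μ₀ z ≤ 1) (n : ℕ) (z w : Ed d) :
    kerN μ μ₀ n z w ≤ 1 := by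
  have := kerN_eq hn hn0 h0 h3 h3' 1 one_pos n z w
  rw [one_pow, inv_one, one_mul] at this
  rw [this]
  have h := kpow_row (Mt_supp h0 1) 1 ((pm_Mt_le μ hn h3 1 one_pos 0).2 (by simpa [phi, dotZ] using hs))
    ((pm_Mt_le μ₀ hn0 h3' 1 one_pos 0).2 (by simpa [phi, dotZ] using hs0)) n z w
  rw [one_pow] at h
  exact ENNReal.toReal_le_of_le_ofReal zero_le_one (by simpa using h)

lemma rho_ev
    (hn : ∀ z, 0 ≤ μ z) (hn0 : ∀ z, 0 ≤ μ₀ z) (h0 : H0 μ μ₀) (h3 : H3 μ) (h3' : H3 μ₀)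
    (hs : ∑' z, μ z ≤ 1) (hs0 : ∑' z, μ₀ z ≤ 1) (t : ℝ) (ht : rho μ μ₀ < t) :
    ∃ s, 0 < s ∧ s < t ∧ ∀ᶠ n : ℕ in atTop, kerN μ μ₀ n 0 0 ≤ s ^ n := by
  obtain ⟨s, h1, h2⟩ := exists_between ht
  have hnn := fun n => kerN_nonneg hn hn0 h0 h3 h3' n 0 0
  have hb : IsBoundedUnder (· ≤ ·) atTop (fun n : ℕ => (kerN μ μ₀ n 0 0) ^ ((n : ℝ)⁻¹)) := by
    refine ⟨1, ?_⟩
    rw [eventually_map]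
    refine Eventually.of_forall fun n => ?_
    exact Real.rpow_le_one (hnn n) (kerN_le_one hn hn0 h0 h3 h3' hs hs0 n 0 0) (by positivity)
  have hev := eventually_lt_of_limsup_lt h1 hb
  have hs' : 0 < s := by
    obtain ⟨n, hn'⟩ := hev.exists
    exact (Real.rpow_nonneg (hnn n) _).trans_lt hn'
  refine ⟨s, hs', h2, ?_⟩
  filter_upwards [hev, eventually_ge_atTop 1] with n h hn1
  have : kerN μ μ₀ n 0 0 = ((kerN μ μ₀ n 0 0) ^ ((n : ℝ)⁻¹)) ^ n :=
    (Real.rpow_inv_natCast_pow (hnn n) (by omega)).symm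
  rw [this]
  exact pow_le_pow_left₀ (Real.rpow_nonneg (hnn n) _) h.le n

lemma homN_zero
    (hn : ∀ z, 0 ≤ μ z)
    (t : ℝ) (ht : 0 < t) (n : ℕ) : ∀ z w : Zd d,
    kpow (Hk (Mt μ t)) n z w = 0 → homN μ n z w = 0 := by
  induction n with
  | zero =>
    intro z w h
    by_cases h' : z = w
    · simp [kpow, kone, h'] at h
    · simp [homN, h']
  | succ n ih =>
    intro z w h
    simp only [kpow, kmul, ENNReal.tsum_eq_zero, mul_eq_zero] at h
    simp only [homN]
    rw [← tsum_zero (β := Zd d)]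
    refine tsum_congr fun v => ?_
    rcases h v with h | h
    · rw [ih z v h, zero_mul]
    · have : ¬ (0 < μ (w - v)) := fun hp => (Mt_ne_zero μ t ht _).2 hp h
      have : μ (w - v) = 0 := le_antisymm (not_lt.1 this) (hn _)
      rw [this, mul_zero]

lemma chain_concrete
    (hn : ∀ z, 0 ≤ μ z) (hn0 : ∀ z, 0 ≤ μ₀ z) (h0 : H0 μ μ₀) (h3 : H3 μ) (h3' : H3 μ₀)
    (hs : ∑' z, μ z ≤ 1) (hs0 : ∑' z, μ₀ z ≤ 1) (h1 : H1 μ μ₀) (h2 : H2 μ)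
    (t : ℝ) (ht : rho μ μ₀ < t) : 0 < t ∧ Chain (Mt μ t) (Mt μ₀ t) := by
  obtain ⟨s, hsp, hst, hev⟩ := rho_ev hn hn0 h0 h3 h3' hs hs0 t ht
  have htp : 0 < t := hsp.trans hst
  have irr : ∀ z z', ∃ n, kpow (Ak (Mt μ t) (Mt μ₀ t)) n z z' ≠ 0 := by
    intro z z'
    obtain ⟨n, hn'⟩ := h1 z z'
    refine ⟨n, fun h => ?_⟩
    have := kerN_eq hn hn0 h0 h3 h3' t htp n z z'
    rw [h, ENNReal.toReal_zero] at this
    have : 0 < (t ^ n)⁻¹ * kerN μ μ₀ n z z' := by positivity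
    linarith
  have f0 : kgreen (Ak (Mt μ t) (Mt μ₀ t)) 0 0 ≠ ⊤ := by
    have hsum : Summable fun n => (kpow (Ak (Mt μ t) (Mt μ₀ t)) n 0 0).toReal := by
      refine Summable.of_norm_bounded_eventually_nat (g := fun n => (s / t) ^ n)
        (summable_geometric_of_lt_one (by positivity) ((div_lt_one htp).2 hst)) ?_
      filter_upwards [hev] with n h
      rw [Real.norm_of_nonneg ENNReal.toReal_nonneg, ← kerN_eq hn hn0 h0 h3 h3' t htp, div_pow, div_eq_inv_mul]
      exact mul_le_mul_of_nonneg_left h (by positivity)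
    have := hsum.tsum_ofReal_ne_top
    simp only [ENNReal.ofReal_toReal (kpow_Mt_ne_top hn hn0 h0 h3 h3' t htp _ _ _)] at this
    exact this
  refine ⟨htp, { toSupp := Mt_supp h0 t, irr := irr, irrh := ?_, mom := ?_, mom0 := ?_, fin := ?_ }⟩
  · intro z
    obtain ⟨n, hn'⟩ := h2 0 z
    exact ⟨n, fun h => hn'.ne' (homN_zero hn t htp n 0 z h)⟩
  · exact pm_Mt_ne_top μ hn h3 t htp
  · exact pm_Mt_ne_top μ₀ hn0 h3' t htp
  · intro z w hzw
    obtain ⟨k, hk⟩ := irr 0 z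
    obtain ⟨l, hl⟩ := irr w 0
    have h1 := kpow_mul_green_le (Ak (Mt μ t) (Mt μ₀ t)) k 0 z w
    have h2 := green_mul_kpow_le (Ak (Mt μ t) (Mt μ₀ t)) l 0 w 0
    rw [hzw, ENNReal.mul_top hk, top_le_iff] at h1
    rw [h1, ENNReal.top_mul hl, top_le_iff] at h2
    exact f0 h2

lemma green_eq
    (hn : ∀ z, 0 ≤ μ z) (hn0 : ∀ z, 0 ≤ μ₀ z) (h0 : H0 μ μ₀) (h3 : H3 μ) (h3' : H3 μ₀)
    (t : ℝ) (ht : 0 < t) (z w : Ed d) :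
    green μ μ₀ t z w = (kgreen (Ak (Mt μ t) (Mt μ₀ t)) z w).toReal := by
  rw [green, kgreen, ENNReal.tsum_toReal_eq fun n => kpow_Mt_ne_top hn hn0 h0 h3 h3' t ht n z w]
  exact tsum_congr fun n => kerN_eq hn hn0 h0 h3 h3' t ht n z w

lemma theta_exists
    (hn : ∀ z, 0 ≤ μ z) (hn0 : ∀ z, 0 ≤ μ₀ z) (h0 : H0 μ μ₀) (h3 : H3 μ) (h3' : H3 μ₀)
    (t : ℝ) (ht : 0 < t) (H : Chain (Mt μ t) (Mt μ₀ t)) (α : Fin d → ℝ)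
    (h : α ∈ Theta μ μ₀ t) : ∃ b, phi μ (α, b) ≤ t ∧ phi μ₀ (α, b) ≤ t := by
  obtain ⟨b, _, h1, h2⟩ := theta_closed H (Mt μ₀ t) H.mom0 α Set.univ isClosed_univ (by
    intro r hr
    have hlt : t < t * Real.exp r := by
      have := Real.one_lt_exp_iff.2 hr
      nlinarith
    obtain ⟨_, ⟨b, rfl⟩, hb⟩ := exists_lt_of_csInf_lt (Set.range_nonempty _) (lt_of_le_of_lt h hlt)
    simp only [max_lt_iff] at hb
    refine ⟨b, trivial, ?_, ?_⟩
    · unfold Mt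
      rw [pm_ofReal μ hn h3 t ht]
      refine ENNReal.ofReal_le_ofReal ?_
      rw [div_le_iff₀ ht]; linarith [hb.1]
    · unfold Mt
      rw [pm_ofReal μ₀ hn0 h3' t ht]
      refine ENNReal.ofReal_le_ofReal ?_
      rw [div_le_iff₀ ht]; linarith [hb.2])
  exact ⟨b, (pm_Mt_le μ hn h3 t ht _).1 h1, (pm_Mt_le μ₀ hn0 h3' t ht _).1 h2⟩

end concrete

section ident
variable {d : ℕ} {μ μ₀ : Zd d → ℝ}

lemma dotZ_shift (α : Fin d → ℝ) (b c : ℝ) (j : Zd d) :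
    dotZ (α, b + c) j = dotZ (α, b) j + c * j.2 := by simp only [dotZ]; ring

lemma exp_toNat {j : Zd d} (hj : -1 ≤ j.2) (s : ℝ) :
    Real.exp s ^ (j.2 + 1).toNat = Real.exp (s * j.2) * Real.exp s := by
  rw [← Real.exp_nat_mul, ← Real.exp_add]
  congr 1
  have : (((j.2 + 1).toNat : ℤ) : ℝ) = ((j.2 + 1 : ℤ) : ℝ) := by rw [Int.toNat_of_nonneg (by omega)]
  rw [Int.cast_natCast] at this
  rw [this]; push_cast; ring

lemma toNat_real {j : Zd d} (hj : 0 ≤ j.2) : ((j.2.toNat : ℕ) : ℝ) = (j.2 : ℝ) := by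
  have : ((j.2.toNat : ℤ) : ℝ) = (j.2 : ℝ) := by rw [Int.toNat_of_nonneg hj]
  rwa [Int.cast_natCast] at this

lemma toNat_real' {j : Zd d} (hj : -1 ≤ j.2) : (((j.2 + 1).toNat : ℕ) : ℝ) = (j.2 : ℝ) + 1 := by
  have : (((j.2 + 1).toNat : ℤ) : ℝ) = ((j.2 + 1 : ℤ) : ℝ) := by rw [Int.toNat_of_nonneg (by omega)]
  rw [Int.cast_natCast] at this
  rw [this]; push_cast; ring

lemma sum_pow
    (hn : ∀ z, 0 ≤ μ z) (h3 : H3 μ)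
    (hs : ∀ z : Zd d, z.2 < -1 → μ z = 0) (t : ℝ) (α : Fin d → ℝ) (b s : ℝ) :
    HasSum (fun j => μ j / t * Real.exp (dotZ (α, b) j) * Real.exp s ^ (j.2 + 1).toNat)
      (phi μ (α, b + s) / t * Real.exp s) := by
  refine (((phi_hasSum μ h3 (α, b + s)).div_const t).mul_right (Real.exp s)).congr_fun fun j => ?_
  rcases lt_or_ge j.2 (-1) with hj | hj
  · simp [hs j hj]
  · rw [exp_toNat hj, dotZ_shift, Real.exp_add]; ring

lemma od_concrete
    (hn : ∀ z, 0 ≤ μ z) (h3 : H3 μ)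
    (hs : ∀ z : Zd d, z.2 < -1 → μ z = 0) (t : ℝ) (ht : 0 < t) (α : Fin d → ℝ) (b : ℝ)
    (hb : phi μ (α, b) = t) (hd : ∃ j : Zd d, 0 < μ j ∧ j.2 = -1) (hu : ∃ j : Zd d, 0 < μ j ∧ 0 < j.2) :
    OD (fun j => μ j / t * Real.exp (dotZ (α, b) j)) (fun j : Zd d => (j.2 + 1).toNat) where
  nn := fun j => mul_nonneg (div_nonneg (hn j) ht.le) (Real.exp_pos _).le
  one := by
    have := (phi_hasSum μ h3 (α, b)).div_const t
    rw [hb, div_self ht.ne'] at this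
    refine this.congr_fun fun j => ?_
    ring
  down := by
    obtain ⟨j, h1, h2⟩ := hd
    exact ⟨j, by positivity, by simp [h2]⟩
  up := by
    obtain ⟨j, h1, h2⟩ := hu
    exact ⟨j, by positivity, by omega⟩
  mom := fun C hC => by
    have := (sum_pow hn h3 hs t α b (Real.log C)).summable
    rwa [Real.exp_log (by linarith)] at this

lemma har_concrete (hs : ∀ z : Zd d, z.2 < -1 → μ z = 0) (t : ℝ) (α : Fin d → ℝ) (b : ℝ) (f : ℕ → ℝ)
    (hf : ∀ y, HasSum (fun j => μ j / t * Real.exp (dotZ (α, 0) j) * f (y + (j.2 + 1).toNat)) (f (y + 1))) :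
    Har (fun j => μ j / t * Real.exp (dotZ (α, b) j)) (fun j : Zd d => (j.2 + 1).toNat)
      (fun y => f y * Real.exp (-b * y)) := by
  intro y
  refine ((hf y).mul_right (Real.exp (-b * ((y + 1 : ℕ) : ℝ)))).congr_fun fun j => ?_
  rcases lt_or_ge j.2 (-1) with hj | hj
  · simp [hs j hj]
  · have e1 := dotZ_shift α 0 b j
    rw [zero_add] at e1
    simp only [e1, Real.exp_add]
    push_cast
    rw [toNat_real' hj]
    have : Real.exp (b * (j.2 : ℝ)) * Real.exp (-b * ((y : ℝ) + ((j.2 : ℝ) + 1))) = Real.exp (-b * ((y : ℝ) + 1)) := by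
      rw [← Real.exp_add]; congr 1; ring
    rw [← this]; ring

lemma bdry_exp
    (hn0 : ∀ z, 0 ≤ μ₀ z) (h3' : H3 μ₀)
    (hs : ∀ z : Zd d, z.2 < 0 → μ₀ z = 0) (t : ℝ) (α : Fin d → ℝ) (b : ℝ) :
    HasSum (fun j : Zd d => μ₀ j / t * Real.exp (dotZ (α, 0) j) * Real.exp (b * (j.2.toNat : ℕ)))
      (phi μ₀ (α, b) / t) := by
  refine ((phi_hasSum μ₀ h3' (α, b)).div_const t).congr_fun fun j => ?_
  rcases lt_or_ge j.2 0 with hj | hj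
  · simp [hs j hj]
  · have e1 := dotZ_shift α 0 b j
    rw [zero_add] at e1
    rw [toNat_real hj, e1, Real.exp_add]; ring

lemma bdry_exp'
    (hn0 : ∀ z, 0 ≤ μ₀ z) (h3' : H3 μ₀)
    (hs : ∀ z : Zd d, z.2 < 0 → μ₀ z = 0) (t : ℝ) (α : Fin d → ℝ) (b : ℝ) :
    HasSum (fun j : Zd d => μ₀ j / t * Real.exp (dotZ (α, 0) j) *
      ((j.2.toNat : ℕ) * Real.exp (b * (j.2.toNat : ℕ))))
      (dBeta (phi μ₀) (α, b) / t) := by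
  refine ((dBeta_hasSum μ₀ hn0 h3' (α, b)).div_const t).congr_fun fun j => ?_
  rcases lt_or_ge j.2 0 with hj | hj
  · simp [hs j hj]
  · have e1 := dotZ_shift α 0 b j
    rw [zero_add] at e1
    rw [toNat_real hj, e1, Real.exp_add]; ring

lemma geoS_mul (r : ℝ) (y : ℕ) : geoS r y * (r - 1) = r ^ y - 1 := by
  rw [geoS]; exact geom_sum_mul r y

lemma geoS_one (y : ℕ) : geoS 1 y = y := by simp [geoS]

lemma identify
    (hn : ∀ z, 0 ≤ μ z) (hn0 : ∀ z, 0 ≤ μ₀ z) (h0 : H0 μ μ₀) (h3 : H3 μ) (h3' : H3 μ₀)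
    (t : ℝ) (ht : 0 < t) (a : Rd d) (haF : a ∈ frontier (Dset μ t))
    (hdb : 0 ≤ dBeta (phi μ) a) (hb0 : phi μ₀ (abar μ t a) ≤ t)
    (hd : ∃ j : Zd d, 0 < μ j ∧ j.2 = -1) (hu : ∃ j : Zd d, 0 < μ j ∧ 0 < j.2)
    (hu0 : ∃ j : Zd d, 0 < μ₀ j ∧ 0 < j.2) (f : ℕ → ℝ) (hf0 : ∀ y, 0 ≤ f y)
    (hf : ∀ y, HasSum (fun j => μ j / t * Real.exp (dotZ (a.1, 0) j) * f (y + (j.2 + 1).toNat)) (f (y + 1)))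
    (hfb : HasSum (fun j : Zd d => μ₀ j / t * Real.exp (dotZ (a.1, 0) j) * f (j.2.toNat)) (f 0)) :
    ∃ c, ∀ y : ℕ, f y = c * hFun μ μ₀ t a (0, y) := by
  have hpa : phi μ a = t := frontier_eq μ hn h3 t a haF
  obtain ⟨α, β⟩ := a
  set b := betaBar μ t α with hbdef
  have hab : abar μ t (α, β) = (α, b) := rfl
  obtain ⟨hpb, hmin⟩ := betaBar_spec μ hn h3 t α hd β hpa.le
  rw [← hbdef] at hpb hmin
  have hbβ : b ≤ β := hmin β hpa.le
  have hd' : ∃ j : Zd d, 0 < μ j ∧ j.2 ≠ 0 := by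
    obtain ⟨j, h1, h2⟩ := hd; exact ⟨j, h1, by omega⟩
  have hu0' : ∃ j : Zd d, 0 < μ₀ j ∧ j.2 ≠ 0 := by
    obtain ⟨j, h1, h2⟩ := hu0; exact ⟨j, h1, by omega⟩
  have hOD := od_concrete hn h3 h0.1 t ht α b hpb hd hu
  have hHar := har_concrete h0.1 t α b f hf
  have hg0 : ∀ y : ℕ, 0 ≤ f y * Real.exp (-b * y) := fun y => mul_nonneg (hf0 y) (Real.exp_pos _).le
  have hexp : ∀ y : ℕ, Real.exp (-b * y) * Real.exp (b * y) = 1 := fun y => by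
    rw [← Real.exp_add]; simp
  have hdE : ∀ (s : ℝ) (y : ℕ), dotE (α, s) ((0, y) : Ed d) = s * y := fun s y => by simp [dotE]
  have hup0 : ∀ s, 0 < dBeta (phi μ₀) (α, s) := fun s => phi0_dBeta_pos μ₀ hn0 h3' h0.2 hu0 _
  rw [hab] at hb0
  simp only [] at hf hfb
  by_cases hz : ((α, β) : Rd d) ∈ dZero μ t
  · -- the tangent case
    have hdz : dBeta (phi μ) (α, β) = 0 := hz.2
    have hbe : b = β := by
      by_contra hne
      have := phi_tangent_lt μ hn h3 α β b (Ne.symm hne) hd'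
      rw [hdz, hpa, hpb] at this
      linarith
    have hsum : HasSum (fun j : Zd d => μ j / t * Real.exp (dotZ (α, b) j) * geoS 1 ((j.2 + 1).toNat)) 1 := by
      have := ((dBeta_hasSum μ hn h3 (α, b)).div_const t).add ((phi_hasSum μ h3 (α, b)).div_const t)
      rw [hpb, div_self ht.ne', hbe, hdz, zero_div, zero_add] at this
      refine this.congr_fun fun j => ?_
      rw [geoS_one]
      rcases lt_or_ge j.2 (-1) with hj | hj
      · simp [h0.1 j hj]
      · rw [toNat_real' hj, hbe]; ring
    obtain ⟨c, hc⟩ := hHar.classify hOD le_rfl hsum hg0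
    have hfy : ∀ y : ℕ, f y = f 0 * Real.exp (b * y) + c * (y * Real.exp (b * y)) := by
      intro y
      have := hc y
      rw [geoS_one] at this
      simp only [Nat.cast_zero, mul_zero, Real.exp_zero, mul_one] at this
      calc f y = (f y * Real.exp (-b * y)) * Real.exp (b * y) := by rw [mul_assoc, hexp, mul_one]
        _ = _ := by rw [this]; ring
    have hbd := ((bdry_exp hn0 h3' h0.2 t α b).mul_left (f 0)).add
      ((bdry_exp' hn0 h3' h0.2 t α b).mul_left c)
    have heq := hfb.unique (hbd.congr_fun fun j => by rw [hfy]; ring)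
    rw [← hbe] at hz ⊢
    have heq' : f 0 * (t - phi μ₀ (α, b)) = c * dBeta (phi μ₀) (α, b) := by
      field_simp at heq; linarith
    rcases hb0.lt_or_eq with hlt | he
    · refine ⟨c, fun y => ?_⟩
      have hne : t - phi μ₀ (α, b) ≠ 0 := by linarith
      have hab' : ((α, b) : Rd d) = abar μ t (α, b) := rfl
      rw [hFun, if_neg (by simp [hz]), if_pos ⟨hab', hz, hlt⟩, hdE]
      have : f 0 = c * (dBeta (phi μ₀) (α, b) / (t - phi μ₀ (α, b))) := by
        field_simp; linarith
      rw [hfy, this]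
      ring
    · refine ⟨f 0, fun y => ?_⟩
      rw [he, sub_self, mul_zero] at heq'
      have hc0 : c = 0 := by
        rcases mul_eq_zero.1 heq'.symm with h | h
        · exact h
        · exact absurd h (hup0 b).ne'
      have hab' : abar μ t ((α, b) : Rd d) = (α, b) := rfl
      rw [hFun, if_neg (by simp [hz]), if_neg (by simp [he]), hab', hdE]
      rw [hfy, hc0]
      ring
  · have hdp : dBeta (phi μ) (α, β) ≠ 0 := fun h => hz ⟨haF, h⟩
    have hdp' : 0 < dBeta (phi μ) (α, β) := lt_of_le_of_ne hdb hdp.symm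
    have hlt : b < β := by
      refine lt_of_le_of_ne hbβ fun he => ?_
      -- the derivative would allow going lower
      have h1 : HasFDerivAt (phi μ) (fderiv ℝ (phi μ) (α, β)) (α, β) :=
        (phi_hasFDeriv μ hn h3 (α, β)).1.differentiableAt.hasFDerivAt
      have h2 : HasDerivAt (fun s : ℝ => ((α, s) : Rd d)) (0, 1) β :=
        (hasDerivAt_const β α).prodMk (hasDerivAt_id β)
      have h3 : HasDerivAt (fun s : ℝ => phi μ (α, s)) (dBeta (phi μ) (α, β)) β :=
        h1.comp_hasDerivAt β h2
      have h4 := h3.tendsto_slope.eventually (lt_mem_nhds hdp')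
      have h5 : ∀ᶠ s in nhdsWithin β (Set.Iio β), 0 < slope (fun s : ℝ => phi μ (α, s)) β s :=
        h4.filter_mono (nhdsWithin_mono _ fun s hs => ne_of_lt hs)
      obtain ⟨s, hs1, hs2⟩ := (h5.and self_mem_nhdsWithin).exists
      have hs2' : s < β := hs2
      rw [slope_def_field, hpa] at hs1
      have h6 : phi μ (α, s) < t := by
        by_contra h
        push Not at h
        have : (phi μ (α, s) - t) / (s - β) ≤ 0 := div_nonpos_of_nonneg_of_nonpos (by linarith) (by linarith)
        linarith
      have := hmin s h6.le
      linarith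
    set r := Real.exp (β - b) with hr
    have hr1 : 1 < r := Real.one_lt_exp_iff.2 (by linarith)
    have hr1' : r - 1 ≠ 0 := by linarith
    have hsum : HasSum (fun j : Zd d => μ j / t * Real.exp (dotZ (α, b) j) * geoS r ((j.2 + 1).toNat)) 1 := by
      have h1 := sum_pow hn h3 h0.1 t α b (β - b)
      rw [add_sub_cancel, hpa, div_self ht.ne', one_mul] at h1
      have h2 := (h1.sub hOD.one).div_const (r - 1)
      rw [← hr, div_self hr1'] at h2
      refine h2.congr_fun fun j => ?_
      rw [eq_div_iff hr1', mul_assoc, geoS_mul]; ring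
    obtain ⟨c, hc⟩ := hHar.classify hOD hr1.le hsum hg0
    obtain ⟨c1, c2, hfy⟩ : ∃ c1 c2 : ℝ, ∀ y : ℕ, f y = c1 * Real.exp (β * y) + c2 * Real.exp (b * y) := by
      refine ⟨c / (r - 1), f 0 - c / (r - 1), fun y => ?_⟩
      have := hc y
      simp only [Nat.cast_zero, mul_zero, Real.exp_zero, mul_one] at this
      have hg : geoS r y = (r ^ y - 1) / (r - 1) := by rw [eq_div_iff hr1', geoS_mul]
      have hry : Real.exp (β * y) = r ^ y * Real.exp (b * y) := by
        rw [hr, ← Real.exp_nat_mul, ← Real.exp_add]; congr 1; ring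
      calc f y = (f y * Real.exp (-b * y)) * Real.exp (b * y) := by rw [mul_assoc, hexp, mul_one]
        _ = _ := by rw [this, hg, hry]; ring
    have hbd := ((bdry_exp hn0 h3' h0.2 t α β).mul_left c1).add
      ((bdry_exp hn0 h3' h0.2 t α b).mul_left c2)
    have heq := hfb.unique (hbd.congr_fun fun j => by rw [hfy]; ring)
    have hf0 : f 0 = c1 + c2 := by rw [hfy]; simp
    have heq' : c1 * (t - phi μ₀ (α, β)) + c2 * (t - phi μ₀ (α, b)) = 0 := by
      rw [hf0] at heq
      field_simp at heq; linarith
    rcases hb0.lt_or_eq with hl | he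
    · refine ⟨c1, fun y => ?_⟩
      have hne : t - phi μ₀ (α, b) ≠ 0 := by linarith
      rw [hFun, if_pos ⟨hz, by rw [hab]; exact hl⟩, hab, hdE, hdE]
      have : c2 = - (c1 * ((t - phi μ₀ (α, β)) / (t - phi μ₀ (α, b)))) := by
        field_simp; linarith
      rw [hfy, this]
      ring
    · refine ⟨c2, fun y => ?_⟩
      have h7 := phi_tangent_lt μ₀ hn0 h3' α b β hlt.ne hu0'
      have h8 := hup0 b
      have h9 : t < phi μ₀ (α, β) := by nlinarith
      rw [he, sub_self, mul_zero, add_zero] at heq'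
      have hc0 : c1 = 0 := by
        rcases mul_eq_zero.1 heq' with h | h
        · exact h
        · linarith
      rw [hFun, if_neg (by rw [hab]; simp [he]), if_neg (by simp [hz]), hab, hdE]
      rw [hfy, hc0]
      ring

lemma hFun_split (t : ℝ) (a : Rd d) (z : Ed d) :
    hFun μ μ₀ t a z = Real.exp (dotE (a.1, 0) z) * hFun μ μ₀ t a (0, z.2) := by
  have e : ∀ s, Real.exp (dotE (a.1, s) z) = Real.exp (dotE (a.1, 0) z) * Real.exp (dotE (a.1, s) ((0, z.2) : Ed d)) := by
    intro s
    rw [← Real.exp_add]; congr 1; simp [dotE]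
  have e1 : Real.exp (dotE a z) = _ := e a.2
  have e2 : Real.exp (dotE (abar μ t a) z) = _ := e (betaBar μ t a.1)
  have e3 : dotE a ((0, z.2) : Ed d) = dotE (a.1, a.2) ((0, z.2) : Ed d) := rfl
  have e4 : dotE (abar μ t a) ((0, z.2) : Ed d) = dotE (a.1, betaBar μ t a.1) ((0, z.2) : Ed d) := rfl
  simp only [hFun]
  rw [e1, e2, e3, e4]
  split_ifs <;> ring

end ident

section mainaux
variable {d : ℕ}

lemma euclNorm_nonneg (v : Rd d) : 0 ≤ euclNorm v := Real.sqrt_nonneg _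

lemma euclNorm_sq (v : Rd d) : euclNorm v ^ 2 = dotR v v := by
  rw [euclNorm, Real.sq_sqrt (by positivity), dotR]
  simp only [sq]

lemma abs_fst_le (v : Rd d) (i : Fin d) : |v.1 i| ≤ euclNorm v := by
  refine abs_le_of_sq_le_sq ?_ (euclNorm_nonneg v)
  rw [euclNorm, Real.sq_sqrt (by positivity)]
  have := Finset.single_le_sum (f := fun i => v.1 i ^ 2) (fun i _ => sq_nonneg _) (Finset.mem_univ i)
  have := sq_nonneg v.2
  linarith

lemma abs_snd_le (v : Rd d) : |v.2| ≤ euclNorm v := by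
  refine abs_le_of_sq_le_sq ?_ (euclNorm_nonneg v)
  rw [euclNorm, Real.sq_sqrt (by positivity)]
  have : 0 ≤ ∑ i, v.1 i ^ 2 := by positivity
  linarith

lemma norm_le_euclNorm (v : Rd d) : ‖v‖ ≤ euclNorm v := by
  rw [Prod.norm_def, max_le_iff]
  exact ⟨(pi_norm_le_iff_of_nonneg (euclNorm_nonneg v)).2 fun i => abs_fst_le v i, abs_snd_le v⟩

lemma unit_norm (v : Rd d) : ‖(euclNorm v)⁻¹ • v‖ ≤ 1 := by
  rw [norm_smul, Real.norm_of_nonneg (inv_nonneg.2 (euclNorm_nonneg v)), inv_mul_eq_div]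
  exact div_le_one_of_le₀ (norm_le_euclNorm v) (euclNorm_nonneg v)

lemma unit_dot (v : Rd d) (h : 0 < euclNorm v) :
    dotR ((euclNorm v)⁻¹ • v) ((euclNorm v)⁻¹ • v) = 1 := by
  have e : dotR ((euclNorm v)⁻¹ • v) ((euclNorm v)⁻¹ • v) = (euclNorm v)⁻¹ ^ 2 * dotR v v := by
    simp only [dotR, Prod.smul_fst, Prod.smul_snd, Pi.smul_apply, smul_eq_mul, mul_add, Finset.mul_sum]
    congr 1
    · refine Finset.sum_congr rfl fun i _ => ?_
      ring
    · ring
  rw [e, ← euclNorm_sq, ← mul_pow, inv_mul_cancel₀ h.ne', one_pow]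

lemma dotR_le_eucl (w c : Rd d) : dotR w c ≤ euclNorm w * (∑ i, |c.1 i| + |c.2| + 1) := by
  have h1 : ∀ i, w.1 i * c.1 i ≤ euclNorm w * |c.1 i| := fun i => by
    refine (le_abs_self _).trans ?_
    rw [abs_mul]
    exact mul_le_mul_of_nonneg_right (abs_fst_le w i) (abs_nonneg _)
  have h2 : w.2 * c.2 ≤ euclNorm w * |c.2| := by
    refine (le_abs_self _).trans ?_
    rw [abs_mul]
    exact mul_le_mul_of_nonneg_right (abs_snd_le w) (abs_nonneg _)
  have h3 := Finset.sum_le_sum fun i (_ : i ∈ Finset.univ) => h1 i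
  rw [← Finset.mul_sum] at h3
  have := euclNorm_nonneg w
  rw [dotR, mul_add, mul_add]
  linarith

lemma cone_dist {μ μ₀ : Zd d → ℝ} {t : ℝ} {a a' : Rd d} (h : a' ∈ Hhat μ μ₀ t) (v : Rd d) :
    dotR v (a' - a) ≤ distTo (Vcone μ μ₀ t a) v * (∑ i, |(a' - a).1 i| + |(a' - a).2| + 1) := by
  have hC : 0 < ∑ i, |(a' - a).1 i| + |(a' - a).2| + 1 := by positivity
  rw [← div_le_iff₀ hC]
  refine le_csInf ⟨_, ⟨0, ?_, rfl⟩⟩ ?_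
  · intro a'' _
    simp [dotR]
  · rintro _ ⟨w, hw, rfl⟩
    rw [div_le_iff₀ hC]
    refine le_trans ?_ (dotR_le_eucl (v - w) (a' - a))
    have h1 := hw a' h
    have h2 : dotR v (a' - a) = dotR w (a' - a) + dotR (v - w) (a' - a) := by
      generalize a' - a = c
      simp only [dotR, Prod.fst_sub, Prod.snd_sub, Pi.sub_apply, sub_mul, Finset.sum_sub_distrib]
      ring
    linarith

lemma dotR_comm (v w : Rd d) : dotR v w = dotR w v := by
  simp only [dotR, mul_comm]

lemma dotR_sub' (v w u : Rd d) : dotR v (w - u) = dotR w v - dotR u v := by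
  rw [dotR_comm]
  simp only [dotR, Prod.fst_sub, Prod.snd_sub, Pi.sub_apply, sub_mul, Finset.sum_sub_distrib]
  ring

end mainaux

/-- Theorem 1 (ii): under (H0)-(H4), for `t > ρ(P)`, `a ∈ Γ₊^t` and
any sequence `z_n ∈ ℤ^{d-1} × ℕ` with `|z_n| → ∞` and `dist(V_t(a), z_n/|z_n|) → 0`,
the Martin kernels `K_t(z, z_n)` converge to `h_{a,t}(z)/h_{a,t}(z₀)`. -/
theorem martin_kernel_convergence {d : ℕ} (μ μ₀ : Zd d → ℝ)
    (hμ : IsMeasure μ) (hμ₀ : IsMeasure μ₀)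
    (h0 : H0 μ μ₀) (h1 : H1 μ μ₀) (h2 : H2 μ) (h3 : H3 μ) (h3' : H3 μ₀) (h4 : H4 μ)
    (t : ℝ) (ht : rho μ μ₀ < t)
    (a : Rd d) (ha : a ∈ GammaPlus μ μ₀ t)
    (z₀ : Ed d) (zseq : ℕ → Ed d)
    (hnorm : Tendsto (fun n => euclNorm (vecE (zseq n))) atTop atTop)
    (hdir : Tendsto
      (fun n => distTo (Vcone μ μ₀ t a) ((euclNorm (vecE (zseq n)))⁻¹ • vecE (zseq n)))
      atTop (nhds 0)) :
    ∀ z : Ed d, Tendsto (fun n => martin μ μ₀ t z₀ z (zseq n)) atTop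
      (nhds (hFun μ μ₀ t a z / hFun μ μ₀ t a z₀)) := by
  obtain ⟨hn, -, hs⟩ := hμ
  obtain ⟨hn0, -, hs0⟩ := hμ₀
  obtain ⟨htp, H⟩ := chain_concrete hn hn0 h0 h3 h3' hs hs0 h1 h2 t ht
  obtain ⟨⟨haT, haD⟩, haF, hdb⟩ := ha
  have hd : ∃ j : Zd d, 0 < μ j ∧ j.2 = -1 := by
    obtain ⟨j, hj, hj2⟩ := H.down; exact ⟨j, (Mt_ne_zero μ t htp j).1 hj, hj2⟩
  have hu : ∃ j : Zd d, 0 < μ j ∧ 0 < j.2 := by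
    obtain ⟨j, hj, hj2⟩ := H.up; exact ⟨j, (Mt_ne_zero μ t htp j).1 hj, hj2⟩
  have hu0 : ∃ j : Zd d, 0 < μ₀ j ∧ 0 < j.2 := by
    obtain ⟨j, hj, hj2⟩ := H.up0; exact ⟨j, (Mt_ne_zero μ₀ t htp j).1 hj, hj2⟩
  obtain ⟨hpb, hmin⟩ := betaBar_spec μ hn h3 t a.1 hd a.2 haD
  have hb0 : phi μ₀ (a.1, betaBar μ t a.1) ≤ t := by
    obtain ⟨b, hb1, hb2⟩ := theta_exists hn hn0 h0 h3 h3' t htp H a.1 haT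
    exact (phi0_mono μ₀ hn0 h3' h0.2 a.1 (hmin b hb1)).trans hb2
  intro z
  rw [tendsto_iff_ultrafilter]
  intro U hU
  -- direction
  set N : ℕ → ℝ := fun n => euclNorm (vecE (zseq n)) with hN
  set v : ℕ → Rd d := fun n => (N n)⁻¹ • vecE (zseq n) with hv
  obtain ⟨q, -, hq⟩ := (isCompact_closedBall (0 : Rd d) 1).ultrafilter_le_nhds (U.map v) (by
    rw [Ultrafilter.coe_map, le_principal_iff, mem_map]
    refine univ_mem' fun n => ?_
    simp only [Set.mem_preimage, mem_closedBall_zero_iff]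
    exact unit_norm _)
  have hq' : Tendsto v U (nhds q) := by rwa [Ultrafilter.coe_map] at hq
  have hNU : Tendsto N U atTop := hnorm.mono_left hU
  have hDir : DirH (Mt μ t) (Mt μ₀ t) a q (U : Filter ℕ) zseq N :=
    { q2 := by
        have h := (continuous_snd.tendsto q).comp hq'
        refine ge_of_tendsto' h fun n => ?_
        simp only [Function.comp, hv, vecE, Prod.smul_snd, smul_eq_mul]
        exact mul_nonneg (inv_nonneg.2 (euclNorm_nonneg _)) (Nat.cast_nonneg _)
      qq := by
        have hc : Continuous fun q : Rd d => dotR q q := by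
          unfold dotR; fun_prop
        have h := (hc.tendsto q).comp hq'
        have h' : Tendsto ((fun q : Rd d => dotR q q) ∘ v) U (nhds 1) := by
          refine tendsto_const_nhds.congr' ?_
          filter_upwards [hNU.eventually (eventually_gt_atTop 0)] with n hn'
          exact (unit_dot _ hn').symm
        rw [tendsto_nhds_unique h h']; exact one_pos
      cone := by
        rintro a' ⟨b, hb1, hb2⟩ ha'
        have hm : a' ∈ Hhat μ μ₀ t :=
          ⟨mem_Theta_of μ μ₀ hn t a'.1 b ((pm_Mt_le μ hn h3 t htp _).1 hb1)
            ((pm_Mt_le μ₀ hn0 h3' t htp _).1 hb2), (pm_Mt_le μ hn h3 t htp _).1 ha'⟩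
        have hc : Continuous fun q : Rd d => dotR q (a' - a) := by
          unfold dotR; fun_prop
        have h := (hc.tendsto q).comp hq'
        have h' := (hdir.mono_left hU).mul_const (∑ i, |(a' - a).1 i| + |(a' - a).2| + 1)
        rw [zero_mul] at h'
        have := le_of_tendsto_of_tendsto' h h' fun n => cone_dist hm (v n)
        rw [dotR_sub'] at this
        linarith
      inf := hNU
      lim := hq' }
  obtain ⟨h, hlim, hz0, hnn, hhar, hsft⟩ := limit_fun H hDir ((pm_Mt_le μ hn h3 t htp _).2 haD)
    (betaBar μ t a.1) ((pm_Mt_le μ hn h3 t htp _).2 hpb.le) ((pm_Mt_le μ₀ hn0 h3' t htp _).2 hb0) z₀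
  have hf : ∀ z, h z = Real.exp (dotE (a.1, 0) z) * (fun y : ℕ => h (0, y)) z.2 := by
    intro z
    have := hsft z.1 (0, z.2)
    rw [sft_apply] at this
    simp only [zero_add] at this
    rw [show z = (z.1, z.2) from rfl, this]
    simp [dotE, bd]
  obtain ⟨e1, e0⟩ := limit_eqs H a.1 h hhar (fun y : ℕ => h (0, y)) hf
  simp only [Mt_toReal μ hn t htp, Mt_toReal μ₀ hn0 t htp] at e1 e0
  obtain ⟨c, hc⟩ := identify hn hn0 h0 h3 h3' t htp a haF hdb hb0 hd hu hu0 (fun y => h (0, y))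
    (fun y => hnn _) e1 e0
  have hch : ∀ z, h z = c * hFun μ μ₀ t a z := by
    intro z
    rw [hf z, hFun_split t a z]
    simp only [hc]; ring
  have hval : h z = hFun μ μ₀ t a z / hFun μ μ₀ t a z₀ := by
    rw [hch z₀] at hz0
    have hne : hFun μ μ₀ t a z₀ ≠ 0 := fun h => by rw [h, mul_zero] at hz0; exact zero_ne_one hz0
    rw [hch z, eq_div_iff hne]
    calc _ = (c * hFun μ μ₀ t a z₀) * hFun μ μ₀ t a z := by ring
      _ = _ := by rw [hz0, one_mul]
  rw [← hval]
  refine (hlim z).congr fun n => ?_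
  rw [martin, green_eq hn hn0 h0 h3 h3' t htp, green_eq hn hn0 h0 h3 h3' t htp]


end RWHalfspace
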